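/- Fix ε > 0. There are an absolute constant c > 0 and constants c(ε), C(ε) > 0 such that for all x ≥ 2 and all s with ε/log x ≤ s ≤ 1: log G₂(s,x) = (1/2)·∫_{√x}^{x} dt/( t^{2s} log t ) · (1 + θ) with |θ| ≤ C(ε)( L(x)^{−c} + x^{−s} ), and c(ε)·(x^{1−2s} − x^{1/2−s})/((1−2s) log x) ≤ log G₂(s,x) ≤ C(ε)·(x^{1−2s} − x^{1/2−s})/((1−2s) log x), where at s = 1/2 the quotient (x^{1−2s} − x^{1/2−s})/((1−2s) log x) is interpreted as its limiting value 1/2. -/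

import Mathlib

open Real

/-- `log G₂(s,x) = ∑_{k ≥ 2} ∑_{x^{1/k} < p ≤ x} p^{-ks}/k`. -/
noncomputable def logG2 (s x : ℝ) : ℝ :=
  ∑' k : ℕ, ∑ p ∈ Nat.primesBelow (⌊x⌋₊ + 1),
    if 2 ≤ k ∧ x ^ ((k : ℝ)⁻¹) < (p : ℝ) then (p : ℝ) ^ (-(k : ℝ) * s) / k else 0

/-- `L(x) = exp((log x)^{3/5} (log log x)^{-1/5})`. -/
noncomputable def Lfun (x : ℝ) : ℝ :=
  Real.exp ((Real.log x) ^ ((3 : ℝ) / 5) * (Real.log (Real.log x)) ^ (-(1 : ℝ) / 5))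

namespace VK
open Finset Real
open Complex (I I_im I_re add_re add_im ofReal_re ofReal_im mul_re mul_im norm_real norm_natCast_cpow_of_pos mem_reProdIm cpow_neg sub_re reCLM neg_re abs_re_le_norm abs_im_le_norm sq_norm re_ofReal_mul one_im norm_cpow_eq_rpow_re_of_pos)
lemma newton_prod {R : Type*} [CommRing R] {k : Nat} (x y : Fin k → R)
    (hu : ∀ j : Nat, 1 <= j → j <= k → IsUnit (j : R))
    (h : ∀ j : Nat, 1 <= j → j <= k → ∑ i, x i ^ j = ∑ i, y i ^ j) (z : R) :
    ∏ i, (z - x i) = ∏ i, (z - y i) := by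
  have key : ∀ j : Nat, j <= k → (univ.val.map x).esymm j = (univ.val.map y).esymm j := by
    intro j
    induction j using Nat.strong_induction_on with
    | _ j ih =>
      intro hj
      rcases Nat.eq_zero_or_pos j with rfl | hpos
      · simp [Multiset.esymm]
      · have e := fun w : Fin k → R => congrArg (MvPolynomial.aeval w)
          (MvPolynomial.mul_esymm_eq_sum (Fin k) R j)
        simp only [map_mul, map_natCast, map_pow, map_neg, map_one, map_sum,
          MvPolynomial.aeval_esymm_eq_multiset_esymm] at e
        apply (hu j hpos hj).mul_left_cancel
        rw [e x, e y]
        congr 1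
        apply sum_congr rfl
        intro a ha
        rw [mem_filter, HasAntidiagonal.mem_antidiagonal] at ha
        obtain ⟨ha1, ha2⟩ := ha
        rw [ih a.1 ha2 (by omega)]
        congr 1
        simp only [MvPolynomial.psum, map_sum, map_pow, MvPolynomial.aeval_X]
        exact h a.2 (by omega) (by omega)
  have e2 : ∀ w : Fin k → R, ∏ i, (z - w i) =
      ∑ j ∈ range (k + 1), (-1) ^ j * ((univ.val.map w).esymm j * z ^ (k - j)) := by
    intro w
    have := congrArg (Polynomial.eval z) (Multiset.prod_X_sub_X_eq_sum_esymm (univ.val.map w))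
    rw [Multiset.map_map, Multiset.card_map, Polynomial.eval_finsetSum] at this
    have h3 : (Multiset.map ((fun t => Polynomial.X - Polynomial.C t) ∘ w) univ.val).prod =
      ∏ i, (Polynomial.X - Polynomial.C (w i)) := rfl
    rw [h3, Polynomial.eval_prod] at this
    simpa only [Polynomial.eval_sub, Polynomial.eval_X, Polynomial.eval_C, Polynomial.eval_mul,
      Polynomial.eval_pow, Polynomial.eval_neg, Polynomial.eval_one, card_val,
      card_univ, Fintype.card_fin] using this
  rw [e2 x, e2 y]
  apply sum_congr rfl
  intro j hj
  rw [key j (by simp at hj; omega)]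

lemma linnik_perm {p k : Nat} (hp : p.Prime) (hk : k < p) (x y : Fin k → Int)
    (hx : ∀ i j, i ≠ j → ¬ (p:Int) ∣ x i - x j)
    (h : ∀ j : Nat, 1 <= j → j <= k → (p:Int) ^ k ∣ ∑ i, x i ^ j - ∑ i, y i ^ j) (l : Fin k) :
    ∃ i, (p:Int) ^ k ∣ y l - x i := by
  have hP : Prime (p:Int) := Nat.prime_iff_prime_int.mp hp
  have h1 : ∏ i, (((y l : Int) : ZMod (p ^ k)) - (x i : ZMod (p ^ k))) =
      ∏ i, (((y l : Int) : ZMod (p ^ k)) - (y i : ZMod (p ^ k))) := by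
    apply newton_prod
    · intro j h1 h2
      rw [ZMod.isUnit_iff_coprime]
      apply Nat.Coprime.pow_right
      exact (Nat.coprime_of_lt_prime (by omega) (by omega) hp).symm
    · intro j h1 h2
      have := h j h1 h2
      rw [<- sub_eq_zero]
      have h3 := (ZMod.intCast_zmod_eq_zero_iff_dvd (∑ i, x i ^ j - ∑ i, y i ^ j) (p ^ k)).2
        (by exact_mod_cast this)
      simpa using h3
  have h2 : (p:Int) ^ k ∣ ∏ i, (y l - x i) := by
    have := (ZMod.intCast_zmod_eq_zero_iff_dvd (∏ i, (y l - x i)) (p ^ k)).1 (by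
      push_cast
      rw [h1]
      exact Finset.prod_eq_zero (Finset.mem_univ l) (by simp))
    exact_mod_cast this
  have h3 : (p:Int) ∣ ∏ i, (y l - x i) := by
    refine dvd_trans (dvd_pow_self _ ?_) h2
    have := l.2
    omega
  obtain ⟨i, -, hi⟩ := (Prime.dvd_finsetProd_iff hP _).1 h3
  refine ⟨i, ?_⟩
  rw [<- mul_prod_erase _ _ (mem_univ i)] at h2
  refine IsCoprime.dvd_of_dvd_mul_right (IsCoprime.pow_left ?_) h2
  rw [Prime.coprime_iff_not_dvd hP, Prime.dvd_finsetProd_iff hP]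
  rintro ⟨j, hj, hd⟩
  have hji : j ≠ i := by simpa using hj
  apply hx j i hji
  have := dvd_sub hi hd
  simpa using this

lemma linnik {p k N : Nat} (hp : p.Prime) (hk : k < p) (hN : N <= p ^ k) (a:Int) (c : Fin k → Int) :
    Finset.card {n : Fin k → Fin N | (∀ i j, i ≠ j → ¬ (p:Int) ∣ ((n i : Nat) : Int) - ((n j : Nat) : Int)) ∧
      ∀ j : Fin k, (p:Int) ^ (j.val + 1) ∣ ∑ i, (((n i : Nat) : Int) - a) ^ (j.val + 1) - c j} <=
      p ^ (k * (k - 1) / 2) * k.factorial := by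
  classical
  have : ∀ m, NeZero (p ^ m) := fun m => ⟨pow_ne_zero _ hp.ne_zero⟩
  set S : Finset (Fin k → Fin N) := {n : Fin k → Fin N | (∀ i j, i ≠ j → ¬ (p:Int) ∣ ((n i : Nat) : Int) - ((n j : Nat) : Int)) ∧
      ∀ j : Fin k, (p:Int) ^ (j.val + 1) ∣ ∑ i, (((n i : Nat) : Int) - a) ^ (j.val + 1) - c j} with hS
  let f : (Fin k → Fin N) → (∀ j : Fin k, ZMod (p ^ (k - 1 - j.val))) := fun n j =>
    (((∑ i, (((n i : Nat) : Int) - a) ^ (j.val + 1) - c j) / p ^ (j.val + 1) : Int) : ZMod _)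
  have hcard : Fintype.card (∀ j : Fin k, ZMod (p ^ (k - 1 - j.val))) = p ^ (k * (k - 1) / 2) := by
    rw [Fintype.card_pi]
    simp only [ZMod.card]
    rw [Finset.prod_pow_eq_pow_sum]
    congr 1
    rw [Fin.sum_univ_eq_sum_range (fun j => k - 1 - j), Finset.sum_range_reflect (fun j => j),
      Finset.sum_range_id]
  rw [<- hcard, <- Finset.card_univ, mul_comm]
  apply card_le_mul_card_image_of_maps_to (f := f) (fun _ _ => mem_univ _)
  intro b _
  rcases (S.filter (fun n => f n = b)).eq_empty_or_nonempty with h0 | ⟨n0, hn0⟩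
  · simp [h0]
  have hfac : k.factorial = (univ : Finset (Equiv.Perm (Fin k))).card := by
    rw [Finset.card_univ, Fintype.card_perm, Fintype.card_fin]
  rw [hfac]
  apply card_le_card_of_surjOn (fun σ : Equiv.Perm (Fin k) => n0 ∘ σ)
  intro n hn
  simp only [coe_filter, Set.mem_ofPred_eq] at hn hn0
  rw [mem_filter] at hn0
  obtain ⟨hn1, hn2⟩ := hn
  obtain ⟨hn01, hn02⟩ := hn0
  simp only [hS, mem_filter, mem_univ, true_and] at hn1 hn01
  have hdiv : ∀ j : Nat, 1 <= j → j <= k → (p:Int) ^ k ∣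
      ∑ i, (((n0 i : Nat) : Int) - a) ^ j - ∑ i, (((n i : Nat) : Int) - a) ^ j := by
    intro j h1 h2
    obtain ⟨j, rfl⟩ : ∃ i, j = i + 1 := ⟨j - 1, by omega⟩
    have e : f n0 ⟨j, by omega⟩ = f n ⟨j, by omega⟩ := by rw [hn02, hn2]
    obtain ⟨u, hu⟩ := hn01.2 ⟨j, by omega⟩
    obtain ⟨v, hv⟩ := hn1.2 ⟨j, by omega⟩
    have hpp : (p:Int) ^ (j + 1) ≠ 0 := pow_ne_zero _ (by exact_mod_cast hp.ne_zero)
    simp only [f] at e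
    simp only at hu hv
    rw [hu, hv, Int.mul_ediv_cancel_left _ hpp, Int.mul_ediv_cancel_left _ hpp] at e
    have e' := (ZMod.intCast_eq_intCast_iff_dvd_sub _ _ _).1 e
    obtain ⟨w, hw⟩ := e'
    have hk' : (p:Int) ^ k = p ^ (j + 1) * p ^ (k - 1 - j) := by
      rw [<- pow_add]; congr 1; omega
    refine ⟨-w, ?_⟩
    push_cast at hw
    rw [hk']
    linear_combination hu - hv - p ^ (j + 1) * hw
  have hex := linnik_perm hp hk (fun i => ((n0 i : Nat) : Int) - a) (fun i => ((n i : Nat) : Int) - a)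
    (by intro i j hij; simpa using hn01.1 i j hij) hdiv
  have hex' : ∀ l, ∃ i, n l = n0 i := by
    intro l
    obtain ⟨i, hi⟩ := hex l
    refine ⟨i, ?_⟩
    rw [sub_sub_sub_cancel_right] at hi
    have h1 : (((n l : Nat) : Int) - ((n0 i : Nat) : Int)) = 0 := by
      apply Int.eq_zero_of_abs_lt_dvd hi
      have a1 := (n l).2
      have a2 := (n0 i).2
      have a3 : (N:Int) <= (p:Int) ^ k := by exact_mod_cast hN
      rw [abs_lt]
      constructor <;> omega
    apply Fin.ext
    omega
  choose σ hσ using hex'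
  have hinj : Function.Injective σ := by
    intro l l' hll
    by_contra hne
    apply hn1.1 l l' hne
    rw [hσ l, hσ l', hll]
    simp
  refine ⟨Equiv.ofBijective σ ((Fintype.bijective_iff_injective_and_card σ).2 ⟨hinj, rfl⟩),
    by simp, ?_⟩
  funext l
  simp [hσ l]

open Classical in
noncomputable def cnt {X Y H : Type*} (S : Finset X) (T : Finset Y) (f : X → H) (g : Y → H) : Nat :=
  Finset.card {q ∈ S ×ˢ T | f q.1 = g q.2}

def ts {A H : Type*} [AddCommMonoid H] {b : Nat} (w : A → H) (n : Fin b → A) : H := ∑ i, w (n i)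

lemma char_sum {H ι : Type*} [AddCommGroup H] (ψ : AddChar H Complex) (s : Finset ι) (f : ι → H) :
    ψ (∑ i ∈ s, f i) = ∏ i ∈ s, ψ (f i) := by
  classical
  induction s using Finset.induction_on with
  | empty => simp
  | insert a s ha ih => rw [sum_insert ha, prod_insert ha, AddChar.map_add_eq_mul, ih]

lemma cnt_fourier {X Y H : Type*} [AddCommGroup H] [Fintype H] (S : Finset X) (T : Finset Y)
    (f : X → H) (g : Y → H) :
    (cnt S T f g : Complex) * Fintype.card H =
      ∑ ψ : AddChar H Complex, (∑ x ∈ S, ψ (f x)) * (starRingEnd Complex) (∑ y ∈ T, ψ (g y)) := by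
  classical
  have h1 : ∀ ψ : AddChar H Complex, (∑ x ∈ S, ψ (f x)) * (starRingEnd Complex) (∑ y ∈ T, ψ (g y)) =
      ∑ q ∈ S ×ˢ T, ψ (f q.1 - g q.2) := by
    intro ψ
    rw [map_sum, Finset.sum_mul_sum, Finset.sum_product]
    refine sum_congr rfl fun x _ => sum_congr rfl fun y _ => ?_
    rw [sub_eq_add_neg, AddChar.map_add_eq_mul, AddChar.map_neg_eq_conj]
  simp_rw [h1]
  rw [Finset.sum_comm]
  simp_rw [AddChar.sum_apply_eq_ite, sub_eq_zero]
  rw [<- Finset.sum_filter, Finset.sum_const, nsmul_eq_mul, cnt]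

lemma cnt_self_fourier {X H : Type*} [AddCommGroup H] [Fintype H] (S : Finset X) (f : X → H) :
    (cnt S S f f : Real) * Fintype.card H = ∑ ψ : AddChar H Complex, ‖∑ x ∈ S, ψ (f x)‖ ^ 2 := by
  have := cnt_fourier S S f f
  apply Complex.ofReal_injective
  push_cast
  rw [this]
  refine sum_congr rfl fun ψ _ => ?_
  rw [Complex.mul_conj, Complex.normSq_eq_norm_sq]
  push_cast
  rfl

lemma sum_tuple {A H : Type*} [Fintype A] [AddCommGroup H] (w : A → H) (b:Nat) (ψ : AddChar H Complex) :
    ∑ n : Fin b → A, ψ (ts w n) = (∑ a, ψ (w a)) ^ b := by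
  simp_rw [ts, char_sum]
  rw [Fintype.sum_pow]

lemma cnt_tuple_fourier {A H : Type*} [Fintype A] [AddCommGroup H] [Fintype H] (w : A → H)
    (b:Nat) :
    (cnt (univ : Finset (Fin b → A)) (univ : Finset (Fin b → A)) (ts w) (ts w) : Real)
      * Fintype.card H = ∑ ψ : AddChar H Complex, ‖∑ a, ψ (w a)‖ ^ (2 * b) := by
  rw [cnt_self_fourier]
  refine sum_congr rfl fun ψ _ => ?_
  rw [sum_tuple, norm_pow, <- pow_mul, mul_comm]

lemma sum_coin {A H : Type*} [Fintype A] [DecidableEq A] [AddCommGroup H] (w : A → H) (b:Nat)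
    (i j : Fin b)
    (hij : i ≠ j) (ψ : AddChar H Complex) :
    ∑ n : Fin b → A with n i = n j, ψ (ts w n) =
      (∑ a, ψ (w a) ^ 2) * (∑ a, ψ (w a)) ^ (b - 2) := by
  classical
  have h1 : ∀ n : Fin b → A, (if n i = n j then ψ (ts w n) else 0) =
      ∑ a, ∏ l, (if l = i ∨ l = j then (if n l = a then ψ (w a) else 0) else ψ (w (n l))) := by
    intro n
    rw [ts, char_sum]
    split_ifs with h
    · rw [sum_eq_single (n i)]
      · refine prod_congr rfl fun l _ => ?_
        split_ifs with h1 h2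
        · rw [h2]
        · rcases h1 with rfl | rfl
          · exact absurd rfl h2
          · exact absurd h.symm h2
        · rfl
      · intro a _ ha
        apply prod_eq_zero (mem_univ i)
        rw [if_pos (Or.inl rfl), if_neg (Ne.symm ha)]
      · simp
    · symm
      apply sum_eq_zero
      intro a _
      by_cases ha : n i = a
      · apply prod_eq_zero (mem_univ j)
        rw [if_pos (Or.inr rfl), if_neg]
        rintro rfl
        exact h ha
      · apply prod_eq_zero (mem_univ i)
        rw [if_pos (Or.inl rfl), if_neg ha]
  rw [Finset.sum_filter]
  simp_rw [h1]
  rw [Finset.sum_comm, Finset.sum_mul]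
  refine sum_congr rfl fun a _ => ?_
  have h2 := prod_univ_sum (fun _ : Fin b => (univ : Finset A))
    (fun l c => (if l = i ∨ l = j then (if c = a then ψ (w a) else 0) else ψ (w c)))
  rw [Fintype.piFinset_univ] at h2
  rw [<- h2]
  have h3 : ∀ l : Fin b, (∑ c, (if l = i ∨ l = j then (if c = a then ψ (w a) else 0) else ψ (w c)))
      = if l = i ∨ l = j then ψ (w a) else ∑ c, ψ (w c) := by
    intro l
    split_ifs <;> simp
  simp_rw [h3]
  rw [Finset.prod_ite, Finset.prod_const, Finset.prod_const]
  have h4 : (univ.filter (fun l : Fin b => l = i ∨ l = j)) = {i, j} := by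
    ext l; simp
  have h5 : (univ.filter (fun l : Fin b => ¬ (l = i ∨ l = j))).card = b - 2 := by
    have := Finset.card_filter_add_card_filter_not (s := (univ : Finset (Fin b)))
      (fun l : Fin b => l = i ∨ l = j)
    rw [h4, card_pair hij, card_univ, Fintype.card_fin] at this
    omega
  rw [h4, Finset.card_pair hij, h5]

lemma young_aux {x y B : Real} (hx : 0 <= x) (hy : 0 <= y) (hB : 1 <= B) {b : Nat} (hb : 2 <= b) :
    x * y ^ (b - 2) * y ^ b <= (x ^ (2 * b) + y ^ (2 * b)) / B + B ^ (2 * b) := by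
  have h1 : x * y ^ (b - 2) * y ^ b <= max x y ^ (2 * b - 1) := by
    have : max x y ^ (2 * b - 1) = max x y * max x y ^ (b - 2) * max x y ^ b := by
      rw [<- pow_succ', <- pow_add]; congr 1; omega
    rw [this]
    gcongr <;> simp
  have h2 : max x y ^ (2 * b) <= x ^ (2 * b) + y ^ (2 * b) := by
    rcases max_choice x y with h | h <;> rw [h]
    · linarith [pow_nonneg hy (2 * b)]
    · linarith [pow_nonneg hx (2 * b)]
  have hB0 : 0 < B := by linarith
  have h3 : 0 <= (x ^ (2 * b) + y ^ (2 * b)) / B := by positivity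
  rcases le_total B (max x y) with h | h
  · have : max x y ^ (2 * b - 1) <= (x ^ (2 * b) + y ^ (2 * b)) / B := by
      rw [le_div_iff₀ hB0]
      calc max x y ^ (2 * b - 1) * B <= max x y ^ (2 * b - 1) * max x y := by gcongr
        _ = max x y ^ (2 * b) := by rw [<- pow_succ]; congr 1; omega
        _ <= _ := h2
    linarith [pow_nonneg hB0.le (2 * b)]
  · have : max x y ^ (2 * b - 1) <= B ^ (2 * b) :=
      calc max x y ^ (2 * b - 1) <= B ^ (2 * b - 1) := by gcongr
        _ <= B ^ (2 * b) := by gcongr; all_goals omega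
    linarith

lemma coin_bound {A H : Type*} [Fintype A] [DecidableEq A] [AddCommGroup H] [Fintype H] (w : A → H)
    (h2 : ∀ h : H, ∃ g, g + g = h)
    {b : Nat} (hb : 2 <= b) (i j : Fin b) (hij : i ≠ j) {B : Real} (hB : 1 <= B) :
    (cnt {n : Fin b → A | n i = n j} (univ : Finset (Fin b → A)) (ts w) (ts w) : Real) <=
    2 * (cnt (univ : Finset (Fin b → A)) (univ : Finset (Fin b → A)) (ts w) (ts w) : Real)
      / B + B ^ (2 * b) := by
  classical
  have hcard : (0:Real) < Fintype.card H := by exact_mod_cast Fintype.card_pos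
  have key := cnt_fourier {n : Fin b → A | n i = n j} (univ : Finset (Fin b → A)) (ts w)
    (ts w)
  simp_rw [sum_tuple, sum_coin w b i j hij] at key
  have hJ := cnt_tuple_fourier w b
  set J := cnt (univ : Finset (Fin b → A)) (univ : Finset (Fin b → A)) (ts w) (ts w)
  set E := cnt {n : Fin b → A | n i = n j} (univ : Finset (Fin b → A)) (ts w) (ts w)
  have hinj : Function.Injective (fun ψ : AddChar H Complex => ψ ^ 2) := by
    intro ψ φ h
    ext a
    obtain ⟨g, rfl⟩ := h2 a
    have := DFunLike.congr_fun h g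
    simp only [AddChar.pow_apply] at this
    rw [AddChar.map_add_eq_mul, AddChar.map_add_eq_mul, <- sq, <- sq, this]
  have hbij : Function.Bijective (fun ψ : AddChar H Complex => ψ ^ 2) := Finite.injective_iff_bijective.1 hinj
  have hsq : ∑ ψ : AddChar H Complex, ‖∑ a, ψ (w a) ^ 2‖ ^ (2 * b) =
      ∑ ψ : AddChar H Complex, ‖∑ a, ψ (w a)‖ ^ (2 * b) := by
    rw [<- hbij.sum_comp (fun ψ : AddChar H Complex => ‖∑ a, ψ (w a)‖ ^ (2 * b))]
    simp only [AddChar.pow_apply]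
  have hE : E * Fintype.card H <=
      ∑ ψ : AddChar H Complex, ‖∑ a, ψ (w a) ^ 2‖ * ‖∑ a, ψ (w a)‖ ^ (b - 2) * ‖∑ a, ψ (w a)‖ ^ b := by
    have h3 : E * Fintype.card H = ‖(E:Complex) * Fintype.card H‖ := by simp
    rw [h3, key]
    refine (norm_sum_le _ _).trans (le_of_eq ?_)
    refine sum_congr rfl fun ψ _ => ?_
    rw [norm_mul, RCLike.norm_conj, norm_mul, norm_pow, norm_pow]
  have hE2 := hE.trans (sum_le_sum fun ψ _ => young_aux (norm_nonneg _) (norm_nonneg _) hB hb)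
  rw [sum_add_distrib, <- sum_div, sum_add_distrib, hsq, <- hJ, sum_const,
    card_univ, AddChar.card_eq, nsmul_eq_mul] at hE2
  have : (E:Real) * Fintype.card H <= (2 * J / B + B ^ (2 * b)) * Fintype.card H := by grind
  exact le_of_mul_le_mul_right this hcard
/-- Hölder over classes. -/

lemma class_bound {A H X : Type*} [Fintype A] [AddCommGroup H] [Fintype H] (w : A → H)
    (D : Finset X) (wD : X → H) (s p : Nat) (r : A → Fin p) :
    p * cnt (D ×ˢ (univ : Finset (Fin s → A))) (D ×ˢ (univ : Finset (Fin s → A)))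
      (fun q => wD q.1 + ts w q.2) (fun q => wD q.1 + ts w q.2) <=
    p ^ (2 * s) * ∑ a : Fin p, cnt (D ×ˢ Fintype.piFinset (fun _ : Fin s => univ.filter (r · = a)))
      (D ×ˢ Fintype.piFinset (fun _ : Fin s => univ.filter (r · = a)))
      (fun q => wD q.1 + ts w q.2) (fun q => wD q.1 + ts w q.2) := by
  classical
  have hcard : (0:Real) < Fintype.card H := by exact_mod_cast Fintype.card_pos
  have hs : ∀ (U : Finset A) (ψ : AddChar H Complex),
      ∑ q ∈ D ×ˢ Fintype.piFinset (fun _ : Fin s => U), ψ (wD q.1 + ts w q.2) =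
      (∑ x ∈ D, ψ (wD x)) * (∑ a ∈ U, ψ (w a)) ^ s := by
    intro U ψ
    rw [Finset.sum_product, Finset.sum_mul]
    refine sum_congr rfl fun x _ => ?_
    simp_rw [AddChar.map_add_eq_mul, ts, char_sum]
    rw [<- Finset.mul_sum, Finset.sum_pow']
  have e1 := cnt_self_fourier (D ×ˢ Fintype.piFinset (fun _ : Fin s => (univ : Finset A)))
    (fun q => wD q.1 + ts w q.2)
  have e2 := fun a : Fin p => cnt_self_fourier
    (D ×ˢ Fintype.piFinset (fun _ : Fin s => univ.filter (r · = a)))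
    (fun q => wD q.1 + ts w q.2)
  simp_rw [hs] at e1 e2
  rw [Fintype.piFinset_univ] at e1
  have main : p * (cnt (D ×ˢ (univ : Finset (Fin s → A))) (D ×ˢ (univ : Finset (Fin s → A)))
      (fun q => wD q.1 + ts w q.2) (fun q => wD q.1 + ts w q.2) * Fintype.card H : Real) <=
    p ^ (2 * s) * ∑ a : Fin p, (cnt (D ×ˢ Fintype.piFinset (fun _ : Fin s => univ.filter (r · = a)))
      (D ×ˢ Fintype.piFinset (fun _ : Fin s => univ.filter (r · = a)))
      (fun q => wD q.1 + ts w q.2) (fun q => wD q.1 + ts w q.2) * Fintype.card H : Real) := by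
    simp_rw [e1, e2]
    rw [Finset.sum_comm, Finset.mul_sum, Finset.mul_sum]
    refine sum_le_sum fun ψ _ => ?_
    have h3 : ∑ a, ψ (w a) = ∑ c : Fin p, ∑ a with r a = c, ψ (w a) := by
      rw [Finset.sum_fiberwise]
    have h4 : p * ‖∑ a, ψ (w a)‖ ^ (2 * s) <=
        p ^ (2 * s) * ∑ c : Fin p, ‖∑ a with r a = c, ψ (w a)‖ ^ (2 * s) := by
      rcases Nat.eq_zero_or_pos s with rfl | hspos
      · simp
      · obtain ⟨m, hm⟩ : ∃ m, 2 * s = m + 1 := ⟨2 * s - 1, by omega⟩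
        have h5 := pow_sum_le_card_mul_sum_pow (s := (univ : Finset (Fin p)))
          (f := fun c => ‖∑ a with r a = c, ψ (w a)‖) (fun _ _ => norm_nonneg _) m
        rw [card_univ, Fintype.card_fin] at h5
        rw [hm, pow_succ (p:Real), mul_assoc, mul_left_comm]
        gcongr
        refine le_trans ?_ h5
        gcongr
        rw [h3]
        exact norm_sum_le _ _
    simp only [norm_mul, mul_pow, norm_pow, <- pow_mul, mul_comm s 2]
    rw [<- Finset.mul_sum]
    nlinarith
  rw [<- sum_mul, <- mul_assoc, <- mul_assoc] at main
  have := le_of_mul_le_mul_right main hcard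
  exact_mod_cast this

lemma cnt_congr {X Y H H' : Type*} {S : Finset X} {T : Finset Y} {f : X → H} {g : Y → H}
    {f' : X → H'} {g' : Y → H'} (h : ∀ x ∈ S, ∀ y ∈ T, f x = g y ↔ f' x = g' y) :
    cnt S T f g = cnt S T f' g' := by
  unfold cnt
  congr 1
  ext q
  simp only [mem_filter, mem_product]
  exact and_congr_right fun hq => h _ hq.1 _ hq.2

lemma cnt_symm {X Y H : Type*} (S : Finset X) (T : Finset Y) (f : X → H) (g : Y → H) :
    cnt S T f g = cnt T S g f := by
  classical
  unfold cnt
  apply card_bij (fun q _ => (q.2, q.1))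
  · intro q; simp only [mem_filter, mem_product]; tauto
  · rintro ⟨a, b⟩ _ ⟨c, d⟩ _; simp only [Prod.mk.injEq]; tauto
  · rintro ⟨a, b⟩ h
    refine ⟨(b, a), ?_, rfl⟩
    simp only [mem_filter, mem_product] at h ⊢
    tauto

lemma cnt_eq_sum {X Y H : Type*} [DecidableEq H] (S : Finset X) (T : Finset Y) (f : X → H)
    (g : Y → H) (I : Finset H) (hI : ∀ x ∈ S, f x ∈ I) :
    cnt S T f g = ∑ h ∈ I, (S.filter (f · = h)).card * (T.filter (g · = h)).card := by
  classical
  unfold cnt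
  rw [Finset.card_eq_sum_card_fiberwise (f := fun q => f q.1) (t := I)]
  · refine sum_congr rfl fun h _ => ?_
    rw [<- Finset.card_product]
    congr 1
    ext q
    simp only [mem_filter, mem_product]
    constructor
    · rintro ⟨⟨h1, h2⟩, h3⟩
      exact ⟨⟨h1.1, h3⟩, h1.2, by rw [<- h2, h3]⟩
    · rintro ⟨⟨h1, h2⟩, h3, h4⟩
      exact ⟨⟨⟨h1, h3⟩, by rw [h2, h4]⟩, h2⟩
  · intro q hq
    simp only [coe_filter, mem_product, Set.mem_ofPred_eq] at hq
    exact hI _ hq.1.1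

lemma cnt_le {X Y H : Type*} (S : Finset X) (T : Finset Y) (f : X → H) (g : Y → H) :
    2 * cnt S T f g <= cnt S S f f + cnt T T g g := by
  classical
  have h1 : ∀ x ∈ S, f x ∈ S.image f ∪ T.image g := fun x hx =>
    mem_union_left _ (mem_image_of_mem f hx)
  have h2 : ∀ x ∈ T, g x ∈ S.image f ∪ T.image g := fun x hx =>
    mem_union_right _ (mem_image_of_mem g hx)
  rw [cnt_eq_sum S T f g _ h1, cnt_eq_sum S S f f _ h1, cnt_eq_sum T T g g _ h2,
    <- Finset.sum_add_distrib, Finset.mul_sum]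
  refine sum_le_sum fun h _ => ?_
  zify
  nlinarith [sq_nonneg (((S.filter (f · = h)).card : Int) - ((T.filter (g · = h)).card : Int))]

lemma cnt_shift_le {X H : Type*} [AddCommGroup H] (S : Finset X) (f : X → H) (l : H) :
    cnt S S f (fun x => f x + l) <= cnt S S f f := by
  have h := cnt_le S S f (fun x => f x + l)
  have : cnt S S (fun x => f x + l) (fun x => f x + l) = cnt S S f f :=
    cnt_congr (fun x _ y _ => by simp)
  omega

def zk (k:Nat) (z:Int) : Fin k → Int := fun j => z ^ (j.val + 1)

def wZ (k:Nat) {N : Nat} (a : Fin N) : Fin k → Int := zk k ((a:Nat) : Int)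

noncomputable def Jc (s k N : Nat) : Nat :=
  cnt (univ : Finset (Fin s → Fin N)) (univ : Finset (Fin s → Fin N)) (ts (wZ k)) (ts (wZ k))

lemma ts_wZ {s k N : Nat} (n : Fin s → Fin N) (j : Fin k) :
    ts (wZ k) n j = ∑ i, ((n i : Nat) : Int) ^ (j.val + 1) := by
  simp [ts, wZ, zk, Finset.sum_apply]

lemma power_shift {ι : Type*} [Fintype ι] {k : Nat} (x y : ι → Int) (c:Int)
    (h : ∀ j : Nat, 1 <= j → j <= k → ∑ i, x i ^ j = ∑ i, y i ^ j) (j:Nat) (hj : j <= k) :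
    ∑ i, (x i + c) ^ j = ∑ i, (y i + c) ^ j := by
  simp_rw [add_pow]
  rw [Finset.sum_comm, Finset.sum_comm (s := univ) (t := range (j + 1)) (f := fun i m => y i ^ m * _ * _)]
  refine sum_congr rfl fun m hm => ?_
  simp_rw [<- sum_mul]
  congr 2
  rcases Nat.eq_zero_or_pos m with rfl | hpos
  · simp
  · exact h m hpos (by simp at hm; omega)

def Dp (k N p : Nat) : Finset (Fin k → Fin N) :=
  {n | ∀ i j, i ≠ j → ¬ (p:Int) ∣ ((n i : Nat) : Int) - ((n j : Nat) : Int)}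

lemma class_J {s k N p : Nat} (hp : 0 < p) (a : Fin p) (r : Fin N → Fin p)
    (hr : ∀ x, ((r x : Nat)) = (x:Nat) % p) :
    cnt (Fintype.piFinset (fun _ : Fin s => univ.filter (r · = a)))
      (Fintype.piFinset (fun _ : Fin s => univ.filter (r · = a))) (ts (wZ k)) (ts (wZ k)) <=
      Jc s k (N / p + 1) := by
  classical
  have hrep : ∀ x : Fin N, r x = a → (x:Int) = p * ((x / p : Nat) : Int) + (a:Int) := by
    intro x hx
    rw [<- hx, hr]
    exact_mod_cast (Nat.div_add_mod x p).symm
  unfold Jc cnt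
  let g : Fin N → Fin (N / p + 1) := fun x => ⟨x / p, Nat.lt_succ_of_le (Nat.div_le_div_right x.2.le)⟩
  apply card_le_card_of_injOn (fun q => (g ∘ q.1, g ∘ q.2))
  · rintro ⟨u, v⟩ h
    simp only [coe_filter, mem_product, Fintype.mem_piFinset, mem_filter, mem_univ, true_and,
      Set.mem_ofPred_eq] at h ⊢
    obtain ⟨⟨hu, hv⟩, h⟩ := h
    funext j
    rw [ts_wZ, ts_wZ]
    have h1 := power_shift (k := k) (fun i => ((u i : Nat) : Int)) (fun i => ((v i : Nat) : Int)) (-(a:Int))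
      (by
        intro j h1 h2
        have := congrFun h ⟨j - 1, by omega⟩
        rw [ts_wZ, ts_wZ] at this
        simpa [Nat.sub_add_cancel h1] using this) (j.val + 1) (by omega)
    have h2 : ∀ z : Fin s → Fin N, (∀ i, r (z i) = a) → ∑ i, (((z i : Nat) : Int) + -(a:Int)) ^ (j.val + 1)
        = p ^ (j.val + 1) * ∑ i, (((g (z i) : Nat)) : Int) ^ (j.val + 1) := by
      intro z hz
      rw [Finset.mul_sum]
      refine sum_congr rfl fun i _ => ?_
      rw [hrep _ (hz i), add_neg_cancel_right, mul_pow]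
    rw [h2 u hu, h2 v hv] at h1
    exact mul_left_cancel₀ (pow_ne_zero _ (by exact_mod_cast hp.ne')) h1
  · rintro ⟨u, v⟩ h ⟨u', v'⟩ h' he
    simp only [coe_filter, mem_product, Fintype.mem_piFinset, mem_filter, mem_univ, true_and,
      Set.mem_ofPred_eq] at h h'
    have hinj : ∀ x y : Fin N, r x = a → r y = a → g x = g y → x = y := by grind
    simp only [Prod.mk.injEq] at he ⊢
    constructor
    · funext i
      exact hinj _ _ (h.1.1 i) (h'.1.1 i) (congrFun he.1 i)
    · funext i
      exact hinj _ _ (h.1.2 i) (h'.1.2 i) (congrFun he.2 i)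

lemma Ca_bound {s k N p : Nat} (hp : p.Prime) (hk : k < p) (hN : N <= p ^ k) (a : Fin p)
    (r : Fin N → Fin p) (hr : ∀ x, ((r x : Nat)) = (x:Nat) % p) :
    cnt (Dp k N p ×ˢ Fintype.piFinset (fun _ : Fin s => univ.filter (r · = a)))
      (Dp k N p ×ˢ Fintype.piFinset (fun _ : Fin s => univ.filter (r · = a)))
      (fun q => ts (wZ k) q.1 + ts (wZ k) q.2) (fun q => ts (wZ k) q.1 + ts (wZ k) q.2) <=
    Jc s k (N / p + 1) * (p ^ (k * (k - 1) / 2) * k.factorial * N ^ k) := by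
  classical
  set W := Fintype.piFinset (fun _ : Fin s => univ.filter (r · = a)) with hW
  have hdvd : ∀ x : Fin N, r x = a → (p:Int) ∣ (x:Int) + -(a:Int) := by
    intro x hx
    rw [<- hx, hr, <- sub_eq_add_neg]
    exact Int.dvd_self_sub_emod
  let Q : Finset ((Fin k → Fin N) × (Fin k → Fin N)) := {q | q.1 ∈ Dp k N p ∧
    ∀ j : Fin k, (p:Int) ^ (j.val + 1) ∣ ∑ i, (((q.1 i : Nat) : Int) - (a:Int)) ^ (j.val + 1) -
      ∑ i, (((q.2 i : Nat) : Int) - (a:Int)) ^ (j.val + 1)}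
  have hQ : Q.card <= p ^ (k * (k - 1) / 2) * k.factorial * N ^ k := by
    have hc : (univ : Finset (Fin k → Fin N)).card = N ^ k := by simp
    rw [<- hc]
    apply card_le_mul_card_image_of_maps_to (f := fun q => q.2) (fun _ _ => mem_univ _)
    intro m _
    refine le_trans ?_ (linnik hp hk hN (a:Int)
      (fun j => ∑ i, (((m i : Nat) : Int) - (a:Int)) ^ (j.val + 1)))
    apply card_le_card_of_injOn (fun q => q.1)
    · rintro ⟨n, m'⟩ h
      simp only [coe_filter, mem_filter, mem_univ, true_and, Q, Dp, Set.mem_ofPred_eq] at h ⊢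
      obtain ⟨h, rfl⟩ := h
      exact h
    · rintro ⟨n, m'⟩ h ⟨n', m''⟩ h' e
      simp only [coe_filter, Set.mem_ofPred_eq] at h h' e
      rw [e, h.2, h'.2]
  refine le_trans ?_ (Nat.mul_le_mul_left _ hQ)
  unfold cnt
  apply card_le_mul_card_image_of_maps_to (f := fun q => (q.1.1, q.2.1))
  · rintro ⟨⟨n, u⟩, ⟨m, v⟩⟩ h
    simp only [mem_filter, mem_product] at h
    obtain ⟨⟨⟨hn, hu⟩, hm, hv⟩, h⟩ := h
    simp only [hW, Fintype.mem_piFinset, mem_filter, mem_univ, true_and] at hu hv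
    simp only [Q, mem_filter, mem_univ, true_and]
    refine ⟨hn, fun j => ?_⟩
    have h1 := power_shift (k := k) (Sum.elim (fun i => ((n i : Nat) : Int)) (fun i => ((u i : Nat) : Int)))
      (Sum.elim (fun i => ((m i : Nat) : Int)) (fun i => ((v i : Nat) : Int))) (-(a:Int))
      (by
        intro j h1 h2
        have := congrFun h ⟨j - 1, by omega⟩
        simp only [Pi.add_apply] at this
        rw [ts_wZ, ts_wZ, ts_wZ, ts_wZ] at this
        simpa [Nat.sub_add_cancel h1] using this) (j.val + 1) (by omega)
    simp only [Fintype.sum_sum_type, Sum.elim_inl, Sum.elim_inr] at h1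
    have h2 : ∀ z : Fin s → Fin N, (∀ i, r (z i) = a) → (p:Int) ^ (j.val + 1) ∣
        ∑ i, (((z i : Nat) : Int) + -(a:Int)) ^ (j.val + 1) := by
      intro z hz
      exact dvd_sum fun i _ => pow_dvd_pow_of_dvd (hdvd _ (hz i)) _
    have h3 := dvd_sub (h2 v hv) (h2 u hu)
    simp only [sub_eq_add_neg] at h3 ⊢
    refine h3.trans (dvd_of_eq ?_)
    linear_combination -h1
  · rintro ⟨n, m⟩ -
    refine le_trans ?_ (class_J (s := s) (k := k) hp.pos a r hr)
    refine le_trans ?_ (cnt_shift_le W (ts (wZ k)) (ts (wZ k) m - ts (wZ k) n))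
    unfold cnt
    apply card_le_card_of_injOn (fun q => (q.1.2, q.2.2))
    · rintro ⟨⟨n', u⟩, ⟨m', v⟩⟩ h
      simp only [coe_filter, mem_filter, mem_product, Set.mem_ofPred_eq, Prod.mk.injEq] at h ⊢
      obtain ⟨⟨⟨⟨-, hu⟩, -, hv⟩, h⟩, rfl, rfl⟩ := h
      refine ⟨⟨hu, hv⟩, ?_⟩
      linear_combination h
    · rintro ⟨⟨n', u⟩, ⟨m', v⟩⟩ h ⟨⟨n'', u'⟩, ⟨m'', v'⟩⟩ h' e
      simp only [coe_filter, Set.mem_ofPred_eq, Prod.mk.injEq] at h h' e ⊢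
      obtain ⟨-, h1, h2⟩ := h
      obtain ⟨-, h3, h4⟩ := h'
      exact ⟨⟨h1.trans h3.symm, e.1⟩, h2.trans h4.symm, e.2⟩

def cH (k M : Nat) (u : Fin k → Int) : Fin k → ZMod M := fun j => (u j : ZMod M)

lemma cH_inj {k M : Nat} {u v : Fin k → Int} (hu : ∀ j, 0 <= u j ∧ u j < M) (hv : ∀ j, 0 <= v j ∧ v j < M) :
    u = v ↔ cH k M u = cH k M v := by
  constructor
  · rintro rfl; rfl
  · intro h
    funext j
    have := congrFun h j
    simp only [cH] at this
    rw [ZMod.intCast_eq_intCast_iff] at this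
    rw [Int.ModEq, Int.emod_eq_of_lt (hu j).1 (hu j).2, Int.emod_eq_of_lt (hv j).1 (hv j).2] at this
    exact this

lemma cH_add {k M : Nat} (u v : Fin k → Int) : cH k M (u + v) = cH k M u + cH k M v := by
  funext j; simp [cH]

lemma cH_ts {k M N b : Nat} (n : Fin b → Fin N) :
    cH k M (ts (wZ k) n) = ts (fun a => cH k M (wZ k a)) n := by
  funext j; simp [cH, ts, Finset.sum_apply, wZ, zk]

lemma ts_range {k N b : Nat} (n : Fin b → Fin N) (j : Fin k) :
    0 <= ts (wZ k) n j ∧ ts (wZ k) n j <= (b * N ^ k : Nat) := by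
  rw [ts_wZ]
  constructor
  · positivity
  · push_cast
    calc _ <= ∑ i : Fin b, (N:Int) ^ k := by
          refine sum_le_sum fun i _ => ?_
          have h1 : ((n i : Nat) : Int) <= N := by omega
          have h2 : (1:Int) <= N := by omega
          calc ((n i : Nat) : Int) ^ (j.val + 1) <= N ^ (j.val + 1) := by gcongr
            _ <= N ^ k := pow_le_pow_right₀ h2 (by omega)
      _ = _ := by simp

lemma dbl {k c : Nat} (h : Fin k → ZMod (2 * c + 1)) : ∃ g, g + g = h := by
  refine ⟨fun j => ((c + 1 : Nat) : ZMod (2 * c + 1)) * h j, ?_⟩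
  funext j
  have h0 : ((2 * c + 1 : Nat) : ZMod (2 * c + 1)) = 0 := ZMod.natCast_self _
  push_cast at h0
  simp only [Pi.add_apply]
  push_cast
  linear_combination (h j) * h0

lemma coin_J {k s N : Nat} (hk : 2 <= k) (i j : Fin (k + s)) (hij : i ≠ j) {B : Real} (hB : 1 <= B) :
    (cnt {n : Fin (k + s) → Fin N | n i = n j} (univ : Finset (Fin (k + s) → Fin N)) (ts (wZ k)) (ts (wZ k)) : Real) <=
      2 * (Jc (k + s) k N) / B + B ^ (2 * (k + s)) := by
  have hc : ∀ S T : Finset (Fin (k + s) → Fin N), cnt S T (ts (wZ k)) (ts (wZ k)) =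
      cnt S T (ts (fun a => cH k (2 * ((k + s) * N ^ k) + 1) (wZ k a)))
        (ts (fun a => cH k (2 * ((k + s) * N ^ k) + 1) (wZ k a))) := by
    intro S T
    refine cnt_congr fun n _ m _ => ?_
    rw [<- cH_ts, <- cH_ts]
    apply cH_inj
    · intro j; have := ts_range n j; push_cast at this ⊢; constructor <;> linarith
    · intro j; have := ts_range m j; push_cast at this ⊢; constructor <;> linarith
  unfold Jc
  rw [hc, hc]
  exact coin_bound _ dbl (by omega) i j hij hB

lemma T_bound {s k N p : Nat} (hp : p.Prime) (hk : k < p) (hN : N <= p ^ k) :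
    cnt (Dp k N p ×ˢ (univ : Finset (Fin s → Fin N))) (Dp k N p ×ˢ (univ : Finset (Fin s → Fin N)))
      (fun q => ts (wZ k) q.1 + ts (wZ k) q.2) (fun q => ts (wZ k) q.1 + ts (wZ k) q.2) <=
    p ^ (2 * s) * (Jc s k (N / p + 1) * (p ^ (k * (k - 1) / 2) * k.factorial * N ^ k)) := by
  let r : Fin N → Fin p := fun x => ⟨x % p, Nat.mod_lt _ hp.pos⟩
  have hr : ∀ x, ((r x : Nat)) = x % p := fun x => rfl
  set M := 2 * ((k + s) * N ^ k) + 1 with hM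
  have hc : ∀ W : Finset (Fin s → Fin N), cnt (Dp k N p ×ˢ W) (Dp k N p ×ˢ W)
      (fun q => ts (wZ k) q.1 + ts (wZ k) q.2) (fun q => ts (wZ k) q.1 + ts (wZ k) q.2) =
      cnt (Dp k N p ×ˢ W) (Dp k N p ×ˢ W)
      (fun q => cH k M (ts (wZ k) q.1) + ts (fun a => cH k M (wZ k a)) q.2)
      (fun q => cH k M (ts (wZ k) q.1) + ts (fun a => cH k M (wZ k a)) q.2) := by
    intro W
    refine cnt_congr fun n _ m _ => ?_
    rw [<- cH_ts, <- cH_ts, <- cH_add, <- cH_add]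
    have : ∀ q : (Fin k → Fin N) × (Fin s → Fin N), ∀ j, 0 <= (ts (wZ k) q.1 + ts (wZ k) q.2) j ∧
        (ts (wZ k) q.1 + ts (wZ k) q.2) j < M := by
      intro q j
      have h1 := ts_range q.1 j
      have h2 := ts_range q.2 j
      rw [hM]
      simp only [Pi.add_apply]
      push_cast at *
      constructor
      · linarith
      · nlinarith
    exact cH_inj (this n) (this m)
  have h := class_bound (fun a => cH k M (wZ k a)) (Dp k N p) (fun x => cH k M (ts (wZ k) x)) s p r
  rw [<- hc] at h
  simp_rw [<- hc] at h
  have h2 : ∑ a : Fin p, cnt (Dp k N p ×ˢ Fintype.piFinset (fun _ : Fin s => univ.filter (r · = a)))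
      (Dp k N p ×ˢ Fintype.piFinset (fun _ : Fin s => univ.filter (r · = a)))
      (fun q => ts (wZ k) q.1 + ts (wZ k) q.2) (fun q => ts (wZ k) q.1 + ts (wZ k) q.2) <=
      p * (Jc s k (N / p + 1) * (p ^ (k * (k - 1) / 2) * k.factorial * N ^ k)) := by
    refine (sum_le_sum fun a _ => Ca_bound hp hk hN a r hr).trans ?_
    simp
  refine Nat.le_of_mul_le_mul_left ?_ hp.pos
  refine h.trans ((Nat.mul_le_mul_left _ h2).trans (le_of_eq ?_))
  ring

lemma exists_good_prime {k N : Nat} {P : Finset Nat} (hk : 1 <= k) (hP : ∀ p ∈ P, p.Prime ∧ N < p ^ k)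
    (hcard : 2 * k ^ 3 <= P.card) (hN : 1 <= N) (n m : Fin k → Fin N)
    (hn : ∀ i j, i ≠ j → n i ≠ n j) (hm : ∀ i j, i ≠ j → m i ≠ m j) :
    ∃ p ∈ P, n ∈ Dp k N p ∧ m ∈ Dp k N p := by
  classical
  by_contra hcon
  push Not at hcon
  let F : (Fin k → Fin N) → Int := fun n => ∏ q ∈ (univ : Finset (Fin k)).offDiag,
    (((n q.1 : Nat) : Int) - ((n q.2 : Nat) : Int))
  have hF0 : ∀ n : Fin k → Fin N, (∀ i j, i ≠ j → n i ≠ n j) → F n ≠ 0 := by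
    intro n hn
    refine prod_ne_zero_iff.2 fun q hq => ?_
    rw [mem_offDiag] at hq
    intro h
    apply hn _ _ hq.2.2
    apply Fin.ext
    have := sub_eq_zero.1 h
    exact_mod_cast this
  have hFle : ∀ n : Fin k → Fin N, (F n).natAbs <= N ^ (k ^ 2) := by
    intro n
    have h1 : (F n).natAbs = ∏ q ∈ (univ : Finset (Fin k)).offDiag,
        (((n q.1 : Nat) : Int) - ((n q.2 : Nat) : Int)).natAbs := map_prod Int.natAbsHom _ _
    rw [h1]
    refine (prod_le_pow_card _ _ N fun q _ => ?_).trans ?_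
    · have := (n q.1).2; have := (n q.2).2; omega
    · apply Nat.pow_le_pow_right hN
      rw [offDiag_card]; simp [sq]
  have hFd : ∀ (n : Fin k → Fin N) p, n ∉ Dp k N p → (p:Int) ∣ F n := by
    intro n p h
    simp only [Dp, mem_filter, mem_univ, true_and, not_forall, not_not] at h
    obtain ⟨i, j, hij, h⟩ := h
    exact h.trans (dvd_prod_of_mem (fun q : Fin k × Fin k => (((n q.1 : Nat) : Int) - ((n q.2 : Nat) : Int)))
      (a := (i, j)) (by simp [hij]))
  have hd : ∏ p ∈ P, p ∣ (F n * F m).natAbs := by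
    apply prod_primes_dvd
    · intro p hp; exact (hP p hp).1.prime
    · intro p hp
      rw [<- Int.natCast_dvd]
      by_cases h : n ∈ Dp k N p
      · exact (hFd m p (hcon p hp h)).mul_left _
      · exact (hFd n p h).mul_right _
  have hle := Nat.le_of_dvd (Int.natAbs_pos.2 (mul_ne_zero (hF0 n hn) (hF0 m hm))) hd
  rw [Int.natAbs_mul] at hle
  have h2 : (∏ p ∈ P, p) ^ k <= N ^ (2 * k ^ 3) := by
    calc _ <= (N ^ (k ^ 2) * N ^ (k ^ 2)) ^ k := Nat.pow_le_pow_left (hle.trans (Nat.mul_le_mul (hFle n) (hFle m))) k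
      _ = _ := by ring
  have h3 : N ^ (2 * k ^ 3) < (∏ p ∈ P, p) ^ k := by
    rw [<- Finset.prod_pow]
    have hPne : P.Nonempty := by
      rw [<- Finset.card_pos]; exact lt_of_lt_of_le (by positivity) hcard
    calc N ^ (2 * k ^ 3) <= N ^ P.card := Nat.pow_le_pow_right hN hcard
      _ = ∏ p ∈ P, N := by simp
      _ < _ := Finset.prod_lt_prod_of_nonempty (fun _ _ => hN) (fun p hp => (hP p hp).2) hPne
  omega

lemma vstep {k s N : Nat} (hk : 2 <= k) (hN : 1 <= N) (P : Finset Nat)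
    (hP : ∀ p ∈ P, p.Prime ∧ k < p ∧ N < p ^ k) (hcard : 2 * k ^ 3 <= P.card) :
    (Jc (k + s) k N : Real) <= 4 * k ^ 2 * (8 * k ^ 2) ^ (2 * (k + s)) +
      2 * ∑ p ∈ P, (p:Real) ^ (2 * s) * (Jc s k (N / p + 1) * (p ^ (k * (k - 1) / 2) * k.factorial * N ^ k)) := by
  classical
  set E : Fin k × Fin k → Nat := fun q => cnt {n : Fin (k + s) → Fin N | n (Fin.castAdd s q.1) = n (Fin.castAdd s q.2)}
      (univ : Finset (Fin (k + s) → Fin N)) (ts (wZ k)) (ts (wZ k)) with hE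
  have key : Jc (k + s) k N <= ∑ q ∈ (univ : Finset (Fin k)).offDiag, 2 * E q +
      ∑ p ∈ P, cnt (Dp k N p ×ˢ (univ : Finset (Fin s → Fin N))) (Dp k N p ×ˢ (univ : Finset (Fin s → Fin N)))
      (fun q => ts (wZ k) q.1 + ts (wZ k) q.2) (fun q => ts (wZ k) q.1 + ts (wZ k) q.2) := by
    let hd : (Fin (k + s) → Fin N) → (Fin k → Fin N) := fun n i => n (Fin.castAdd s i)
    let tl : (Fin (k + s) → Fin N) → (Fin s → Fin N) := fun n i => n (Fin.natAdd k i)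
    let A : Fin k × Fin k → Finset ((Fin (k + s) → Fin N) × (Fin (k + s) → Fin N)) := fun q =>
      {z | hd z.1 q.1 = hd z.1 q.2 ∧ ts (wZ k) z.1 = ts (wZ k) z.2}
    let A' : Fin k × Fin k → Finset ((Fin (k + s) → Fin N) × (Fin (k + s) → Fin N)) := fun q =>
      {z | hd z.2 q.1 = hd z.2 q.2 ∧ ts (wZ k) z.1 = ts (wZ k) z.2}
    let Bp : Nat → Finset ((Fin (k + s) → Fin N) × (Fin (k + s) → Fin N)) := fun p =>
      {z | hd z.1 ∈ Dp k N p ∧ hd z.2 ∈ Dp k N p ∧ ts (wZ k) z.1 = ts (wZ k) z.2}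
    have hA : ∀ q, (A q).card <= E q := by
      intro q
      apply le_of_eq
      simp only [A, hE, cnt, hd]
      congr 1
      ext z; simp only [mem_filter, mem_product, mem_univ, true_and, and_true]
    have hA' : ∀ q, (A' q).card <= E q := by
      intro q
      rw [hE]
      simp only
      rw [cnt_symm]
      apply le_of_eq
      simp only [A', cnt, hd]
      congr 1
      ext z; simp only [mem_filter, mem_product, mem_univ, true_and]
    have hB : ∀ p, (Bp p).card <= cnt (Dp k N p ×ˢ (univ : Finset (Fin s → Fin N))) (Dp k N p ×ˢ (univ : Finset (Fin s → Fin N)))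
      (fun q => ts (wZ k) q.1 + ts (wZ k) q.2) (fun q => ts (wZ k) q.1 + ts (wZ k) q.2) := by
      intro p
      have hts : ∀ n : Fin (k + s) → Fin N, ts (wZ k) n = ts (wZ k) (hd n) + ts (wZ k) (tl n) := by
        intro n; simp only [ts, hd, tl]; rw [Fin.sum_univ_add]
      have hinj : ∀ n n' : Fin (k + s) → Fin N, hd n = hd n' → tl n = tl n' → n = n' := by
        intro n n' h1 h2
        funext i
        refine Fin.addCases (fun i => congrFun h1 i) (fun i => congrFun h2 i) i
      unfold cnt
      apply card_le_card_of_injOn (fun z => ((hd z.1, tl z.1), (hd z.2, tl z.2)))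
      · intro z hz
        simp only [Bp, coe_filter, mem_univ, true_and, mem_product, and_true, Set.mem_ofPred_eq] at hz ⊢
        rw [hts, hts] at hz
        exact ⟨⟨hz.1, hz.2.1⟩, hz.2.2⟩
      · intro z _ z' _ h
        simp only [Prod.mk.injEq] at h
        exact Prod.ext (hinj _ _ h.1.1 h.1.2) (hinj _ _ h.2.1 h.2.2)
    have hsub : (univ ×ˢ univ : Finset ((Fin (k + s) → Fin N) × (Fin (k + s) → Fin N))).filter
        (fun q => ts (wZ k) q.1 = ts (wZ k) q.2) ⊆
        (((univ : Finset (Fin k)).offDiag.biUnion fun q => A q ∪ A' q) ∪ P.biUnion Bp) := by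
      intro z hz
      simp only [mem_filter, mem_product, mem_univ, true_and] at hz
      by_cases h1 : ∃ q ∈ (univ : Finset (Fin k)).offDiag, z ∈ A q ∪ A' q
      · exact mem_union_left _ (mem_biUnion.2 h1)
      · push Not at h1
        have h2 : ∀ i j, i ≠ j → hd z.1 i ≠ hd z.1 j := by
          intro i j hij h
          apply h1 (i, j) (by simp [hij])
          apply mem_union_left
          simp only [A, mem_filter, mem_univ, true_and]
          exact ⟨h, hz⟩
        have h3 : ∀ i j, i ≠ j → hd z.2 i ≠ hd z.2 j := by
          intro i j hij h
          apply h1 (i, j) (by simp [hij])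
          apply mem_union_right
          simp only [A', mem_filter, mem_univ, true_and]
          exact ⟨h, hz⟩
        obtain ⟨p, hp, h4, h5⟩ := exists_good_prime (by omega) (fun p hp => ⟨(hP p hp).1, (hP p hp).2.2⟩) hcard hN _ _ h2 h3
        apply mem_union_right
        refine mem_biUnion.2 ⟨p, hp, ?_⟩
        simp only [Bp, mem_filter, mem_univ, true_and]
        exact ⟨h4, h5, hz⟩
    have hJ : Jc (k + s) k N = ((univ ×ˢ univ : Finset ((Fin (k + s) → Fin N) × (Fin (k + s) → Fin N))).filter
        (fun q => ts (wZ k) q.1 = ts (wZ k) q.2)).card := by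
      unfold Jc cnt
      congr 1
      ext q; simp only [mem_filter]
    rw [hJ]
    refine (card_le_card hsub).trans ((card_union_le _ _).trans (add_le_add ?_ ?_))
    · refine card_biUnion_le.trans (sum_le_sum fun q _ => ?_)
      refine (card_union_le _ _).trans ?_
      have := hA q; have := hA' q; omega
    · exact card_biUnion_le.trans (sum_le_sum fun p _ => hB p)
  have hk0 : (2:Real) <= k := by exact_mod_cast hk
  have hEb : ∀ q ∈ (univ : Finset (Fin k)).offDiag, (2 * E q : Real) <=
      4 * Jc (k + s) k N / (8 * k ^ 2) + 2 * (8 * k ^ 2) ^ (2 * (k + s)) := by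
    intro q hq
    have := coin_J (k := k) (s := s) (N := N) hk (Fin.castAdd s q.1) (Fin.castAdd s q.2)
      (by
        rw [Finset.mem_offDiag] at hq
        intro h; exact hq.2.2 (Fin.castAdd_injective _ _ h)) (B := 8 * k ^ 2) (by nlinarith)
    have h2 : (E q : Real) <= 2 * (Jc (k + s) k N) / (8 * k ^ 2) + (8 * k ^ 2) ^ (2 * (k + s)) := by
      convert this using 2
    rw [show (4:Real) * Jc (k + s) k N / (8 * k ^ 2) = 2 * (2 * (Jc (k + s) k N) / (8 * k ^ 2)) by ring]
    linarith
  have h1 : (∑ q ∈ (univ : Finset (Fin k)).offDiag, (2 * E q : Real)) <= (k:Real) ^ 2 *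
      (4 * Jc (k + s) k N / (8 * k ^ 2) + 2 * (8 * k ^ 2) ^ (2 * (k + s))) := by
    refine (Finset.sum_le_card_nsmul _ _ _ hEb).trans ?_
    rw [nsmul_eq_mul]
    gcongr
    rw [Finset.offDiag_card]
    simp only [card_univ, Fintype.card_fin]
    exact_mod_cast (by rw [sq]; omega : k * k - k <= k ^ 2)
  have h2 : (k:Real) ^ 2 * (4 * Jc (k + s) k N / (8 * k ^ 2) + 2 * (8 * k ^ 2) ^ (2 * (k + s)))
      = Jc (k + s) k N / 2 + 2 * k ^ 2 * (8 * k ^ 2) ^ (2 * (k + s)) := by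
    field_simp; ring
  have h3 : ∑ p ∈ P, (cnt (Dp k N p ×ˢ (univ : Finset (Fin s → Fin N))) (Dp k N p ×ˢ (univ : Finset (Fin s → Fin N)))
      (fun q => ts (wZ k) q.1 + ts (wZ k) q.2) (fun q => ts (wZ k) q.1 + ts (wZ k) q.2) : Real) <=
      ∑ p ∈ P, (p:Real) ^ (2 * s) * (Jc s k (N / p + 1) * (p ^ (k * (k - 1) / 2) * k.factorial * N ^ k)) := by
    refine Finset.sum_le_sum fun p hp => ?_
    exact_mod_cast T_bound (s := s) (hP p hp).1 (hP p hp).2.1 (hP p hp).2.2.le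
  have h4 : (Jc (k + s) k N : Real) <= ∑ q ∈ (univ : Finset (Fin k)).offDiag, (2 * E q : Real) +
      ∑ p ∈ P, (cnt (Dp k N p ×ˢ (univ : Finset (Fin s → Fin N))) (Dp k N p ×ˢ (univ : Finset (Fin s → Fin N)))
      (fun q => ts (wZ k) q.1 + ts (wZ k) q.2) (fun q => ts (wZ k) q.1 + ts (wZ k) q.2) : Real) := by
    exact_mod_cast key
  linarith

lemma many_primes : ∃ A : Nat, 8 <= A ∧ ∀ k : Nat, 2 <= k → ∀ Y : Real, (k:Real) ^ A <= Y →
    ∃ P : Finset Nat, P.card = 2 * k ^ 3 ∧ ∀ p ∈ P, p.Prime ∧ Y < p ∧ (p:Real) <= 16 * Y := by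
  have hlog : ∀ᶠ x : Real in Filter.atTop, log x <= (1 / 16) * x ^ (1 / 2 : Real) := by
    have := (isLittleO_log_rpow_atTop (show (0:Real) < 1 / 2 by norm_num)).bound
      (show (0:Real) < 1 / 16 by norm_num)
    filter_upwards [this, Filter.eventually_ge_atTop 1] with x hx h1
    rw [norm_of_nonneg (log_nonneg h1), norm_of_nonneg (by positivity)] at hx
    exact hx
  obtain ⟨Y0, hY0⟩ := Filter.eventually_atTop.1 hlog
  refine ⟨8 + ⌈max Y0 0⌉₊, by omega, fun k hk Y hY => ?_⟩
  have hk2 : (2:Real) <= k := by exact_mod_cast hk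
  have h8 : k ^ 8 <= Y := (pow_le_pow_right₀ (by linarith) (by omega)).trans hY
  have hY0' : Y0 <= Y := by
    have h1 : (2:Real) ^ ⌈max Y0 0⌉₊ <= Y := by
      refine le_trans ?_ hY
      calc (2:Real) ^ ⌈max Y0 0⌉₊ <= (k:Real) ^ ⌈max Y0 0⌉₊ := by gcongr
        _ <= _ := pow_le_pow_right₀ (by linarith) (by omega)
    have h2 : (⌈max Y0 0⌉₊ : Real) <= 2 ^ ⌈max Y0 0⌉₊ := by exact_mod_cast Nat.lt_two_pow_self.le
    have h3 := Nat.le_ceil (max Y0 0)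
    have := le_max_left Y0 0
    linarith
  have hYbig : (256:Real) <= Y := by
    refine le_trans ?_ h8
    calc (256:Real) = 2 ^ 8 := by norm_num
      _ <= _ := by gcongr
  set P := (Nat.primesLE ⌊16 * Y⌋₊).filter (fun p : Nat => Y < p) with hP
  have hlogY : Real.log (16 * Y) <= (1 / 4) * Real.sqrt Y := by
    have := hY0 (16 * Y) (by linarith)
    rw [<- Real.sqrt_eq_rpow, Real.sqrt_mul (by norm_num), show Real.sqrt 16 = 4 by
      rw [show (16:Real) = 4 ^ 2 by norm_num]; exact Real.sqrt_sq (by norm_num)] at this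
    linarith
  have hsq : Real.sqrt Y * Real.sqrt Y = Y := Real.mul_self_sqrt (by linarith)
  have hsq16 : 16 <= Real.sqrt Y := Real.le_sqrt_of_sq_le (by linarith)
  have hcard : sqrt Y <= P.card := by
    have h1 := Chebyshev.theta_ge' (x := 16 * Y) (by linarith)
    have h2 := Chebyshev.theta_le_log4_mul_x (x := Y) (by linarith)
    have h3 : Chebyshev.theta (16 * Y) - Chebyshev.theta Y <= P.card * Real.log (16 * Y) := by
      rw [Chebyshev.theta_eq_sum_primesLE, Chebyshev.theta_eq_sum_primesLE, sub_le_iff_le_add]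
      rw [<- Finset.sum_filter_add_sum_filter_not (Nat.primesLE ⌊16 * Y⌋₊) (fun p : Nat => Y < p)]
      apply add_le_add
      · rw [<- nsmul_eq_mul]
        refine Finset.sum_le_card_nsmul _ _ _ fun p hp => ?_
        rw [mem_filter, Nat.mem_primesLE] at hp
        apply Real.log_le_log (by exact_mod_cast hp.1.2.pos)
        exact (Nat.le_floor_iff (by linarith)).1 hp.1.1
      · apply Finset.sum_le_sum_of_subset_of_nonneg
        · intro p hp
          rw [mem_filter, Nat.mem_primesLE] at hp
          rw [Nat.mem_primesLE]
          exact ⟨Nat.le_floor (not_lt.1 hp.2), hp.1.2⟩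
        · intro p hp _
          rw [Nat.mem_primesLE] at hp
          exact Real.log_nonneg (by exact_mod_cast hp.2.one_lt.le)
    have h4 : sqrt (16 * Y) = 4 * sqrt Y := by norm_num
    rw [h4] at h1
    have h5 : Real.log (16 * Y + 2) <= 1 + Real.log (16 * Y) := by
      have : Real.log (16 * Y + 2) <= Real.log (2 * (16 * Y)) := Real.log_le_log (by linarith) (by linarith)
      rw [Real.log_mul (by norm_num) (by linarith)] at this
      have := Real.log_two_lt_d9
      linarith
    have h6 : log 4 = 2 * log 2 := by
      rw [show (4:Real) = 2 ^ 2 by norm_num, log_pow]; norm_num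
    have hl1 := Real.log_two_gt_d9
    rw [h6] at h2
    have h8 : Y <= P.card * log (16 * Y) := by nlinarith
    nlinarith
  have hcard' : 2 * k ^ 3 <= P.card := by
    have h1 : (k ^ 4) <= sqrt Y := le_sqrt_of_sq_le (by rw [<- pow_mul]; exact h8)
    have h2 : (2 * k ^ 3 : Real) <= k ^ 4 := by
      have : (0:Real) <= (k:Real) ^ 3 := by positivity
      nlinarith
    exact_mod_cast h2.trans (h1.trans hcard)
  obtain ⟨Q, hQ, hQc⟩ := exists_subset_card_eq hcard'
  refine ⟨Q, hQc, fun p hp => ?_⟩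
  have := hQ hp
  rw [hP, mem_filter, Nat.mem_primesLE] at this
  exact ⟨this.1.2, this.2, (Nat.le_floor_iff (by linarith)).1 this.1.1⟩

lemma Jc_trivial (s k N : Nat) : Jc s k N <= N ^ (2 * s) := by
  unfold Jc cnt
  refine le_trans (b := ((univ ×ˢ univ : Finset ((Fin s → Fin N) × (Fin s → Fin N))).card)) ?_ ?_
  · apply card_le_card
    intro q hq
    simp
  simp [two_mul, pow_add]
/-- exponent -/

noncomputable def ex (k r : Nat) : Real := 2 * r * k - k * (k + 1) / 2 + k * (k + 1) / 2 * (1 - 1 / k) ^ r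

lemma ex_nonneg {k r : Nat} (hk : 2 <= k) : 0 <= ex k r := by
  have hk2 : (2:Real) <= k := by exact_mod_cast hk
  have h1 : (1:Real) / k <= 1 / 2 := one_div_le_one_div_of_le (by norm_num) hk2
  have h := one_add_mul_le_pow (a := -(1 / k : Real)) (by linarith) r
  unfold ex
  have h2 : (k:Real) * (k + 1) / 2 * (1 + r * -(1 / k)) <= k * (k + 1) / 2 * (1 - 1 / k) ^ r := by bound
  have h3 : (k:Real) * (k + 1) / 2 * (1 + r * -(1 / k)) = k * (k + 1) / 2 - r * (k + 1) / 2 := by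
    field_simp; ring
  nlinarith

lemma ex_le {k r : Nat} (hk : 2 <= k) : ex k r <= 2 * r * k := by
  have hk2 : (2:Real) <= k := by exact_mod_cast hk
  have h1 : (1:Real) / k <= 1 / 2 := one_div_le_one_div_of_le (by norm_num) hk2
  have h2 : (0:Real) < 1 / k := by positivity
  have : ((1:Real) - 1 / k) ^ r <= 1 := pow_le_one₀ (by linarith) (by linarith)
  have h3 : (k:Real) * (k + 1) / 2 * (1 - 1 / k) ^ r <= k * (k + 1) / 2 * 1 := by gcongr
  unfold ex; linarith

lemma ex_succ {k r : Nat} :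
    ex k (r + 1) = ex k r + 2 * k - k * (k + 1) / 2 * (1 - 1 / k) ^ r / k := by
  unfold ex
  push_cast
  ring

lemma vterm {k r N p : Nat} (hk : 2 <= k) (hN : 1 <= N) (hp0 : 0 < p) (hpN : p <= N)
    (hp : (p:Real) <= 16 * (N:Real) ^ (1 / k : Real)) {D : Real} (hD : 0 <= D)
    (hJ : ∀ N : Nat, 1 <= N → (Jc (r * k) k N : Real) <= D * (N:Real) ^ ex k r) :
    (p:Real) ^ (2 * (r * k)) * (Jc (r * k) k (N / p + 1) * (p ^ (k * (k - 1) / 2) * k.factorial * N ^ k)) <=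
      D * k ^ (2 * r * k + k + 4 * k ^ 2) * (N:Real) ^ ex k (r + 1) := by
  have hk2 : (2:Real) <= k := by exact_mod_cast hk
  have hp0' : (0:Real) < p := by exact_mod_cast hp0
  have hN' : (1:Real) <= N := by exact_mod_cast hN
  have hN0 : (0:Real) < N := by linarith
  have hpN' : (p:Real) <= N := by exact_mod_cast hpN
  have he := ex_nonneg (r := r) hk
  have he2 := ex_le (r := r) hk
  set g : Real := k * (k + 1) / 2 * (1 - 1 / k) ^ r with hg
  have hg0 : 0 <= g := by bound
  have hexg : ex k r = 2 * r * k - k * (k + 1) / 2 + g := rfl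
  have hJ1 : (Jc (r * k) k (N / p + 1) : Real) <= D * (2 ^ (2 * r * k) * ((N:Real) ^ ex k r * ((p:Real) ^ ex k r)⁻¹)) := by
    refine (hJ _ (Nat.succ_pos _)).trans ?_
    gcongr
    have h1 : ((N / p + 1 : Nat) : Real) <= 2 * (N / p) := by
      push_cast
      have : ((N / p : Nat) : Real) <= N / p := Nat.cast_div_le
      have : (1:Real) <= N / p := by rwa [le_div_iff₀ hp0', one_mul]
      linarith
    calc ((N / p + 1 : Nat) : Real) ^ ex k r <= (2 * (N / p : Real)) ^ ex k r := Real.rpow_le_rpow (by positivity) h1 he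
      _ = 2 ^ ex k r * ((N:Real) ^ ex k r * ((p:Real) ^ ex k r)⁻¹) := by
        rw [Real.mul_rpow (by norm_num) (by positivity), Real.div_rpow (by positivity) (by positivity), div_eq_mul_inv]
      _ <= _ := by
        gcongr
        rw [<- Real.rpow_natCast]
        apply Real.rpow_le_rpow_of_exponent_le (by norm_num)
        push_cast; linarith
  have hpp : (p:Real) ^ (2 * (r * k)) * ((p:Real) ^ ex k r)⁻¹ * p ^ (k * (k - 1) / 2) <=
      16 ^ (k ^ 2) * (N:Real) ^ (k - g / k) := by
    have hc : (((k * (k - 1) / 2 : Nat)) : Real) = k * (k - 1) / 2 := by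
      rw [Nat.cast_div (even_iff_two_dvd.1 (Nat.even_mul_pred_self k)) (by norm_num)]
      push_cast [Nat.cast_sub (show 1 <= k by omega)]; ring
    have h1 : (p:Real) ^ (2 * (r * k)) * ((p:Real) ^ ex k r)⁻¹ * p ^ (k * (k - 1) / 2) = (p:Real) ^ (k ^ 2 - g) := by
      rw [<- Real.rpow_natCast, <- Real.rpow_natCast, <- Real.rpow_neg hp0'.le, <- Real.rpow_add hp0', <- Real.rpow_add hp0', hc, hexg]
      congr 1
      push_cast; ring
    rw [h1]
    calc (p:Real) ^ (k ^ 2 - g) <= (16 * (N:Real) ^ (1 / k : Real)) ^ (k ^ 2 - g) :=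
          Real.rpow_le_rpow hp0'.le hp (by linarith)
      _ = 16 ^ (k ^ 2 - g) * (N:Real) ^ (k - g / k) := by
        rw [Real.mul_rpow (by norm_num) (by positivity), <- Real.rpow_mul hN0.le]
        congr 2
        field_simp
      _ <= _ := by
        gcongr
        rw [<- Real.rpow_natCast 16 (k ^ 2)]
        apply Real.rpow_le_rpow_of_exponent_le (by norm_num)
        push_cast; linarith
  have hN3 : (N:Real) ^ ex k r * N ^ (k - g / k) * N ^ k = N ^ ex k (r + 1) := by
    rw [<- Real.rpow_natCast, <- Real.rpow_add hN0, <- Real.rpow_add hN0, ex_succ]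
    congr 1
    ring
  have hcon : (2:Real) ^ (2 * r * k) * k.factorial * 16 ^ (k ^ 2) <= k ^ (2 * r * k + k + 4 * k ^ 2) := by
    rw [pow_add, pow_add]
    have h1 : (k.factorial : Real) <= k ^ k := by exact_mod_cast Nat.factorial_le_pow k
    have h2 : (16:Real) ^ (k ^ 2) <= k ^ (4 * k ^ 2) := by
      rw [pow_mul]
      gcongr
      calc (16:Real) = 2 ^ 4 := by norm_num
        _ <= _ := by gcongr
    gcongr
  calc p ^ (2 * (r * k)) * (Jc (r * k) k (N / p + 1) * (p ^ (k * (k - 1) / 2) * k.factorial * N ^ k))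
      <= p ^ (2 * (r * k)) * ((D * (2 ^ (2 * r * k) * (N ^ ex k r * ((p:Real) ^ ex k r)⁻¹))) * (p ^ (k * (k - 1) / 2) * k.factorial * N ^ k)) := by
        gcongr
    _ = D * (2 ^ (2 * r * k) * k.factorial) * (p ^ (2 * (r * k)) * ((p:Real) ^ ex k r)⁻¹ * p ^ (k * (k - 1) / 2)) * (N ^ ex k r * N ^ k) := by ring
    _ <= D * (2 ^ (2 * r * k) * k.factorial) * (16 ^ (k ^ 2) * N ^ (k - g / k)) * (N ^ ex k r * N ^ k) := by
        gcongr
    _ = D * (2 ^ (2 * r * k) * k.factorial * 16 ^ (k ^ 2)) * (N ^ ex k r * N ^ (k - g / k) * N ^ k) := by ring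
    _ <= _ := by rw [hN3]; gcongr

theorem vmvt : ∃ A : Nat, ∀ k : Nat, 2 <= k → ∀ r N : Nat, 1 <= N →
    (Jc (r * k) k N : Real) <= (k:Real) ^ (A * k ^ 3 + 16 * r * k ^ 2 + 2 * r ^ 2 * k) * (N:Real) ^ ex k r := by
  obtain ⟨A, hA8, hA⟩ := many_primes
  refine ⟨A, fun k hk r => ?_⟩
  have hk2 : (2:Real) <= k := by exact_mod_cast hk
  have hk1 : (1:Real) <= k := by linarith
  induction r with
  | zero =>
    intro N hN
    have h1 : Jc (0 * k) k N <= 1 := by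
      refine (Jc_trivial _ _ _).trans ?_; simp
    have h2 : (N:Real) ^ ex k 0 = 1 := by simp [ex]
    rw [h2, mul_one]
    calc (Jc (0 * k) k N : Real) <= 1 := by exact_mod_cast h1
      _ <= _ := one_le_pow₀ hk1
  | succ r ih =>
    intro N hN
    have hN' : (1:Real) <= N := by exact_mod_cast hN
    have hN0 : (0:Real) < N := by linarith
    rcases lt_or_ge ((N:Real) ^ (1 / k : Real)) ((k:Real) ^ A) with hsm | hbig
    · have h1 : (N:Real) <= (k:Real) ^ (A * k) := by
        calc (N:Real) = ((N:Real) ^ (1 / k : Real)) ^ k := by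
              rw [<- Real.rpow_natCast, <- Real.rpow_mul hN0.le]; field_simp; simp
          _ <= ((k:Real) ^ A) ^ k := by gcongr
          _ = _ := by rw [pow_mul]
      have h2 : (N:Real) ^ (2 * ((r + 1) * k)) <= (N:Real) ^ (k ^ 2) * (N:Real) ^ ex k (r + 1) := by
        rw [<- Real.rpow_natCast, <- Real.rpow_natCast, <- Real.rpow_add hN0]
        apply Real.rpow_le_rpow_of_exponent_le hN'
        unfold ex
        have h3 : (1:Real) / k <= 1 / 2 := one_div_le_one_div_of_le (by norm_num) hk2
        have h4 : (0:Real) <= k * (k + 1) / 2 * (1 - 1 / k) ^ (r + 1) := by bound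
        push_cast
        nlinarith
      calc (Jc ((r + 1) * k) k N : Real) <= (N:Real) ^ (2 * ((r + 1) * k)) := by exact_mod_cast Jc_trivial _ _ _
        _ <= (N:Real) ^ (k ^ 2) * (N:Real) ^ ex k (r + 1) := h2
        _ <= _ := by
          gcongr
          calc (N:Real) ^ (k ^ 2) <= ((k:Real) ^ (A * k)) ^ (k ^ 2) := by gcongr
            _ = (k:Real) ^ (A * k ^ 3) := by ring
            _ <= _ := pow_le_pow_right₀ hk1 (by nlinarith)
    · obtain ⟨P, hPc, hP⟩ := hA k hk _ hbig
      set D : Real := (k:Real) ^ (A * k ^ 3 + 16 * r * k ^ 2 + 2 * r ^ 2 * k) with hD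
      have hNk : ((N:Real) ^ (1 / k : Real)) ^ k = N := by
        rw [<- Real.rpow_natCast, <- Real.rpow_mul hN0.le]; field_simp; simp
      have hY1 : (256:Real) <= (N:Real) ^ (1 / k : Real) := by
        refine le_trans ?_ hbig
        calc (256:Real) = 2 ^ 8 := by norm_num
          _ <= (k:Real) ^ 8 := by gcongr
          _ <= _ := pow_le_pow_right₀ hk1 hA8
      have hst := vstep (s := r * k) hk hN P (fun p hp => by
        obtain ⟨h1, h2, h3⟩ := hP p hp
        refine ⟨h1, ?_, ?_⟩
        · have : (k:Real) < p := by
            calc (k:Real) = (k:Real) ^ 1 := by simp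
              _ <= (k:Real) ^ A := pow_le_pow_right₀ hk1 (by omega)
              _ < p := lt_of_le_of_lt hbig h2
          exact_mod_cast this
        · have : (N:Real) < (p:Real) ^ k := by
            rw [<- hNk]
            exact pow_lt_pow_left₀ h2 (by positivity) (by omega)
          exact_mod_cast this) hPc.ge
      have hterm : ∀ p ∈ P, (p:Real) ^ (2 * (r * k)) * (Jc (r * k) k (N / p + 1) * (p ^ (k * (k - 1) / 2) * k.factorial * N ^ k)) <=
          D * k ^ (2 * r * k + k + 4 * k ^ 2) * (N:Real) ^ ex k (r + 1) := by
        intro p hp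
        obtain ⟨h1, h2, h3⟩ := hP p hp
        refine vterm hk hN h1.pos ?_ h3 (by positivity) ih
        have : (p:Real) <= N := by
          refine h3.trans ?_
          calc 16 * (N:Real) ^ (1 / k : Real) <= ((N:Real) ^ (1 / k : Real)) ^ 2 := by nlinarith
            _ <= ((N:Real) ^ (1 / k : Real)) ^ k := pow_le_pow_right₀ (by linarith) hk
            _ = N := hNk
        exact_mod_cast this
      have hsum := Finset.sum_le_card_nsmul _ _ _ hterm
      rw [hPc, nsmul_eq_mul] at hsum
      rw [show (r + 1) * k = k + r * k by ring]
      have hNe : 1 <= (N:Real) ^ ex k (r + 1) := one_le_rpow hN' (ex_nonneg hk)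
      set X := (N:Real) ^ ex k (r + 1)
      have h4k : (4:Real) <= k ^ 2 := by nlinarith
      have hc1 : 4 * (k:Real) ^ 2 * (8 * k ^ 2) ^ (2 * (k + r * k)) <= k ^ (4 + 10 * (k + r * k)) := by
        rw [pow_add, show 10 * (k + r * k) = 5 * (2 * (k + r * k)) by ring, pow_mul (k:Real) 5]
        gcongr
        · nlinarith
        · calc 8 * (k:Real) ^ 2 = 2 ^ 3 * k ^ 2 := by norm_num
            _ <= (k:Real) ^ 3 * k ^ 2 := by gcongr
            _ = _ := by ring
      have hc2 : 2 * ((2 * k ^ 3 : Nat) * (D * k ^ (2 * r * k + k + 4 * k ^ 2) * X)) <= D * k ^ (5 + 2 * r * k + k + 4 * k ^ 2) * X := by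
        push_cast
        calc 2 * ((2 * k ^ 3) * (D * k ^ (2 * r * k + k + 4 * k ^ 2) * X)) = (4 * k ^ 3) * (D * k ^ (2 * r * k + k + 4 * k ^ 2) * X) := by ring
          _ <= (k ^ 2 * k ^ 3) * (D * k ^ (2 * r * k + k + 4 * k ^ 2) * X) := by gcongr
          _ = _ := by ring
      set E : Real := k ^ (A * k ^ 3 + 16 * (r + 1) * k ^ 2 + 2 * (r + 1) ^ 2 * k) with hE
      have hEk : E = k * k ^ (A * k ^ 3 + 16 * (r + 1) * k ^ 2 + 2 * (r + 1) ^ 2 * k - 1) := by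
        rw [hE, <- pow_succ']; congr 1
        have : 0 < 2 * (r + 1) ^ 2 * k := by positivity
        omega
      have hd1 : (k:Real) ^ (4 + 10 * (k + r * k)) <= k ^ (A * k ^ 3 + 16 * (r + 1) * k ^ 2 + 2 * (r + 1) ^ 2 * k - 1) := by
        apply pow_le_pow_right₀ hk1
        apply Nat.le_sub_of_add_le
        have h1 : (r + 1) * k * 2 <= (r + 1) * k * k := Nat.mul_le_mul_left _ hk
        nlinarith
      have hd2 : D * k ^ (5 + 2 * r * k + k + 4 * k ^ 2) <= k ^ (A * k ^ 3 + 16 * (r + 1) * k ^ 2 + 2 * (r + 1) ^ 2 * k - 1) := by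
        rw [hD, <- pow_add]
        apply pow_le_pow_right₀ hk1
        apply Nat.le_sub_of_add_le
        nlinarith
      have hX0 : 0 <= X := by linarith
      calc _ <= _ := hst
        _ <= k ^ (4 + 10 * (k + r * k)) * X + D * k ^ (5 + 2 * r * k + k + 4 * k ^ 2) * X := by
          apply add_le_add
          · refine hc1.trans (le_mul_of_one_le_right (by positivity) hNe)
          · refine le_trans ?_ hc2
            gcongr
        _ <= E * X := by
          have h0 : 0 <= (k:Real) ^ (A * k ^ 3 + 16 * (r + 1) * k ^ 2 + 2 * (r + 1) ^ 2 * k - 1) * X := by positivity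
          nlinarith
/-- `e x = exp (i x)` -/

noncomputable def e (x:Real) : Complex := Complex.exp (x * I)

lemma e_add (x y : Real) : e (x + y) = e x * e y := by
  unfold e; rw [<- Complex.exp_add]; congr 1; push_cast; ring

lemma e_zero : e 0 = 1 := by simp [e]

lemma norm_e (x:Real) : ‖e x‖ = 1 := Complex.norm_exp_ofReal_mul_I x

lemma e_neg (x:Real) : e (-x) = (starRingEnd Complex) (e x) := by
  unfold e; rw [<- Complex.exp_conj]; simp

lemma e_sum {ι : Type*} (s : Finset ι) (f : ι → Real) : e (∑ i ∈ s, f i) = ∏ i ∈ s, e (f i) := by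
  unfold e; rw [<- Complex.exp_sum, <- sum_mul]; push_cast; rfl

noncomputable def dt {k : Nat} (α : Fin k → Real) (v : Fin k → Int) : Real := ∑ j, α j * v j

lemma dt_sub {k : Nat} (α : Fin k → Real) (u v : Fin k → Int) : dt α (u - v) = dt α u - dt α v := by
  simp [dt, mul_sub]

lemma dt_ts {k s M : Nat} (α : Fin k → Real) (x : Fin s → Fin M) :
    dt α (ts (wZ k) x) = ∑ i, dt α (wZ k (x i)) := by
  simp only [dt, ts, Finset.sum_apply, Int.cast_sum, Finset.mul_sum]
  exact sum_comm

def Dq {s k M : Nat} (q : (Fin s → Fin M) × (Fin s → Fin M)) : Fin k → Int := ts (wZ k) q.1 - ts (wZ k) q.2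

lemma pow2s {k M : Nat} (s:Nat) (α : Fin k → Real) :
    ((‖∑ b : Fin M, e (dt α (wZ k b))‖ ^ (2 * s) : Real) : Complex) =
      ∑ q : (Fin s → Fin M) × (Fin s → Fin M), e (dt α (Dq q)) := by
  have h1 : (∑ b : Fin M, e (dt α (wZ k b))) ^ s = ∑ x : Fin s → Fin M, e (dt α (ts (wZ k) x)) := by
    simp_rw [dt_ts, e_sum]
    rw [Finset.sum_pow', Fintype.piFinset_univ]
  rw [pow_mul, Complex.sq_norm, Complex.ofReal_pow, Complex.normSq_eq_conj_mul_self, mul_pow, <- map_pow, h1,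
    map_sum, Fintype.sum_prod_type_right, Finset.sum_mul]
  refine sum_congr rfl fun y _ => ?_
  rw [Finset.mul_sum]
  refine sum_congr rfl fun x _ => ?_
  rw [Dq, dt_sub, sub_eq_add_neg, e_add, e_neg, mul_comm]

noncomputable def bx (s k M : Nat) (j : Fin k) : Finset Int := Icc (-((s * M ^ (j.val + 1) : Nat) : Int)) ((s * M ^ (j.val + 1) : Nat) : Int)

lemma Dq_mem {s k M : Nat} (q : (Fin s → Fin M) × (Fin s → Fin M)) :
    Dq q ∈ Fintype.piFinset (bx s k M) := by
  have h : ∀ (x : Fin s → Fin M) (j : Fin k), 0 <= ts (wZ k) x j ∧ ts (wZ k) x j <= ((s * M ^ (j.val + 1) : Nat) : Int) := by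
    intro x j
    rw [ts_wZ]
    constructor
    · positivity
    · push_cast
      calc _ <= ∑ i : Fin s, (M:Int) ^ (j.val + 1) := by
            refine sum_le_sum fun i _ => ?_
            have h1 : ((x i : Nat) : Int) <= M := by omega
            gcongr
        _ = _ := by simp
  rw [Fintype.mem_piFinset]
  intro j
  rw [bx, mem_Icc, Dq, Pi.sub_apply]
  have h1 := h q.1 j
  have h2 := h q.2 j
  constructor <;> linarith

lemma sum_Dq_le {s k M : Nat} (F : (Fin k → Int) → Real) (hF : ∀ v, 0 <= F v) :
    ∑ q : (Fin s → Fin M) × (Fin s → Fin M), F (Dq q) <= Jc s k M * ∑ v ∈ Fintype.piFinset (bx s k M), F v := by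
  classical
  rw [<- Finset.sum_fiberwise_of_maps_to (t := Fintype.piFinset (bx s k M)) (g := Dq) (fun q _ => Dq_mem q), Finset.mul_sum]
  refine sum_le_sum fun v _ => ?_
  rw [sum_congr rfl (g := fun _ => F v) (fun q hq => by rw [(mem_filter.1 hq).2]), sum_const, nsmul_eq_mul]
  refine mul_le_mul_of_nonneg_right ?_ (hF v)
  have h := cnt_shift_le (univ : Finset (Fin s → Fin M)) (ts (wZ k)) v
  refine le_trans ?_ (Nat.cast_le.2 h)
  apply Nat.cast_le.2
  unfold cnt
  apply card_le_card
  intro q hq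
  simp only [mem_filter, mem_univ, true_and, mem_product] at hq ⊢
  rw [<- hq, Dq]; abel

noncomputable def Ws (m:Nat) (α:Real) : Real :=
  ∑ μ ∈ Icc (-(m:Int)) m, ‖∑ l ∈ Icc (-(m:Int)) m, e (α * l * μ)‖
/-- the bilinear sum -/

noncomputable def Us {k : Nat} (M:Nat) (α : Fin k → Real) : Complex :=
  ∑ a : Fin M, ∑ b : Fin M, e (∑ j : Fin k, α j * ((a:Nat) * (b:Nat) : Real) ^ (j.val + 1))

lemma U_bound {k : Nat} (s M : Nat) (α : Fin k → Real) :
    ‖Us M α‖ ^ (2 * s * (2 * s)) <=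
      (M:Real) ^ ((2 * s - 1) * (2 * s)) * ((M:Real) ^ (2 * s)) ^ (2 * s - 1) * (Jc s k M : Real) ^ 2 *
        ∏ j : Fin k, Ws (s * M ^ (j.val + 1)) (α j) := by
  classical
  rcases Nat.eq_zero_or_pos s with rfl | hs
  · have : (1:Real) <= Jc 0 k M := by
      have : 1 <= Jc 0 k M := by
        unfold Jc cnt
        rw [Nat.one_le_iff_ne_zero, Finset.card_ne_zero]
        exact ⟨(default, default), by simp⟩
      exact_mod_cast this
    have h0 : ∀ α, Ws 0 α = 1 := by intro α; simp [Ws, e_zero]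
    simp only [mul_zero, pow_zero, zero_mul, h0, Finset.prod_const_one, Nat.zero_sub, one_mul, mul_one]
    nlinarith
  set V : (Fin k → Int) → Complex := fun l => ∑ a : Fin M, e (dt (fun j => α j * l j) (wZ k a)) with hV
  have hU1 : ‖Us M α‖ ^ (2 * s) <= (M:Real) ^ (2 * s - 1) *
      ∑ q : (Fin s → Fin M) × (Fin s → Fin M), ‖V (Dq q)‖ := by
    have h1 : Us M α = ∑ a : Fin M, ∑ b : Fin M, e (dt (fun j => α j * wZ k a j) (wZ k b)) := by
      unfold Us
      refine Finset.sum_congr rfl fun a _ => Finset.sum_congr rfl fun b _ => ?_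
      congr 1
      unfold dt
      refine Finset.sum_congr rfl fun j _ => ?_
      simp only [wZ, zk]
      push_cast
      rw [mul_pow]; ring
    have h2 : ‖Us M α‖ ^ (2 * s) <= (M:Real) ^ (2 * s - 1) *
        ∑ a : Fin M, ‖∑ b : Fin M, e (dt (fun j => α j * wZ k a j) (wZ k b))‖ ^ (2 * s) := by
      rw [h1]
      refine (pow_le_pow_left₀ (norm_nonneg _) (norm_sum_le _ _) _).trans ?_
      have h3 := pow_sum_le_card_mul_sum_pow (s := (univ : Finset (Fin M)))
        (f := fun a => ‖∑ b : Fin M, e (dt (fun j => α j * wZ k a j) (wZ k b))‖) (fun _ _ => norm_nonneg _) (2 * s - 1)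
      rw [Nat.sub_add_cancel (by omega)] at h3
      simpa using h3
    refine h2.trans ?_
    gcongr
    have h3 : ((∑ a : Fin M, ‖∑ b : Fin M, e (dt (fun j => α j * wZ k a j) (wZ k b))‖ ^ (2 * s) : Real) : Complex) =
        ∑ q : (Fin s → Fin M) × (Fin s → Fin M), V (Dq q) := by
      rw [Complex.ofReal_sum]
      simp_rw [pow2s]
      rw [Finset.sum_comm]
      refine Finset.sum_congr rfl fun q _ => ?_
      rw [hV]
      refine Finset.sum_congr rfl fun a _ => ?_
      congr 1
      unfold dt
      refine Finset.sum_congr rfl fun j _ => by ring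
    have h4 : (∑ a : Fin M, ‖∑ b : Fin M, e (dt (fun j => α j * wZ k a j) (wZ k b))‖ ^ (2 * s) : Real) =
        ‖∑ q : (Fin s → Fin M) × (Fin s → Fin M), V (Dq q)‖ := by
      rw [<- h3, Complex.norm_of_nonneg (by positivity)]
    rw [h4]
    exact norm_sum_le _ _
  have hU2 : (∑ q : (Fin s → Fin M) × (Fin s → Fin M), ‖V (Dq q)‖) ^ (2 * s) <=
      (M ^ (2 * s)) ^ (2 * s - 1) * (Jc s k M * ∑ l ∈ Fintype.piFinset (bx s k M), ‖V l‖ ^ (2 * s)) := by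
    have h3 := pow_sum_le_card_mul_sum_pow (s := (univ : Finset ((Fin s → Fin M) × (Fin s → Fin M))))
        (f := fun q => ‖V (Dq q)‖) (fun _ _ => norm_nonneg _) (2 * s - 1)
    rw [Nat.sub_add_cancel (by omega)] at h3
    refine h3.trans ?_
    have hc : ((univ : Finset ((Fin s → Fin M) × (Fin s → Fin M))).card : Real) = M ^ (2 * s) := by
      simp [two_mul, pow_add]
    rw [hc]
    gcongr
    exact sum_Dq_le (fun l => ‖V l‖ ^ (2 * s)) (fun _ => by positivity)
  have hU3 : ∑ l ∈ Fintype.piFinset (bx s k M), ‖V l‖ ^ (2 * s) <=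
      Jc s k M * ∏ j : Fin k, Ws (s * M ^ (j.val + 1)) (α j) := by
    have h1 : ((∑ l ∈ Fintype.piFinset (bx s k M), ‖V l‖ ^ (2 * s) : Real) : Complex) =
        ∑ q : (Fin s → Fin M) × (Fin s → Fin M), ∏ j : Fin k, ∑ l ∈ bx s k M j, e (α j * l * (Dq (k := k) q j : Int)) := by
      rw [Complex.ofReal_sum]
      simp_rw [hV, pow2s]
      rw [Finset.sum_comm]
      refine Finset.sum_congr rfl fun q _ => ?_
      rw [Finset.prod_univ_sum]
      refine Finset.sum_congr rfl fun l _ => ?_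
      rw [dt, e_sum]
    have h2 : ∑ l ∈ Fintype.piFinset (bx s k M), ‖V l‖ ^ (2 * s) =
        ‖∑ q : (Fin s → Fin M) × (Fin s → Fin M), ∏ j : Fin k, ∑ l ∈ bx s k M j, e (α j * l * (Dq (k := k) q j : Int))‖ := by
      rw [<- h1, Complex.norm_of_nonneg (by positivity)]
    rw [h2]
    refine (norm_sum_le _ _).trans ?_
    refine (sum_Dq_le (s := s) (k := k) (M := M) (fun v => ‖∏ j : Fin k, ∑ l ∈ bx s k M j, e (α j * l * (v j : Int))‖)
      (fun _ => norm_nonneg _)).trans ?_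
    gcongr
    simp_rw [norm_prod]
    unfold Ws
    rw [Finset.prod_univ_sum]
    rfl
  calc ‖Us M α‖ ^ (2 * s * (2 * s)) = (‖Us M α‖ ^ (2 * s)) ^ (2 * s) := by rw [<- pow_mul]
    _ <= (M ^ (2 * s - 1) * ∑ q : (Fin s → Fin M) × (Fin s → Fin M), ‖V (Dq q)‖) ^ (2 * s) := by gcongr
    _ = M ^ ((2 * s - 1) * (2 * s)) * (∑ q : (Fin s → Fin M) × (Fin s → Fin M), ‖V (Dq q)‖) ^ (2 * s) := by ring
    _ <= M ^ ((2 * s - 1) * (2 * s)) * ((M ^ (2 * s)) ^ (2 * s - 1) * (Jc s k M *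
        (Jc s k M * ∏ j : Fin k, Ws (s * M ^ (j.val + 1)) (α j)))) := by
      gcongr
      refine hU2.trans ?_
      gcongr
    _ = _ := by ring

lemma Ws_nonneg (m:Nat) (α:Real) : 0 <= Ws m α := Finset.sum_nonneg fun _ _ => norm_nonneg _

lemma card_Icc_m (m:Nat) : ((Icc (-(m:Int)) m).card : Real) = 2 * m + 1 := by
  rw [Int.card_Icc]
  have : ((m:Int) + 1 - -(m:Int)).toNat = 2 * m + 1 := by omega
  rw [this]; push_cast; ring

lemma inner_triv (m:Nat) (f : Int → Real) : ‖∑ l ∈ Icc (-(m:Int)) m, e (f l)‖ <= 2 * m + 1 := by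
  refine (norm_sum_le _ _).trans ?_
  simp only [norm_e]
  rw [Finset.sum_const, nsmul_eq_mul, mul_one, card_Icc_m]

lemma Ws_triv (m:Nat) (α:Real) : Ws m α <= (2 * m + 1) ^ 2 := by
  unfold Ws
  have := Finset.sum_le_card_nsmul (Icc (-(m:Int)) m) (fun μ : Int => ‖∑ l ∈ Icc (-(m:Int)) m, e (α * l * μ)‖) (2 * m + 1)
    (fun μ _ => inner_triv m (fun l => α * l * μ))
  rw [nsmul_eq_mul, card_Icc_m] at this
  rw [sq]; exact this

lemma geom_bd (m:Nat) (θ:Real) (h0 : θ ≠ 0) (hθ : |θ| <= Real.pi) :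
    ‖∑ l ∈ Icc (-(m:Int)) m, e (l * θ)‖ <= Real.pi / |θ| := by
  have h1 : (∑ l ∈ Icc (-(m:Int)) m, e (l * θ)) * (e θ - 1) = e ((m + 1) * θ) - e (-m * θ) := by
    induction m with
    | zero => simp [e_zero]
    | succ m ih =>
      have hI : Icc (-((m + 1 : Nat) : Int)) ((m + 1 : Nat) : Int) = insert ((m:Int) + 1) (insert (-((m:Int) + 1)) (Icc (-(m:Int)) m)) := by grind
      rw [hI, sum_insert (by simp only [mem_insert, mem_Icc]; omega), sum_insert (by simp only [mem_Icc]; omega), add_mul, add_mul, ih]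
      have e1 : e (((m + 1 : Nat) + 1) * θ) = e ((m + 1) * θ) * e θ := by rw [<- e_add]; congr 1; push_cast; ring
      have e2 : e (-m * θ) = e (-(m + 1 : Nat) * θ) * e θ := by rw [<- e_add]; congr 1; push_cast; ring
      rw [e1, e2]
      push_cast
      ring
  have h2 : ‖e θ - 1‖ ≥ 2 * |θ| / Real.pi := by
    have : ‖e θ - 1‖ = ‖2 * Real.sin (θ / 2)‖ := by
      rw [<- Complex.norm_exp_I_mul_ofReal_sub_one]; unfold e; rw [mul_comm]
    rw [this, norm_eq_abs, abs_mul, abs_two]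
    have h3 : 2 / Real.pi * (|θ| / 2) <= sin (|θ| / 2) :=
      mul_le_sin (by positivity) (by linarith)
    have h4 : sin (|θ| / 2) <= |sin (θ / 2)| := by
      rcases abs_cases θ with ⟨h, _⟩ | ⟨h, _⟩
      · rw [h]; exact le_abs_self _
      · rw [h, neg_div, sin_neg]; exact neg_le_abs _
    calc 2 * |θ| / Real.pi = 2 * (2 / Real.pi * (|θ| / 2)) := by ring
      _ <= _ := by linarith
  have h3 : ‖∑ l ∈ Icc (-(m:Int)) m, e (l * θ)‖ * ‖e θ - 1‖ <= 2 := by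
    rw [<- norm_mul, h1]
    refine (norm_sub_le _ _).trans ?_
    rw [norm_e, norm_e]; norm_num
  have hpos : 0 < |θ| := abs_pos.2 h0
  have hpi := pi_pos
  rw [le_div_iff₀ hpos]
  have h4 : ‖∑ l ∈ Icc (-(m:Int)) m, e (l * θ)‖ * (2 * |θ| / Real.pi) <= 2 :=
    (mul_le_mul_of_nonneg_left h2 (norm_nonneg _)).trans h3
  rw [mul_div_assoc', div_le_iff₀ hpi] at h4
  linarith

lemma Ws_good {m : Nat} {α : Real} (h0 : α ≠ 0) (hα : |α| * m <= Real.pi) :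
    Ws m α <= (2 * m + 1) + 2 * Real.pi / |α| * (1 + Real.log m) := by
  have hsplit : Ws m α <= (2 * m + 1) + ∑ i ∈ Icc 1 m, 2 * (Real.pi / (|α| * i)) := by
    have hle : ∀ m' ≤ m, ∑ μ ∈ Icc (-(m':Int)) m', ‖∑ l ∈ Icc (-(m:Int)) m, e (α * l * μ)‖ <=
        (2 * m + 1) + ∑ i ∈ Icc 1 m', 2 * (Real.pi / (|α| * i)) := by
      intro m' hm'
      induction m' with
      | zero => simpa using inner_triv m (fun l => α * l * 0)
      | succ m' ih =>
        have hI : Icc (-((m' + 1 : Nat) : Int)) ((m' + 1 : Nat) : Int) = insert ((m':Int) + 1) (insert (-((m':Int) + 1)) (Icc (-(m':Int)) m')) := by grind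
        rw [hI, sum_insert (by simp only [mem_insert, mem_Icc]; omega), sum_insert (by simp only [mem_Icc]; omega),
          sum_Icc_succ_top (by omega)]
        have ih' := ih (by omega)
        have hb : ∀ ε : Real, |ε| = 1 → ‖∑ l ∈ Icc (-(m:Int)) m, e (α * l * (ε * (m' + 1)))‖ <= Real.pi / (|α| * ((m' + 1 : Nat))) := by
          intro ε hε
          have habs : |α * (ε * (m' + 1))| = |α| * ((m' + 1 : Nat)) := by
            rw [abs_mul, abs_mul, hε, one_mul, abs_of_nonneg (show (0:Real) <= m' + 1 by positivity)]; push_cast; rfl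
          have := geom_bd m (α * (ε * (m' + 1))) (by
            rw [<- abs_pos, habs]; have := abs_pos.2 h0; positivity) (by
            rw [habs]
            refine le_trans ?_ hα
            gcongr)
          rw [habs] at this
          refine le_trans (le_of_eq ?_) this
          congr 1
          refine sum_congr rfl fun l _ => ?_
          congr 1; ring
        have hb1 := hb 1 (by simp)
        have hb2 := hb (-1) (by simp)
        have c1 : ‖∑ l ∈ Icc (-(m:Int)) m, e (α * l * ((m':Int) + 1 : Int))‖ <= Real.pi / (|α| * ((m' + 1 : Nat))) := by simp_all
        have c2 : ‖∑ l ∈ Icc (-(m:Int)) m, e (α * l * (-((m':Int) + 1) : Int))‖ <= Real.pi / (|α| * ((m' + 1 : Nat))) := by simp_all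
        linarith
    exact hle m le_rfl
  refine hsplit.trans ?_
  gcongr
  have hh := harmonic_le_one_add_log m
  rw [harmonic_eq_sum_Icc] at hh
  push_cast at hh
  have h1 : ∑ i ∈ Icc 1 m, 2 * (Real.pi / (|α| * i)) = 2 * Real.pi / |α| * ∑ i ∈ Icc 1 m, (i:Real)⁻¹ := by
    rw [Finset.mul_sum]
    refine sum_congr rfl fun i _ => ?_
    rw [<- div_div]; ring
  rw [h1]
  gcongr

lemma e_sub_le (x y : Real) : ‖e x - e y‖ <= |x - y| := by
  have h1 : e x - e y = e y * (e (x - y) - 1) := by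
    rw [mul_sub, <- e_add, mul_one]; congr 2; ring
  rw [h1, norm_mul, norm_e, one_mul]
  have := Real.norm_exp_I_mul_ofReal_sub_one_le (x := x - y)
  unfold e
  rw [mul_comm]; exact this

noncomputable def al (t:Real) (k n : Nat) : Fin k → Real := fun j => t * (-1) ^ (j.val + 1) / ((j.val + 1) * (n:Real) ^ (j.val + 1))

lemma shift_one (f : Nat → Complex) {N N' : Nat} (h : N <= N') (m:Nat) :
    ∑ n ∈ Ioc N N', f (n + m) - ∑ n ∈ Ioc N N', f (n + (m + 1)) = f (N + (m + 1)) - f (N' + (m + 1)) := by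
  rw [<- Finset.sum_sub_distrib]
  induction N', h using Nat.le_induction with
  | base => simp
  | succ K hK ih2 =>
    rw [Finset.sum_Ioc_succ_top (by omega), ih2]
    ring

lemma shift_bd (f : Nat → Complex) (hf : ∀ n, ‖f n‖ <= 1) {N N' : Nat} (h : N <= N') (m:Nat) :
    ‖∑ n ∈ Ioc N N', f n - ∑ n ∈ Ioc N N', f (n + m)‖ <= 2 * m := by
  induction m with
  | zero => simp
  | succ m ih =>
    have h1 := shift_one f h m
    have h2 : ∑ n ∈ Ioc N N', f n - ∑ n ∈ Ioc N N', f (n + (m + 1)) =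
        (∑ n ∈ Ioc N N', f n - ∑ n ∈ Ioc N N', f (n + m)) + (f (N + (m + 1)) - f (N' + (m + 1))) := by
      rw [<- h1]; ring
    rw [h2]
    refine (norm_add_le _ _).trans ?_
    have h3 := norm_sub_le (f (N + (m + 1))) (f (N' + (m + 1)))
    have := hf (N + (m + 1))
    have := hf (N' + (m + 1))
    push_cast
    linarith

lemma taylor_bd {t : Real} (ht : 0 <= t) {n N M a b : Nat} (k:Nat) (hn : N < n) (hM : 2 * M ^ 2 <= N) (ha : a < M) (hb : b < M) :
    ‖e (-t * Real.log ((n + a * b : Nat) : Real)) - e (-t * Real.log n) * e (∑ j : Fin k, al t k n j * ((a:Real) * b) ^ (j.val + 1))‖ <=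
      t * (2 * ((M:Real) ^ 2 / N) ^ (k + 1)) := by
  have hM0 : 0 < M := by omega
  have hN0 : 0 < N := lt_of_lt_of_le (by positivity) hM
  have hN' : (0:Real) < N := by exact_mod_cast hN0
  have hn' : (0:Real) < n := by exact_mod_cast hN0.trans hn
  have hab : (a:Real) * b <= M ^ 2 := by
    have : a * b <= M ^ 2 := by rw [sq]; exact Nat.mul_le_mul ha.le hb.le
    exact_mod_cast this
  set u : Real := a * b / n with hu
  have hu0 : 0 <= u := by positivity
  have huN : u <= (M:Real) ^ 2 / N := by
    rw [hu]; gcongr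
  have hMN : (M:Real) ^ 2 / N <= 1 / 2 := by
    rw [div_le_iff₀ hN']
    have : (2 * M ^ 2 : Real) <= N := by exact_mod_cast hM
    linarith
  rw [<- e_add]
  refine (e_sub_le _ _).trans ?_
  have hlog : log ((n + a * b : Nat) : Real) = log n + log (1 - -u) := by
    rw [<- Real.log_mul hn'.ne' (by linarith)]
    congr 1
    rw [hu]; push_cast; field_simp; ring
  have hsum : ∑ j : Fin k, al t k n j * (a * b) ^ (j.val + 1) = t * ∑ i ∈ range k, (-u) ^ (i + 1) / (i + 1) := by
    rw [Finset.sum_range, Finset.mul_sum]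
    refine sum_congr rfl fun j _ => ?_
    rw [al, hu, neg_pow (_ / _), div_pow]
    field_simp
  rw [hlog, hsum]
  have := Real.abs_log_sub_add_sum_range_le (x := -u) (by rw [abs_neg, abs_of_nonneg hu0]; linarith) k
  rw [abs_neg, abs_of_nonneg hu0] at this
  rw [show -t * (Real.log n + Real.log (1 - -u)) - (-t * Real.log n + t * ∑ i ∈ range k, (-u) ^ (i + 1) / (i + 1)) =
    -(t * ((∑ i ∈ range k, (-u) ^ (i + 1) / (i + 1)) + Real.log (1 - -u))) by ring, abs_neg, abs_mul, abs_of_nonneg ht]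
  gcongr
  refine this.trans ?_
  calc u ^ (k + 1) / (1 - u) <= (M ^ 2 / N) ^ (k + 1) / (1 / 2) := by
        gcongr
        linarith
    _ = _ := by ring

noncomputable def Sz (t:Real) (N N' : Nat) : Complex := ∑ n ∈ Ioc N N', e (-t * Real.log n)

lemma S_bound {t : Real} (ht : 0 <= t) {N N' M : Nat} (k:Nat) (hN : N <= N') (hM : 2 * M ^ 2 <= N) {B : Real}
    (hB : ∀ n ∈ Ioc N N', ‖Us M (al t k n)‖ <= B * M ^ 2) (hM1 : 1 <= M) :
    ‖Sz t N N'‖ <= (N' - N) * (B + t * (2 * ((M:Real) ^ 2 / N) ^ (k + 1))) + 2 * M ^ 2 := by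
  set R := t * (2 * (M ^ 2 / N) ^ (k + 1)) with hR
  have h1 : Sz t N N' * (M ^ 2 : Real) = ∑ a : Fin M, ∑ b : Fin M,
        (Sz t N N' - ∑ n ∈ Ioc N N', e (-t * log ((n + a * b : Nat) : Real))) +
      ∑ n ∈ Ioc N N', ∑ a : Fin M, ∑ b : Fin M, e (-t * log ((n + a * b : Nat) : Real)) := by
    have : ∑ n ∈ Ioc N N', ∑ a : Fin M, ∑ b : Fin M, e (-t * Real.log ((n + (a:Nat) * (b:Nat) : Nat) : Real)) =
        ∑ a : Fin M, ∑ b : Fin M, ∑ n ∈ Ioc N N', e (-t * Real.log ((n + (a:Nat) * (b:Nat) : Nat) : Real)) := by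
      rw [Finset.sum_comm]
      exact Finset.sum_congr rfl fun a _ => Finset.sum_comm
    rw [this, <- sum_add_distrib]
    simp_rw [<- sum_add_distrib, sub_add_cancel]
    simp [sq]; ring
  have h2 : ‖∑ a : Fin M, ∑ b : Fin M,
        (Sz t N N' - ∑ n ∈ Ioc N N', e (-t * log ((n + a * b : Nat) : Real)))‖ <= M * (M * (2 * M ^ 2)) := by
    refine (norm_sum_le_of_le _ (n := fun _ => (M * (2 * M ^ 2) : Real)) fun a _ => ?_).trans (le_of_eq (by simp))
    refine (norm_sum_le_of_le _ (n := fun _ => (2 * M ^ 2 : Real)) fun b _ => ?_).trans (le_of_eq (by simp))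
    refine (shift_bd (fun n => e (-t * log n)) (fun n => (norm_e _).le) hN (a * b)).trans ?_
    have : (a:Nat) * (b:Nat) <= M ^ 2 := by rw [sq]; exact Nat.mul_le_mul a.2.le b.2.le
    have : (((a:Nat) * (b:Nat) : Nat) : Real) <= M ^ 2 := by exact_mod_cast this
    linarith
  have h3 : ∀ n ∈ Ioc N N', ‖∑ a : Fin M, ∑ b : Fin M, e (-t * log ((n + a * b : Nat) : Real))‖ <= (B + R) * M ^ 2 := by
    intro n hn
    have hd : ∑ a : Fin M, ∑ b : Fin M, e (-t * log ((n + a * b : Nat) : Real)) =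
        e (-t * log n) * Us M (al t k n) + ∑ a : Fin M, ∑ b : Fin M,
          (e (-t * log ((n + a * b : Nat) : Real)) -
            e (-t * log n) * e (∑ j : Fin k, al t k n j * ((a:Real) * b) ^ (j.val + 1))) := by
      rw [Us, Finset.mul_sum, <- Finset.sum_add_distrib]
      simp_rw [mul_sum, <- sum_add_distrib, add_sub_cancel]
    rw [hd]
    refine (norm_add_le _ _).trans ?_
    rw [norm_mul, norm_e, one_mul, add_mul]
    refine add_le_add (hB n hn) ?_
    calc _ <= M * (M * R) := by
          refine (norm_sum_le_of_le _ (n := fun _ => (M * R : Real)) fun a _ => ?_).trans (le_of_eq (by simp))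
          refine (norm_sum_le_of_le _ (n := fun _ => R) fun b _ => ?_).trans (le_of_eq (by simp))
          exact taylor_bd ht k (mem_Ioc.1 hn).1 hM a.2 b.2
      _ = _ := by ring
  have h4 : ‖Sz t N N'‖ * M ^ 2 <= M * (M * (2 * M ^ 2)) + (N' - N) * ((B + R) * M ^ 2) := by
    have : ‖Sz t N N'‖ * M ^ 2 = ‖Sz t N N' * (M ^ 2 : Real)‖ := by
      rw [norm_mul]; simp
    rw [this, h1]
    refine (norm_add_le _ _).trans (add_le_add h2 ?_)
    refine (norm_sum_le_of_le _ h3).trans ?_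
    rw [Finset.sum_const, Nat.card_Ioc, nsmul_eq_mul, Nat.cast_sub hN]
  have h5 : ‖Sz t N N'‖ * M ^ 2 <= ((N' - N) * (B + R) + 2 * M ^ 2) * M ^ 2 := by
    refine h4.trans (le_of_eq ?_); ring
  exact le_of_mul_le_mul_right h5 (by positivity)

lemma good_W {T l : Real} {n M s J : Nat} (hT : 100 <= T) (hl : 0 <= l) (hM1 : exp (0.395 * l) <= M) (hM2 : M <= exp (0.4 * l))
    (hn1 : exp l <= n) (hn2 : n <= exp (1.005 * l)) (hJ1 : 2 * T <= J * l) (hJ2 : J * l <= 4 * T)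
    (hJ0 : 1 <= J) (hJs : J <= s) (hs : s * exp (-0.2 * T) <= 1) (hs2 : 1 + s + 2 * T <= exp (0.03 * T))
    {α : Real} (hα : |α| = exp T / (J * (n:Real) ^ J)) :
    Ws (s * M ^ J) α <= exp (-0.1 * T) * (3 * s * M ^ J) ^ 2 := by
  have hs1 : (1:Real) <= s := by exact_mod_cast hJ0.trans hJs
  have hJ' : (1:Real) <= J := by exact_mod_cast hJ0
  have hJs' : (J:Real) <= s := by exact_mod_cast hJs
  have hn0 : (0:Real) < n := lt_of_lt_of_le (exp_pos _) hn1
  have hMJ : exp (0.395 * (J * l)) <= M ^ J := by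
    calc exp (0.395 * (J * l)) = exp (0.395 * l) ^ J := by rw [<- exp_nat_mul]; congr 1; ring
      _ <= _ := by gcongr
  have hMJ2 : M ^ J <= exp (0.4 * (J * l)) := by
    calc _ <= exp (0.4 * l) ^ J := by gcongr
      _ = _ := by rw [<- exp_nat_mul]; congr 1; ring
  have hnJ1 : exp (J * l) <= (n:Real) ^ J := by
    calc exp (J * l) = exp l ^ J := by rw [<- exp_nat_mul]
      _ <= _ := by gcongr
  have hnJ2 : n ^ J <= exp (1.005 * (J * l)) := by
    calc _ <= exp (1.005 * l) ^ J := by gcongr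
      _ = _ := by rw [<- exp_nat_mul]; congr 1; ring
  set X : Real := M ^ J with hX
  have hX0 : 0 < X := lt_of_lt_of_le (exp_pos _) hMJ
  have hm : ((s * M ^ J : Nat) : Real) = s * X := by push_cast; rfl
  have hX1 : exp (0.79 * T) <= X := le_trans (exp_le_exp.2 (by linarith)) hMJ
  have h1X : 1 <= X := le_trans (one_le_exp (by linarith)) hX1
  have hα0 : α ≠ 0 := by
    rw [<- abs_pos, hα]; positivity
  have hwrap : |α| * ((s * M ^ J : Nat) : Real) <= π := by
    rw [hm, hα]
    calc exp T / (J * n ^ J) * (s * X) <= exp T / (1 * exp (J * l)) * (s * exp (0.4 * (J * l))) := by gcongr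
      _ = s * exp (T - 0.6 * (J * l)) := by
        rw [one_mul, div_mul_eq_mul_div, div_eq_iff (exp_pos _).ne', mul_left_comm, <- exp_add, mul_assoc, <- exp_add]
        congr 2; ring
      _ <= s * exp (-0.2 * T) := by
        gcongr; linarith
      _ <= 1 := hs
      _ <= π := by linarith [pi_gt_three]
  have hW := Ws_good hα0 hwrap
  rw [hm] at hW
  have hlog : 1 + log (s * X) <= exp (0.03 * T) := by
    rw [log_mul (by positivity) hX0.ne']
    have h1 : log s <= s := log_le_self (by positivity)
    have h2 : log X <= 0.4 * (J * l) := by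
      rw [log_le_iff_le_exp hX0]; exact hMJ2
    linarith
  have hlog0 : 0 <= 1 + log (s * X) := by
    have : 0 <= log (s * X) := log_nonneg (one_le_mul_of_one_le_of_one_le hs1 h1X)
    linarith
  have hA : 2 * π / |α| * (1 + log (s * X)) <= 7 * (s * X) ^ 2 * exp (-0.11 * T) := by
    have h1 : 2 * π / |α| = 2 * π * J * ((n:Real) ^ J) * exp (-T) := by
      rw [hα, exp_neg]; field_simp
    have h2 : (n:Real) ^ J <= exp (0.86 * T) * X ^ 2 := by
      calc (n:Real) ^ J <= exp (1.005 * (J * l)) := hnJ2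
        _ = exp (0.215 * (J * l)) * (exp (0.395 * (J * l))) ^ 2 := by
          rw [<- exp_nat_mul, <- exp_add]; congr 1; push_cast; ring
        _ <= _ := mul_le_mul (exp_le_exp.2 (by linarith)) (pow_le_pow_left₀ (exp_pos _).le hMJ 2) (by positivity) (exp_pos _).le
    have h3 : (J:Real) <= s ^ 2 := by nlinarith
    rw [h1]
    calc 2 * π * J * ((n:Real) ^ J) * exp (-T) * (1 + log (s * X)) <=
          7 * (s:Real) ^ 2 * (exp (0.86 * T) * X ^ 2) * exp (-T) * exp (0.03 * T) := by
          gcongr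
          linarith [pi_lt_d2]
      _ = 7 * (s * X) ^ 2 * (exp (0.86 * T) * exp (-T) * exp (0.03 * T)) := by ring
      _ = _ := by
        rw [<- exp_add, <- exp_add]; congr 2; ring
  have hB : 2 * (s * X) + 1 <= 3 * (s * X) ^ 2 * exp (-0.11 * T) := by
    have h1 : 1 <= s * X := one_le_mul_of_one_le_of_one_le hs1 h1X
    have h2 : 1 <= X * exp (-0.11 * T) := by
      calc (1:Real) <= exp (0.79 * T) * exp (-0.11 * T) := by
            rw [<- exp_add]; exact one_le_exp (by linarith)
        _ <= _ := by gcongr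
    have h3 : 1 <= s * (X * exp (-0.11 * T)) := one_le_mul_of_one_le_of_one_le hs1 h2
    calc 2 * (s * X) + 1 <= 3 * (s * X) * 1 := by linarith
      _ <= 3 * (s * X) * (s * (X * exp (-0.11 * T))) := by gcongr
      _ = _ := by ring
  have hC : 10 * exp (-0.11 * T) <= 9 * exp (-0.1 * T) := by
    have h1 : exp (-0.1 * T) = exp (-0.11 * T) * exp (0.01 * T) := by rw [<- exp_add]; congr 1; ring
    have h2 : (2:Real) <= exp (0.01 * T) := by
      have := add_one_le_exp (0.01 * T); linarith
    rw [h1]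
    nlinarith [exp_pos (-0.11 * T)]
  calc Ws (s * M ^ J) α <= _ := hW
    _ <= (s * X) ^ 2 * (10 * exp (-0.11 * T)) := by linarith
    _ <= (s * X) ^ 2 * (9 * exp (-0.1 * T)) := by gcongr
    _ = _ := by ring

lemma prod_tri (k:Nat) (a b : Real) : ∏ j ∈ range k, (a * b ^ (j + 1)) ^ 2 = a ^ (2 * k) * b ^ (k * (k + 1)) := by
  induction k with
  | zero => simp
  | succ k ih => rw [prod_range_succ, ih]; ring

lemma prod_W {T l : Real} {n M s k : Nat} (hT : 100 <= T) (hl : 0 < l) (hlT : 0.75 * l <= T) (hM1 : exp (0.395 * l) <= M)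
    (hM2 : M <= exp (0.4 * l)) (hn1 : exp l <= n) (hn2 : n <= exp (1.005 * l)) (hk : 4 * T <= k * l)
    (hks : k <= s) (hs : s * exp (-0.2 * T) <= 1) (hs2 : 1 + s + 2 * T <= exp (0.03 * T)) :
    ∏ j, Ws (s * M ^ (j.val + 1)) (al (exp T) k n j) <=
      exp (-0.1 * T * (2 / 3 * (T / l))) * ((3 * s) ^ (2 * k) * (M:Real) ^ (k * (k + 1))) := by
  have hτ : 0.75 <= T / l := by rwa [le_div_iff₀ hl]
  have hM0 : 1 <= M := by
    have : (0:Real) < M := lt_of_lt_of_le (exp_pos _) hM1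
    exact_mod_cast this
  have hn0 : (0:Real) < n := lt_of_lt_of_le (exp_pos _) hn1
  have hk' : 4 * (T / l) <= k := by rw [<- mul_div_assoc, div_le_iff₀ hl]; exact hk
  have hs1 : 1 <= s := by
    have : (0:Real) < k := by linarith
    have : 0 < k := by exact_mod_cast this
    omega
  let P : Nat → Prop := fun j => 2 * T <= ((j + 1 : Nat) : Real) * l ∧ ((j + 1 : Nat) : Real) * l <= 4 * T
  have hstep : ∀ j : Fin k, Ws (s * M ^ (j.val + 1)) (al (exp T) k n j) <=
      (if P j.val then exp (-0.1 * T) else 1) * (3 * s * M ^ (j.val + 1)) ^ 2 := by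
    intro j
    split_ifs with h
    · refine good_W hT hl.le hM1 hM2 hn1 hn2 h.1 h.2 (by omega) (by omega) hs hs2 ?_
      unfold al
      rw [abs_div, abs_mul, abs_pow, abs_neg, abs_one, one_pow, mul_one, abs_of_pos (exp_pos _), abs_of_pos (by positivity)]
      push_cast; rfl
    · have h1 := Ws_triv (s * M ^ (j.val + 1)) (al (exp T) k n j)
      refine h1.trans ?_
      rw [one_mul]
      have : (1:Real) <= ((s * M ^ (j.val + 1) : Nat) : Real) := by
        exact_mod_cast Nat.mul_pos hs1 (pow_pos hM0 _)
      push_cast at this ⊢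
      gcongr
      linarith
  have h0 : ∏ j, Ws (s * M ^ (j.val + 1)) (al (exp T) k n j) <=
      ∏ j : Fin k, (if P j.val then exp (-0.1 * T) else 1) * (3 * s * M ^ (j.val + 1)) ^ 2 :=
    prod_le_prod (fun j _ => Ws_nonneg _ _) (fun j _ => hstep j)
  refine h0.trans ?_
  rw [Fin.prod_univ_eq_prod_range (fun j => (if P j then exp (-0.1 * T) else 1) * (3 * s * (M:Real) ^ (j + 1)) ^ 2) k,
    prod_mul_distrib, prod_tri, <- prod_filter, prod_const, <- exp_nat_mul]
  refine mul_le_mul_of_nonneg_right (exp_le_exp.2 ?_) (by positivity)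
  have hcard : #(Icc ⌈2 * (T / l)⌉₊ ⌊4 * (T / l)⌋₊) <= #(filter P (range k)) := by
    have hp : ∀ i ∈ Icc ⌈2 * (T / l)⌉₊ ⌊4 * (T / l)⌋₊, 1 <= i ∧ (2 * (T / l) <= i) ∧ (i <= 4 * (T / l)) := by
      intro i hi
      rw [mem_Icc] at hi
      have h1 := Nat.ceil_le.1 hi.1
      have h2 := (Nat.le_floor_iff (by linarith)).1 hi.2
      refine ⟨?_, h1, h2⟩
      have : (0:Real) < i := by linarith
      exact_mod_cast this
    refine card_le_card_of_injOn (fun i => i - 1) ?_ ?_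
    · intro i hi
      obtain ⟨h1, h2, h3⟩ := hp i hi
      have h4 : i <= k := by exact_mod_cast h3.trans hk'
      rw [mem_coe, mem_filter, mem_range]
      refine ⟨(by omega : i - 1 < k), ?_⟩
      show _ ∧ _
      rw [Nat.sub_add_cancel h1]
      constructor
      · rwa [<- mul_div_assoc, div_le_iff₀ hl] at h2
      · rwa [<- mul_div_assoc, le_div_iff₀ hl] at h3
    · intro i hi j hj hij
      have := (hp i hi).1; have := (hp j hj).1
      simp only at hij
      omega
  have hg : 2 / 3 * (T / l) <= (#(filter P (range k)) : Real) := by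
    have h1 : (#(Icc ⌈2 * (T / l)⌉₊ ⌊4 * (T / l)⌋₊) : Real) <= #(filter P (range k)) := by exact_mod_cast hcard
    rw [Nat.card_Icc] at h1
    have h2 : ((⌊4 * (T / l)⌋₊ + 1 : Nat) : Real) - (⌈2 * (T / l)⌉₊ : Real) <= ((⌊4 * (T / l)⌋₊ + 1 - ⌈2 * (T / l)⌉₊ : Nat) : Real) := by
      rw [sub_le_iff_le_add]; norm_cast; omega
    have h3 := Nat.lt_floor_add_one (4 * (T / l))
    have h4 := Nat.ceil_lt_add_one (show 0 <= 2 * (T / l) by linarith)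
    push_cast at h2
    linarith
  nlinarith

lemma U_Y {A : Nat} (hA : ∀ k, 2 <= k → ∀ r N, 1 <= N → (Jc (r*k) k N : Real) <= (k:Real)^(A*k^3+16*r*k^2+2*r^2*k) * (N:Real)^(ex k r))
    {k M : Nat} (hk : 2 <= k) (hM : 1 <= M) (α : Fin k → Real) {s : Nat} (hs : s = 9 * k * k) {R : Real}
    (hW : ∏ j, Ws (s * M ^ (j.val + 1)) (α j) <= R * ((3 * s) ^ (2 * k) * (M:Real) ^ (k * (k + 1)))) :
    ‖Us M α‖ ^ (2 * s * (2 * s)) <= ((M:Real) ^ 2) ^ (2 * s * (2 * s)) * ((k:Real) ^ (2 * (A + 306) * k ^ 3) *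
      (3 * s) ^ (2 * k) * (M:Real) ^ ((k * (k + 1) : Real) * exp (-9)) * R) := by
  have hM0 : (0:Real) < M := by exact_mod_cast hM
  have hM1 : (1:Real) <= M := by exact_mod_cast hM
  have hk0 : (0:Real) < k := by positivity
  have h1 := U_bound s M α
  have h2 := hA k hk (9 * k) M hM
  have hex : ex k (9 * k) <= 2 * s - k * (k + 1) / 2 + k * (k + 1) / 2 * exp (-9) := by
    have : (1 - 1 / (k:Real)) ^ (9 * k) <= exp (-9) := by
      have h3 : 1 - 1 / (k:Real) <= exp (-(1 / k)) := one_sub_le_exp_neg _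
      have h4 : 0 <= 1 - 1 / (k:Real) := by
        rw [sub_nonneg, div_le_one hk0]; exact_mod_cast (by omega : 1 <= k)
      calc _ <= exp (-(1 / k)) ^ (9 * k) := by gcongr
        _ = _ := by rw [<- exp_nat_mul]; congr 1; push_cast; field_simp
    unfold ex
    rw [hs]; push_cast
    have h5 : 0 <= (k:Real) * (k + 1) / 2 := by positivity
    nlinarith
  have hJ : (Jc s k M : Real) <= k ^ ((A + 306) * k ^ 3) * M ^ (2 * s - k * (k + 1) / 2 + k * (k + 1) / 2 * exp (-9) : Real) := by
    rw [hs] at hex ⊢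
    refine h2.trans ?_
    have h6 : A * k ^ 3 + 16 * (9 * k) * k ^ 2 + 2 * (9 * k) ^ 2 * k = (A + 306) * k ^ 3 := by ring
    rw [h6]
    gcongr
  have hJ2 : (Jc s k M : Real) ^ 2 <= (k:Real) ^ (2 * (A + 306) * k ^ 3) * ((M:Real) ^ (4 * s : Real) * (M:Real) ^ ((k * (k + 1) : Real) * exp (-9)) * (M:Real) ^ (-(k * (k + 1)) : Real)) := by
    calc (Jc s k M : Real) ^ 2 <= _ := pow_le_pow_left₀ (by positivity) hJ 2
      _ = _ := by
        rw [mul_pow, <- pow_mul, <- rpow_mul_natCast hM0.le, <- rpow_add hM0, <- rpow_add hM0]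
        congr 1
        · congr 1; ring
        · congr 1; push_cast; ring
  have hs1 : 1 <= s := by rw [hs]; nlinarith
  calc ‖Us M α‖ ^ (2 * s * (2 * s)) <= _ := h1
    _ <= M^((2*s-1)*(2*s)) * (M^(2*s))^(2*s-1) * (k ^ (2 * (A + 306) * k ^ 3) * (M ^ (4 * s : Real) * M ^ ((k * (k + 1) : Real) * exp (-9)) * M ^ (-(k * (k + 1)) : Real))) * (R * ((3 * s) ^ (2 * k) * M ^ (k * (k + 1)))) := by
      gcongr
      exact prod_nonneg fun j _ => Ws_nonneg _ _
    _ = (M^((2*s-1)*(2*s)) * (M^(2*s))^(2*s-1) * M ^ (4 * s : Real)) * (M ^ (-(k * (k + 1)) : Real) * M ^ (k * (k + 1))) * (k ^ (2 * (A + 306) * k ^ 3) *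
      (3 * s) ^ (2 * k) * M ^ ((k * (k + 1) : Real) * exp (-9)) * R) := by ring
    _ = _ := by
      have h7 : (M:Real) ^ (-(k * (k + 1)) : Real) * M ^ (k * (k + 1)) = 1 := by
        rw [<- rpow_natCast, <- rpow_add hM0]; push_cast; simp
      have h8 : (M:Real)^((2*s-1)*(2*s)) * (M^(2*s))^(2*s-1) * M ^ (4 * s : Real) = (M ^ 2) ^ (2 * s * (2 * s)) := by
        have : (M:Real) ^ (4 * s : Real) = (M:Real) ^ (4 * s) := by rw [<- rpow_natCast]; push_cast; rfl
        rw [this, <- pow_mul, <- pow_mul, <- pow_add, <- pow_add]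
        congr 1
        obtain ⟨u, rfl⟩ : ∃ u, s = u + 1 := ⟨s - 1, by omega⟩
        rw [show 2 * (u + 1) - 1 = 2 * u + 1 by omega]; ring
      rw [h7, h8, mul_one]

lemma exp9 : exp (-9) <= 1 / 8000 := by
  rw [exp_neg, <- one_div]
  apply one_div_le_one_div_of_le (by norm_num)
  have h1 := exp_one_gt_d9
  calc 8000 <= 2.718 ^ 9 := by norm_num
    _ <= exp 1 ^ 9 := by gcongr; linarith
    _ = exp 9 := by rw [<- exp_nat_mul]; norm_num

lemma ev_T : ∃ T0 : Real, 100 <= T0 ∧ ∀ T, T0 <= T → 1 + 9 * T ^ 2 + 2 * T <= exp (0.03 * T) := by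
  refine ⟨1000000, by norm_num, fun T hT => ?_⟩
  have h1 := quadratic_le_exp_of_nonneg (show 0 <= 0.01 * T by linarith)
  have h3 : exp (0.03 * T) = exp (0.01 * T) * exp (0.01 * T) * exp (0.01 * T) := by
    rw [<- exp_add, <- exp_add]; congr 1; ring
  rw [h3]
  nlinarith

set_option maxHeartbeats 1000000 in
lemma U_final : ∃ C0 : Real, 10000 <= C0 ∧ ∀ (T l : Real) (n M k : Nat), C0 <= T → 8 <= l → 0.75 * l <= T → C0 * (T * log T) <= l ^ 2 →
    exp (0.395 * l) <= M → M <= exp (0.4 * l) → exp l <= n → n <= exp (1.005 * l) → 6 * (T / l) <= k → k <= 8 * (T / l) →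
    ‖Us M (al (exp T) k n)‖ <= exp (-(3e-8 * (l ^ 3 / T ^ 2))) * (M:Real) ^ 2 := by
  obtain ⟨A, hA⟩ := vmvt
  obtain ⟨T0, hT0, hT0'⟩ := ev_T
  refine ⟨T0 + 10000 + 51200 * (2 * (A + 306) + 10), by linarith [(Nat.cast_nonneg A : (0:Real) <= A)], ?_⟩
  intro T l n M k hT hl hlT hC hM1 hM2 hn1 hn2 hk1 hk2
  have hA0 : (0:Real) <= A := Nat.cast_nonneg A
  have hT1 : T0 <= T := by linarith
  have hT2 : 10000 <= T := by linarith
  have hl0 : 0 < l := by linarith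
  set τ := T / l with hτd
  have hτ : 0.75 <= τ := by rwa [hτd, le_div_iff₀ hl0]
  have hTτ : T = τ * l := by rw [hτd]; field_simp
  have hk3 : (4:Real) < k := by linarith
  have hk5 : 5 <= k := by
    have : 4 < k := by exact_mod_cast hk3
    omega
  have hk5' : (5:Real) <= k := by exact_mod_cast hk5
  have hkT : (k:Real) <= T := by rw [hTτ]; nlinarith
  set s : Nat := 9 * k * k with hs
  have hsr : (s:Real) = 9 * k ^ 2 := by rw [hs]; push_cast; ring
  have hM0 : 1 <= M := by
    have : (0:Real) < M := lt_of_lt_of_le (exp_pos _) hM1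
    exact_mod_cast this
  have hM0' : (0:Real) < M := by exact_mod_cast hM0
  have hsT : (s:Real) <= 9 * T ^ 2 := by rw [hsr]; gcongr
  have hs2 : 1 + s + 2 * T <= exp (0.03 * T) := by linarith [hT0' T hT1]
  have hs3 : s * exp (-0.2 * T) <= 1 := by
    calc s * exp (-0.2 * T) <= exp (0.03 * T) * exp (-0.2 * T) := by gcongr; linarith
      _ <= 1 := by rw [<- exp_add]; exact exp_le_one_iff.2 (by linarith)
  have hW := prod_W (n := n) (M := M) (s := s) (k := k) (by linarith) hl0 hlT hM1 hM2 hn1 hn2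
    (by rw [hTτ]; nlinarith) (by rw [hs]; nlinarith) hs3 hs2
  have hU := U_Y hA (by omega) hM0 (al (exp T) k n) hs hW
  rw [<- hτd] at hU
  have hY : k ^ (2 * (A + 306) * k ^ 3) * (3 * s) ^ (2 * k) * M ^ ((k * (k + 1) : Real) * exp (-9)) *
      exp (-0.1 * T * (2 / 3 * τ)) <= exp (-(3e-8 * (l ^ 3 / T ^ 2))) ^ (2 * s * (2 * s)) := by
    have hlogT : 0 <= log T := log_nonneg (by linarith)
    have hkexp : (k:Real) <= exp (log T) := by rw [exp_log (by linarith)]; exact hkT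
    have h1 : (k:Real) ^ (2 * (A + 306) * k ^ 3) <= exp (2 * (A + 306) * k ^ 3 * log T) := by
      calc _ <= exp (log T) ^ (2 * (A + 306) * k ^ 3) := by gcongr
        _ = _ := by rw [<- exp_nat_mul]; push_cast; rfl
    have h2 : (3 * s : Real) ^ (2 * k) <= exp (10 * k ^ 3 * log T) := by
      have h3 : (3 * s : Real) <= exp (5 * log T) := by
        calc (3 * s : Real) <= (k:Real) ^ 5 := by
              rw [hsr]
              have : (27:Real) <= k ^ 3 := by
                calc (27:Real) <= 5 ^ 3 := by norm_num
                  _ <= _ := by gcongr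
              calc 3 * (9 * (k:Real) ^ 2) = 27 * (k:Real) ^ 2 := by ring
                _ <= (k:Real) ^ 3 * (k:Real) ^ 2 := by gcongr
                _ = _ := by ring
          _ <= exp (log T) ^ 5 := by gcongr
          _ = _ := by rw [<- exp_nat_mul]; push_cast; rfl
      calc _ <= exp (5 * log T) ^ (2 * k) := by gcongr
        _ = exp (10 * k * log T) := by rw [<- exp_nat_mul]; congr 1; push_cast; ring
        _ <= _ := by
          have : (k:Real) <= k ^ 3 := le_self_pow₀ (by linarith) (by norm_num)
          gcongr
    have h3 : (M:Real) ^ ((k * (k + 1) : Real) * exp (-9)) <= exp (0.0064 * (τ ^ 2 * l)) := by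
      calc _ <= exp (0.4 * l) ^ ((k * (k + 1) : Real) * exp (-9)) := by gcongr
        _ = exp (0.4 * l * ((k * (k + 1) : Real) * exp (-9))) := by rw [<- exp_mul]
        _ <= _ := by
          apply exp_le_exp.2
          have h4 : (k * (k + 1) : Real) * exp (-9) <= (2 * (8 * τ) ^ 2) * (1 / 8000) := by
            refine mul_le_mul ?_ exp9 (exp_pos _).le (by positivity)
            calc (k:Real) * (k + 1) <= (8 * τ) * (8 * τ + 8 * τ) := by gcongr; linarith
              _ = _ := by ring
          calc _ <= 0.4 * l * ((2 * (8 * τ) ^ 2) * (1 / 8000)) := by gcongr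
            _ = _ := by ring
    calc _ <= exp (2 * (A + 306) * k ^ 3 * log T) * exp (10 * k ^ 3 * log T) * exp (0.0064 * (τ ^ 2 * l)) * exp (-0.1 * T * (2 / 3 * τ)) := by gcongr
      _ = exp ((2 * (A + 306) + 10) * k ^ 3 * log T + 0.0064 * (τ ^ 2 * l) - 0.1 * T * (2 / 3 * τ)) := by
        rw [<- exp_add, <- exp_add, <- exp_add]; congr 1; ring
      _ <= exp (-0.04 * (τ ^ 2 * l)) := by
        apply exp_le_exp.2
        have h5 : (2 * (A + 306) + 10) * k ^ 3 * log T <= 0.01 * (τ ^ 2 * l) := by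
          have h6 : 51200 * (2 * (A + 306) + 10) * (τ * log T) <= l := by
            have h7 : 51200 * (2 * (A + 306) + 10) * (T * log T) <= l ^ 2 := by
              refine le_trans ?_ hC
              have : 0 <= T * log T := by positivity
              exact mul_le_mul_of_nonneg_right (by linarith) this
            rw [<- mul_le_mul_iff_left₀ hl0]
            calc _ = 51200 * (2 * (A + 306) + 10) * (τ * l * log T) := by ring
              _ <= _ := by rw [<- hTτ, <- sq]; exact h7
          calc (2 * (A + 306) + 10) * k ^ 3 * log T <= (2 * (A + 306) + 10) * (8 * τ) ^ 3 * log T := by gcongr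
            _ = 0.01 * τ ^ 2 * (51200 * (2 * (A + 306) + 10) * (τ * log T)) := by ring
            _ <= 0.01 * τ ^ 2 * l := by gcongr
            _ = _ := by ring
        have h8 : 0.1 * T * (2 / 3 * τ) = 0.2 / 3 * (τ ^ 2 * l) := by rw [hTτ]; ring
        have h9 : 0 <= τ ^ 2 * l := by positivity
        rw [h8]; linarith
      _ <= _ := by
        rw [<- exp_nat_mul]
        apply exp_le_exp.2
        have h10 : l ^ 3 / T ^ 2 = l / τ ^ 2 := by rw [hTτ]; field_simp
        rw [h10]
        have h11 : ((2 * s * (2 * s) : Nat) : Real) <= 1327104 * τ ^ 4 := by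
          push_cast
          rw [hsr]
          calc 2 * (9 * (k:Real) ^ 2) * (2 * (9 * k ^ 2)) <= 2 * (9 * (8 * τ) ^ 2) * (2 * (9 * (8 * τ) ^ 2)) := by gcongr
            _ = _ := by ring
        have h12 : ((2 * s * (2 * s) : Nat) : Real) * (3e-8 * (l / τ ^ 2)) <= 1327104 * τ ^ 4 * (3e-8 * (l / τ ^ 2)) := by gcongr
        have h13 : 1327104 * τ ^ 4 * (3e-8 * (l / τ ^ 2)) = 1327104 * 3e-8 * (τ ^ 2 * l) := by field_simp
        have h9 : 0 <= τ ^ 2 * l := by positivity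
        linarith
  have hfin : ‖Us M (al (exp T) k n)‖ ^ (2 * s * (2 * s)) <= (exp (-(3e-8 * (l ^ 3 / T ^ 2))) * M ^ 2) ^ (2 * s * (2 * s)) := by
    refine hU.trans ((mul_le_mul_of_nonneg_left hY (by positivity)).trans_eq ?_)
    rw [<- mul_pow, mul_comm]
  have hs0 : 2 * s * (2 * s) ≠ 0 := by
    positivity
  exact le_of_pow_le_pow_left₀ hs0 (by positivity) hfin

lemma zsum : ∃ C0 : Real, 10000 <= C0 ∧ ∀ (T l : Real) (N N' : Nat), C0 <= T → l = log N → 0 <= l → 0.75 * l <= T → C0 * (T * log T) <= l ^ 2 →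
    N <= N' → N' <= 2 * N → 1 <= N → ‖Sz (exp T) N N'‖ <= 5 * N * exp (-(3e-8 * (l ^ 3 / T ^ 2))) := by
  obtain ⟨C0, hC0, hU⟩ := U_final
  refine ⟨C0, hC0, ?_⟩
  intro T l N N' hT hlN hl0 hlT hC hN hN2 hN1
  have hN0 : (0:Real) < N := by exact_mod_cast hN1
  have hNl : N = exp l := by rw [hlN, exp_log hN0]
  have hl : 1000 <= l := by
    have h1 : 1 <= log T := by
      rw [le_log_iff_exp_le (by linarith)]; linarith [exp_one_lt_d9]
    have h3 : C0 * (T * 1) <= C0 * (T * log T) := by gcongr <;> linarith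
    nlinarith
  have hl' : 0 < l := by linarith
  have hT0 : 0 < T := by linarith
  set M := ⌊exp (0.4 * l)⌋₊ with hM
  have hM2 : M <= exp (0.4 * l) := Nat.floor_le (exp_pos _).le
  have hM1 : exp (0.395 * l) <= M := by
    have h1 := Nat.lt_floor_add_one (exp (0.4 * l))
    rw [<- hM] at h1
    have h2 : exp (0.4 * l) = exp (0.395 * l) * exp (0.005 * l) := by rw [<- exp_add]; congr 1; ring
    have h3 := add_one_le_exp (0.005 * l)
    have h4 : 1 <= exp (0.395 * l) := one_le_exp (by linarith)
    nlinarith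
  have hM0 : 1 <= M := by
    have : (0:Real) < M := lt_of_lt_of_le (exp_pos _) hM1
    exact_mod_cast this
  have hMsq : M ^ 2 <= exp (0.8 * l) := by
    calc _ <= exp (0.4 * l) ^ 2 := by gcongr
      _ = _ := by rw [<- exp_nat_mul]; congr 1; push_cast; ring
  have h2e : 2 <= exp (0.005 * l) := by linarith [add_one_le_exp (0.005 * l)]
  have h2M : 2 * M ^ 2 <= N := by
    have : 2 * (M:Real) ^ 2 <= N := by
      calc 2 * (M:Real) ^ 2 <= exp (0.005 * l) * exp (0.8 * l) := by gcongr
        _ <= _ := by rw [<- exp_add, hNl]; exact exp_le_exp.2 (by linarith)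
    exact_mod_cast this
  have hτ : 0.75 <= T / l := by rwa [le_div_iff₀ hl']
  set k := ⌈6 * (T / l)⌉₊ with hk
  have hk1 : 6 * (T / l) <= k := Nat.le_ceil _
  have hk2 : k <= 8 * (T / l) := by
    have := Nat.ceil_lt_add_one (show 0 <= 6 * (T / l) by linarith)
    linarith
  set δ := 3e-8 * (l ^ 3 / T ^ 2) with hδ
  have hδ1 : δ <= 0.15 * l := by
    have h1 : l ^ 3 / T ^ 2 <= 2 * l := by
      rw [div_le_iff₀ (by positivity)]
      have : (0.75 * l) ^ 2 <= T ^ 2 := by gcongr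
      nlinarith
    rw [hδ]; linarith
  have hS := S_bound (exp_pos T).le k hN h2M (B := exp (-δ)) (fun n hn => by
    rw [mem_Ioc] at hn
    refine hU T l n M k hT (by linarith) hlT hC hM1 hM2 ?_ ?_ hk1 hk2
    · rw [<- hNl]; exact_mod_cast hn.1.le
    · calc (n:Real) <= 2 * N := by exact_mod_cast hn.2.trans hN2
        _ <= exp (0.005 * l) * exp l := by rw [hNl]; gcongr
        _ = _ := by rw [<- exp_add]; congr 1; ring) hM0
  refine hS.trans ?_
  have hE1 : exp T * (2 * ((M:Real) ^ 2 / N) ^ (k + 1)) <= 2 * exp (-δ) := by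
    have h1 : (M:Real) ^ 2 / N <= exp (-0.2 * l) := by
      rw [div_le_iff₀ hN0, hNl, <- exp_add]
      exact hMsq.trans (exp_le_exp.2 (by linarith))
    have h2 : ((M:Real) ^ 2 / N) ^ (k + 1) <= exp (-1.2 * T) := by
      calc _ <= exp (-0.2 * l) ^ (k + 1) := by gcongr
        _ = exp (-0.2 * l * (k + 1)) := by rw [<- exp_nat_mul]; congr 1; push_cast; ring
        _ <= _ := by
          apply exp_le_exp.2
          have : 6 * T <= k * l := by rwa [<- mul_div_assoc, div_le_iff₀ hl'] at hk1
          nlinarith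
    calc _ <= exp T * (2 * exp (-1.2 * T)) := by gcongr
      _ = 2 * exp (T + -1.2 * T) := by rw [exp_add]; ring
      _ <= _ := by gcongr; linarith
  have hE2 : (M:Real) ^ 2 <= N * exp (-δ) := by
    rw [hNl, <- exp_add]
    exact hMsq.trans (exp_le_exp.2 (by linarith))
  have hNN : (N':Real) - N <= N := by
    have : (N':Real) <= 2 * N := by exact_mod_cast hN2
    linarith
  have h5 : ((N':Real) - N) * (exp (-δ) + exp T * (2 * ((M:Real) ^ 2 / N) ^ (k + 1))) <= N * (3 * exp (-δ)) := by
    refine mul_le_mul hNN (by linarith) (by positivity) hN0.le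
  linarith

lemma abel_bd {w : Nat → Real} {z : Nat → Complex} {a b : Nat} (hab : a <= b) {B : Real} (hw : ∀ n, a <= n → w (n + 1) <= w n) (hw0 : ∀ n, 0 <= w n)
    (hB : ∀ m, a <= m → m <= b → ‖∑ n ∈ Ioc a m, z n‖ <= B) : ‖∑ n ∈ Ioc a b, (w n : Complex) * z n‖ <= w a * B := by
  have key : ∀ m, a <= m → m <= b → ‖∑ n ∈ Ioc a m, (w n : Complex) * z n - w m * ∑ n ∈ Ioc a m, z n‖ <= (w a - w m) * B := by
    intro m hm
    induction m, hm using Nat.le_induction with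
    | base => simp
    | succ m hm ih =>
      intro hmb
      rw [sum_Ioc_succ_top hm, sum_Ioc_succ_top hm]
      have h1 : ∑ n ∈ Ioc a m, (w n : Complex) * z n + w (m + 1) * z (m + 1) - w (m + 1) * (∑ n ∈ Ioc a m, z n + z (m + 1)) =
        (∑ n ∈ Ioc a m, (w n : Complex) * z n - w m * ∑ n ∈ Ioc a m, z n) + ((w m - w (m + 1) : Real) : Complex) * ∑ n ∈ Ioc a m, z n := by
        push_cast; ring
      rw [h1]
      refine (norm_add_le _ _).trans ?_
      rw [norm_mul, Complex.norm_real, norm_of_nonneg (sub_nonneg.2 (hw m hm))]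
      have h2 := ih (by omega)
      have h3 := mul_le_mul_of_nonneg_left (hB m hm (by omega)) (sub_nonneg.2 (hw m hm))
      linarith
  have h1 := key b hab le_rfl
  have h2 : ‖(w b : Complex) * ∑ n ∈ Ioc a b, z n‖ <= w b * B := by
    rw [norm_mul, Complex.norm_real, norm_of_nonneg (hw0 b)]
    exact mul_le_mul_of_nonneg_left (hB b hab le_rfl) (hw0 b)
  calc _ = ‖(∑ n ∈ Ioc a b, (w n : Complex) * z n - w b * ∑ n ∈ Ioc a b, z n) + w b * ∑ n ∈ Ioc a b, z n‖ := by rw [sub_add_cancel]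
    _ <= _ := norm_add_le _ _
    _ <= _ := by linarith

lemma cpow_split {n : Nat} (hn : 1 <= n) (σ t : Real) : (n:Complex) ^ (-(σ + t * I)) = ((n:Real) ^ (-σ) : Real) * e (-t * log n) := by
  have hn0 : (0:Real) < n := by exact_mod_cast hn
  rw [neg_add, Complex.cpow_add _ _ (by exact_mod_cast hn0.ne'), Complex.ofReal_cpow hn0.le]
  congr 1
  · push_cast; rfl
  · rw [Complex.cpow_def_of_ne_zero (by exact_mod_cast hn0.ne')]
    unfold e
    congr 1
    push_cast
    rw [<- Complex.natCast_log]; ring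

lemma block : ∃ C0 : Real, 10000 <= C0 ∧ ∀ (T q σ : Real) (a:Nat), C0 <= T → 0 < q → C0 * q <= 1 → q ^ 3 = log T / T →
    1 - 3e-8 * q ^ 2 <= σ → 1 <= a → 0.75 * log a <= T →
    ‖∑ n ∈ Ioc a (2 * a), (n:Complex) ^ (-(σ + exp T * I))‖ <= T := by
  obtain ⟨C0, hC0, hz⟩ := zsum
  refine ⟨C0, hC0, ?_⟩
  intro T q σ a hT hq hq1 hq3 hσ ha hla
  have ha0 : (0:Real) < a := by exact_mod_cast ha
  have ha1 : (1:Real) <= a := by exact_mod_cast ha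
  have hT0 : 0 < T := by linarith
  have hl0 : 0 <= log a := log_nonneg ha1
  have hlogT : T * q ^ 3 = log T := by rw [hq3]; field_simp
  have hσ0 : 0 <= σ := by
    have : q <= 1 := by nlinarith
    nlinarith
  have h1 : ∑ n ∈ Ioc a (2 * a), (n:Complex) ^ (-(σ + exp T * I)) =
      ∑ n ∈ Ioc a (2 * a), ((n ^ (-σ) : Real) : Complex) * e (-(exp T) * log n) := by
    refine sum_congr rfl fun n hn => ?_
    rw [mem_Ioc] at hn
    have := cpow_split (by omega : 1 <= n) σ (exp T)
    rw [<- this]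
  rw [h1]
  have hmono : ∀ n : Nat, a <= n → (((n + 1 : Nat) : Real) ^ (-σ)) <= n ^ (-σ) := fun n hn => by
    have : (0:Real) < n := by exact_mod_cast (by omega : 0 < n)
    exact rpow_le_rpow_of_nonpos this (by push_cast; linarith) (by linarith)
  have haη : (a:Real) * (a:Real) ^ (-σ) <= exp (3e-8 * q ^ 2 * log a) := by
    rw [show (a:Real) * (a:Real) ^ (-σ) = (a:Real) ^ (1 - σ) by rw [sub_eq_add_neg, rpow_add ha0, rpow_one], rpow_def_of_pos ha0]
    apply exp_le_exp.2
    rw [mul_comm]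
    gcongr; linarith
  have main : ∀ B, (∀ m, a <= m → m <= 2 * a → ‖Sz (exp T) a m‖ <= a * B) → 0 <= B →
      exp (3e-8 * q ^ 2 * log a) * B <= T → 
      ‖∑ n ∈ Ioc a (2 * a), ((n ^ (-σ) : Real) : Complex) * e (-(exp T) * log n)‖ <= T := by
    intro B hB hB0 hBT
    have := abel_bd (w := fun n => (n:Real) ^ (-σ)) (z := fun n => e (-(exp T) * log n)) (by omega : a <= 2 * a) hmono (fun n => by positivity) hB
    refine this.trans (le_trans ?_ hBT)
    rw [<- mul_assoc, mul_comm _ (a:Real)]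
    gcongr
  by_cases hc : T * q <= log a
  · refine main (5 * exp (-(3e-8 * (log a ^ 3 / T ^ 2)))) ?_ (by positivity) ?_
    · intro m hm1 hm2
      have := hz T (log a) a m hT rfl hl0 hla ?_ hm1 hm2 ha
      · linarith
      · calc C0 * (T * log T) = (C0 * q) * (T * q) ^ 2 := by rw [<- hlogT]; ring
          _ <= 1 * (log a) ^ 2 := by gcongr
          _ = _ := one_mul _
    · rw [mul_left_comm, <- exp_add]
      have : exp (3e-8 * q ^ 2 * log a + -(3e-8 * (log a ^ 3 / T ^ 2))) <= 1 := by
        rw [exp_le_one_iff]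
        have : q ^ 2 * log a <= log a ^ 3 / T ^ 2 := by
          rw [le_div_iff₀ (by positivity)]
          calc q ^ 2 * log a * T ^ 2 = (T * q) ^ 2 * log a := by ring
            _ <= (log a) ^ 2 * log a := by gcongr
            _ = _ := by ring
        linarith
      linarith
  · push Not at hc
    refine main 1 ?_ zero_le_one ?_
    · intro m hm1 hm2
      unfold Sz
      refine (norm_sum_le _ _).trans ?_
      simp only [norm_e, sum_const, Nat.card_Ioc, nsmul_eq_mul, mul_one]
      exact_mod_cast (by omega)
    · rw [mul_one]
      calc exp (3e-8 * q ^ 2 * log a) <= exp (log T) := by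
            apply exp_le_exp.2
            nlinarith
        _ = T := exp_log hT0

noncomputable def hz (n:Nat) (s:Complex) : Complex := (s - 1) * ((n + 1 : Nat) : Complex) ^ (-s) + ((n + 1 : Nat) : Complex) ^ (1 - s) - (n:Complex) ^ (1 - s)

lemma hz_bd {n : Nat} (hn : 1 <= n) {s : Complex} (hs : 0 < s.re) : ‖hz n s‖ <= ‖s - 1‖ * ‖s‖ * (n:Real) ^ (-s.re - 1) := by
  have hn0 : (0:Real) < n := by exact_mod_cast hn
  have hs0 : s ≠ 0 := fun h => by simp [h] at hs
  have hd1 : ∀ x ∈ Set.Icc (n:Real) (n + 1), HasDerivWithinAt (fun y : Real => (y:Complex) ^ (-s)) (-s * x ^ (-s - 1)) (Set.Icc n (n + 1)) x := by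
    intro x hx
    have hx0 : x ≠ 0 := (lt_of_lt_of_le hn0 hx.1).ne'
    exact (hasDerivAt_ofReal_cpow_const hx0 (neg_ne_zero.2 hs0)).hasDerivWithinAt
  have hb1 : ∀ x ∈ Set.Icc (n:Real) (n + 1), ‖(((n + 1 : Real) : Complex)) ^ (-s) - x ^ (-s)‖ <= ‖s‖ * n ^ (-s.re - 1) := by
    intro x hx
    have := (convex_Icc (n:Real) (n + 1)).norm_image_sub_le_of_norm_hasDerivWithin_le (C := ‖s‖ * (n:Real) ^ (-s.re - 1)) hd1 (fun y hy => by
      have hy0 : 0 < y := lt_of_lt_of_le hn0 hy.1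
      rw [norm_mul, norm_neg, Complex.norm_cpow_eq_rpow_re_of_pos hy0]
      refine mul_le_mul_of_nonneg_left ?_ (norm_nonneg _)
      simp only [Complex.sub_re, Complex.neg_re, Complex.one_re]
      exact rpow_le_rpow_of_nonpos hn0 hy.1 (by linarith)) hx (Set.right_mem_Icc.2 (by linarith))
    refine this.trans ?_
    have h1 : ‖n + 1 - x‖ <= 1 := by
      rw [norm_eq_abs, abs_le]; constructor <;> linarith [hx.1, hx.2]
    have h2 : 0 <= ‖s‖ * n ^ (-s.re - 1) := by positivity
    nlinarith
  by_cases h1 : s = 1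
  · subst h1; simp [hz]
  have hs1 : 1 - s ≠ 0 := fun h => h1 (by linear_combination -h)
  have hd2 : ∀ x ∈ Set.Icc (n:Real) (n + 1), HasDerivWithinAt (fun y : Real => (s - 1) * (((n + 1 : Real) : Complex)) ^ (-s) * y + y ^ (1 - s))
      ((s - 1) * (((n + 1 : Real) : Complex)) ^ (-s) * 1 + (1 - s) * x ^ (-s)) (Set.Icc n (n + 1)) x := by
    intro x hx
    have hx0 : x ≠ 0 := (lt_of_lt_of_le hn0 hx.1).ne'
    have h2 := hasDerivAt_ofReal_cpow_const hx0 hs1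
    rw [show 1 - s - 1 = -s by ring] at h2
    exact (((Complex.ofRealCLM.hasDerivAt (x := x)).const_mul _).add h2).hasDerivWithinAt
  have h3 := (convex_Icc (n:Real) (n + 1)).norm_image_sub_le_of_norm_hasDerivWithin_le (C := ‖s - 1‖ * (‖s‖ * n ^ (-s.re - 1))) hd2 (fun y hy => by
      have : (s - 1) * (((n + 1 : Real) : Complex)) ^ (-s) * 1 + (1 - s) * (y:Complex) ^ (-s) = (s - 1) * ((((n + 1 : Real) : Complex)) ^ (-s) - (y:Complex) ^ (-s)) := by ring
      rw [this, norm_mul]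
      gcongr
      exact hb1 y hy) (Set.left_mem_Icc.2 (by linarith)) (Set.right_mem_Icc.2 (by linarith))
  have h4 : hz n s = (s - 1) * (((n + 1 : Real) : Complex)) ^ (-s) * ((n + 1 : Real) : Complex) + ((n + 1 : Real) : Complex) ^ (1 - s) - ((s - 1) * (((n + 1 : Real) : Complex)) ^ (-s) * (n:Complex) + (n:Complex) ^ (1 - s)) := by
    unfold hz; push_cast; ring
  rw [h4]
  simpa [mul_assoc] using h3

lemma hz_sum (s:Complex) (N:Nat) : ∑ n ∈ range N, hz (n + 1) s = (s - 1) * ∑ n ∈ range N, ((n + 2 : Nat) : Complex) ^ (-s) + ((N + 1 : Nat) : Complex) ^ (1 - s) - 1 := by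
  induction N with
  | zero => simp
  | succ N ih => rw [sum_range_succ, ih, sum_range_succ, hz]; push_cast; ring_nf

lemma hz_summable {δ : Real} (hδ : 0 < δ) (A:Real) : Summable fun n : Nat => A * ((n + 1 : Nat) : Real) ^ (-δ - 1) :=
  ((summable_nat_add_iff 1).2 (summable_nat_rpow.2 (by linarith))).mul_left A

lemma zeta1_of_one_lt {s : Complex} (hs : 1 < s.re) : ∑' n, hz (n + 1) s = riemannZeta₁ s - s := by
  have hsum : Summable fun n => hz (n + 1) s :=
    Summable.of_norm_bounded (hz_summable (δ := s.re) (by linarith) (‖s - 1‖ * ‖s‖)) fun n => hz_bd (by omega) (by linarith)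
  have h1 := hsum.hasSum.tendsto_sum_nat
  have hs1 : s ≠ 1 := fun h => by simp [h] at hs
  have hz1 : riemannZeta₁ s = (s - 1) * riemannZeta s := by
    rw [riemannZeta_eq_inv_sub_mul hs1, mul_inv_cancel_left₀ (sub_ne_zero.2 hs1)]
  have h2 : HasSum (fun n : Nat => ((n + 2 : Nat) : Complex) ^ (-s)) (riemannZeta s - 1) := by
    have h3 : HasSum (fun n : Nat => (n:Complex) ^ (-s)) (riemannZeta s) := by
      have hss : Summable (fun n : Nat => (n:Complex) ^ (-s)) := by
        have := Complex.summable_one_div_nat_cpow.2 hs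
        refine this.congr fun n => ?_
        rw [Complex.cpow_neg, one_div]
      rw [zeta_eq_tsum_one_div_nat_cpow hs]
      convert hss.hasSum using 2
      funext n
      rw [Complex.cpow_neg, one_div]
    have h4 := (hasSum_nat_add_iff' 2).2 h3
    simp only [sum_range_succ, range_zero, sum_empty, Nat.cast_zero, zero_add, Nat.cast_one, Complex.one_cpow] at h4
    rwa [Complex.zero_cpow (by intro h; have := congrArg Complex.re h; simp at this; linarith), zero_add] at h4
  have h5 : Filter.Tendsto (fun N : Nat => ∑ n ∈ range N, hz (n + 1) s) Filter.atTop (nhds ((s - 1) * (riemannZeta s - 1) + 0 - 1)) := by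
    simp_rw [hz_sum]
    refine (((h2.tendsto_sum_nat).const_mul _).add ?_).sub_const 1
    rw [tendsto_zero_iff_norm_tendsto_zero]
    have h6 : ∀ N : Nat, ‖((N + 1 : Nat) : Complex) ^ (1 - s)‖ = ((N + 1 : Nat) : Real) ^ (-(s.re - 1)) := by
      intro N
      rw [Complex.norm_natCast_cpow_of_pos (by omega)]
      congr 1; simp
    simp_rw [h6]
    exact ((tendsto_rpow_neg_atTop (by linarith)).comp tendsto_natCast_atTop_atTop).comp (Filter.tendsto_add_atTop_nat 1)
  rw [tendsto_nhds_unique h1 h5, hz1]; ring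

lemma zeta1_eq {s : Complex} (hs : 0 < s.re) : HasSum (fun n => hz (n + 1) s) (riemannZeta₁ s - s) := by
  have hsum : Summable fun n => hz (n + 1) s :=
    Summable.of_norm_bounded (hz_summable (δ := s.re) hs (‖s - 1‖ * ‖s‖)) fun n => hz_bd (by omega) hs
  suffices h : ∑' n, hz (n + 1) s = riemannZeta₁ s - s by rw [<- h]; exact hsum.hasSum
  set δ := min (s.re / 2) 1 with hδ
  have hδ0 : 0 < δ := by rw [hδ]; exact lt_min (by linarith) one_pos
  have hδ1 : δ <= 1 := min_le_right _ _
  have hδs : δ < s.re := lt_of_le_of_lt (min_le_left _ _) (by linarith)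
  set R := ‖s‖ + 4 with hR
  have hR4 : 4 <= R := by rw [hR]; linarith [norm_nonneg s]
  set U := {z : Complex | δ < z.re} ∩ Metric.ball 0 R with hU
  have hUo : IsOpen U := (isOpen_lt continuous_const Complex.continuous_re).inter Metric.isOpen_ball
  have hUc : Convex Real U := (convex_halfSpace_re_gt δ).inter (convex_ball 0 R)
  have hF : DifferentiableOn Complex (fun z => ∑' n, hz (n + 1) z) U := by
    refine Complex.differentiableOn_tsum_of_summable_norm (hz_summable hδ0 ((R + 1) * R)) ?_ hUo ?_
    · intro n z _
      unfold hz
      apply DifferentiableAt.differentiableWithinAt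
      have h1 : ((n + 1 + 1 : Nat) : Complex) ≠ 0 := Nat.cast_ne_zero.2 (by omega)
      have h2 : ((n + 1 : Nat) : Complex) ≠ 0 := Nat.cast_ne_zero.2 (by omega)
      refine (((differentiableAt_id.sub_const 1).mul ((differentiableAt_id.neg).const_cpow (Or.inl h1))).add
        ((differentiableAt_id.const_sub 1).const_cpow (Or.inl h1))).sub ((differentiableAt_id.const_sub 1).const_cpow (Or.inl h2))
    · intro n z hz'
      have hzre : δ < z.re := hz'.1
      have hzR : ‖z‖ < R := by simpa using hz'.2
      refine (hz_bd (by omega) (by linarith)).trans ?_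
      have h1 : ‖z - 1‖ <= R + 1 := (norm_sub_le _ _).trans (by rw [norm_one]; linarith)
      have h2 : (1:Real) <= ((n + 1 : Nat) : Real) := by push_cast; linarith [(Nat.cast_nonneg n : (0:Real) <= n)]
      gcongr
  have hG : DifferentiableOn Complex (fun z => riemannZeta₁ z - z) U := by
    intro z _; exact (differentiable_riemannZeta₁.sub differentiable_id).differentiableAt.differentiableWithinAt
  have h2U : 2 ∈ U := ⟨by show δ < (2:Complex).re; simp; linarith, by simp; linarith⟩
  have hsU : s ∈ U := ⟨hδs, by simp [hR]⟩
  refine (hF.analyticOnNhd hUo).eqOn_of_preconnected_of_eventuallyEq (hG.analyticOnNhd hUo) hUc.isPreconnected h2U ?_ hsU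
  have : {z : Complex | 1 < z.re} ∈ nhds (2:Complex) := (isOpen_lt continuous_const Complex.continuous_re).mem_nhds (by simp)
  filter_upwards [this] with z hz'
  exact zeta1_of_one_lt hz'

lemma q_small (C0:Real) (hC0 : 0 < C0) : ∃ T0 : Real, ∀ T q : Real, T0 <= T → 0 < q → q ^ 3 = log T / T → C0 * q <= 1 := by
  have h1 := isLittleO_log_id_atTop.tendsto_div_nhds_zero
  have h2 := h1.eventually (gt_mem_nhds (show 0 < 1 / C0 ^ 3 by positivity))
  obtain ⟨T0, h3⟩ := Filter.eventually_atTop.1 h2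
  refine ⟨T0, fun T q hT hq hq3 => ?_⟩
  have h4 := h3 T hT
  simp only [id] at h4
  rw [<- hq3, lt_div_iff₀ (by positivity), <- mul_pow] at h4
  by_contra h
  push Not at h
  have : 1 <= (q * C0) ^ 3 := one_le_pow₀ (by linarith)
  linarith

lemma tail_bd : ∃ Z : Real, 0 <= Z ∧ ∀ (s:Complex) (N:Nat), 0.1 <= s.re →
    ‖∑' n, hz (n + N + 1) s‖ <= ‖s - 1‖ * ‖s‖ * (((N + 1 : Nat) : Real) ^ (-(s.re - 0.1)) * Z) := by
  have hS := hz_summable (δ := 0.1) (by norm_num) 1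
  refine ⟨∑' n : Nat, 1 * ((n + 1 : Nat) : Real) ^ (-(0.1 : Real) - 1), tsum_nonneg fun n => by positivity, ?_⟩
  intro s N hs
  rw [<- tsum_mul_left, <- tsum_mul_left]
  refine tsum_of_norm_bounded ((hS.mul_left _).mul_left _).hasSum fun n => ?_
  refine (hz_bd (by omega) (by linarith)).trans ?_
  refine mul_le_mul_of_nonneg_left ?_ (by positivity)
  have h0 : 0 < ((n + N + 1 : Nat) : Real) := by positivity
  rw [one_mul, show -s.re - 1 = -(s.re - 0.1) + (-(0.1 : Real) - 1) by ring, rpow_add h0]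
  have h1 : ((N + 1 : Nat) : Real) <= ((n + N + 1 : Nat) : Real) := by exact_mod_cast (by omega)
  have h2 : ((n + 1 : Nat) : Real) <= ((n + N + 1 : Nat) : Real) := by exact_mod_cast (by omega)
  exact mul_le_mul (rpow_le_rpow_of_nonpos (by positivity) h1 (by linarith)) (rpow_le_rpow_of_nonpos (by positivity) h2 (by norm_num))
    (by positivity) (by positivity)

lemma zeta_approx : ∃ Z : Real, 0 <= Z ∧ ∀ (s:Complex) (W:Nat), 1 <= W → 0.1 <= s.re → s ≠ 1 → ‖riemannZeta s‖ <=
    1 + ‖∑ n ∈ Ioc 1 W, (n:Complex) ^ (-s)‖ + (W:Real) ^ (1 - s.re) / ‖s - 1‖ + ‖s‖ * ((W:Real) ^ (-(s.re - 0.1)) * Z) := by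
  obtain ⟨Z, hZ0, hZ⟩ := tail_bd
  refine ⟨Z, hZ0, fun s W hW hs hs1 => ?_⟩
  obtain ⟨N, rfl⟩ : ∃ N, W = N + 1 := ⟨W - 1, by omega⟩
  have h1 := zeta1_eq (s := s) (by linarith)
  have h2 := h1.summable.sum_add_tsum_nat_add N
  rw [h1.tsum_eq, hz_sum] at h2
  have h3 : ∑ n ∈ Ioc 1 (N + 1), (n:Complex) ^ (-s) = ∑ n ∈ range N, ((n + 2 : Nat) : Complex) ^ (-s) := by
    clear h2 hW
    induction N with
    | zero => simp
    | succ N ih => rw [sum_Ioc_succ_top (by omega), ih, sum_range_succ]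
  rw [<- h3] at h2
  have hne : s - 1 ≠ 0 := sub_ne_zero.2 hs1
  have h4 : riemannZeta s = 1 + ∑ n ∈ Ioc 1 (N + 1), (n:Complex) ^ (-s) + ((N + 1 : Nat) : Complex) ^ (1 - s) / (s - 1) + (∑' n, hz (n + N + 1) s) / (s - 1) := by
    rw [riemannZeta_eq_inv_sub_mul hs1]
    field_simp
    linear_combination -h2
  rw [h4]
  refine (norm_add_le _ _).trans (add_le_add ((norm_add_le _ _).trans (add_le_add ((norm_add_le _ _).trans (by rw [norm_one])) ?_)) ?_)
  · rw [norm_div, norm_natCast_cpow_of_pos (by omega)]; simp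
  · rw [norm_div, div_le_iff₀ (norm_pos_iff.2 hne)]
    refine (hZ s N hs).trans (le_of_eq (by ring))

lemma zeta_bd : ∃ T0 : Real, 10000 <= T0 ∧ ∀ T q σ : Real, T0 <= T → 0 < q → q ^ 3 = log T / T → 1 - 3e-8 * q ^ 2 <= σ → σ <= 2 →
    ‖riemannZeta (σ + exp T * I)‖ <= T ^ 3 := by
  obtain ⟨C0, hC0, hb⟩ := block
  obtain ⟨T1, hT1⟩ := q_small C0 (by linarith)
  obtain ⟨Z, hZ0, hZ⟩ := zeta_approx
  refine ⟨max (C0 + 9 * Z) T1, le_max_of_le_left (by linarith), ?_⟩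
  intro T q σ hT hq hq3 hσ hσ2
  have hTC : C0 + 9 * Z <= T := le_trans (le_max_left _ _) hT
  have hq1 := hT1 T q (le_trans (le_max_right _ _) hT) hq hq3
  have hT0 : 0 < T := by linarith
  have hσ95 : 0.95 <= σ := by nlinarith
  have hlog2 := log_two_gt_d9
  have hlog2' := log_two_lt_d9
  set V := ⌊(4 / 3 * T) / log 2⌋₊ with hI
  have hI1 : V * log 2 <= 4 / 3 * T := by
    have := Nat.floor_le (show 0 <= (4 / 3 * T) / log 2 by positivity)
    rwa [le_div_iff₀ (by linarith)] at this
  have hI2 : 4 / 3 * T - 1 <= V * log 2 := by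
    have := Nat.lt_floor_add_one ((4 / 3 * T) / log 2)
    rw [div_lt_iff₀ (by linarith), <- hI] at this
    linarith
  have hsum : ∀ i ≤ V, ‖∑ n ∈ Ioc 1 ((2:Nat) ^ i), (n:Complex) ^ (-(σ + exp T * I : Complex))‖ <= i * T := by
    intro i
    induction i with
    | zero => simp
    | succ i ih =>
      intro hi
      have h1 := ih (by omega)
      rw [<- sum_Ioc_consecutive _ (Nat.one_le_two_pow (n := i)) (Nat.pow_le_pow_right (by omega) (by omega : i <= i + 1)), pow_succ', Nat.cast_succ, add_mul, one_mul]
      refine (norm_add_le _ _).trans (add_le_add h1 ?_)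
      refine hb T q σ (2 ^ i) (by linarith) hq hq1 hq3 hσ Nat.one_le_two_pow ?_
      push_cast
      rw [log_pow]
      have : (i:Real) <= V := by exact_mod_cast (by omega)
      nlinarith
  have hre : (σ + exp T * I : Complex).re = σ := by simp [Complex.exp_ofReal_re]
  have him : (σ + exp T * I : Complex).im = exp T := by simp [Complex.exp_ofReal_re]
  have hne : (σ + exp T * I : Complex) ≠ 1 := by
    intro h
    have := congrArg Complex.im h
    rw [him] at this; simp at this
  have h1 := hZ (σ + exp T * I) (2 ^ V) Nat.one_le_two_pow (by rw [hre]; linarith) hne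
  rw [hre] at h1
  have hn1 : exp T <= ‖(σ + exp T * I : Complex) - 1‖ := by
    have := Complex.abs_im_le_norm ((σ + exp T * I : Complex) - 1)
    rw [Complex.sub_im, him, one_im, sub_zero, abs_of_pos (exp_pos _)] at this
    exact this
  have hn2 : ‖(σ + exp T * I : Complex)‖ <= 3 * exp T := by
    have := Complex.norm_le_abs_re_add_abs_im (σ + exp T * I : Complex)
    rw [hre, him, abs_of_pos (exp_pos _), abs_of_pos (by linarith)] at this
    linarith [one_le_exp hT0.le]
  have hW : ((2 ^ V : Nat) : Real) = exp (V * log 2) := by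
    rw [exp_nat_mul, exp_log (by norm_num)]; push_cast; rfl
  have hA : ((2 ^ V : Nat) : Real) ^ (1 - σ) / ‖(σ + exp T * I : Complex) - 1‖ <= 1 := by
    rw [div_le_one (lt_of_lt_of_le (exp_pos _) hn1), hW, <- exp_mul]
    refine le_trans (exp_le_exp.2 ?_) hn1
    have : (0:Real) <= V * log 2 := by positivity
    nlinarith
  have hB : ‖(σ + exp T * I : Complex)‖ * (((2 ^ V : Nat) : Real) ^ (-(σ - 0.1)) * Z) <= 9 * Z := by
    calc _ <= 3 * exp T * (exp (1 - T) * Z) := by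
          rw [hW, <- exp_mul]
          gcongr
          nlinarith
      _ = 3 * exp (T + (1 - T)) * Z := by rw [exp_add]; ring
      _ <= 9 * Z := by
        gcongr
        rw [show T + (1 - T) = 1 by ring]; linarith [exp_one_lt_d9]
  have hI3 : (V:Real) <= 2 * T := by nlinarith
  have hC := hsum V le_rfl
  have hC' : V * T <= 2 * T * T := by gcongr
  refine h1.trans ?_
  have : 2 + 9 * Z + 2 * T * T <= T ^ 3 := by
    have hT4 : 10000 <= T := by linarith
    have h5 : 10000 * T <= T * T := by gcongr
    have h6 : 10000 * (T * T) <= T * (T * T) := by gcongr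
    have h7 : T ^ 3 = T * (T * T) := by ring
    linarith
  linarith

lemma logder_bd {f : Complex → Complex} {r M : Real} (hr : 0 < r) (hM : 0 < M) (hf : DifferentiableOn Complex f (Metric.ball 0 r))
    (h0 : ∀ z ∈ Metric.ball (0:Complex) r, f z ≠ 0) (hb : ∀ z ∈ Metric.ball (0:Complex) r, ‖f z‖ <= exp M * ‖f 0‖)
    {z : Complex} (hz : ‖z‖ <= r / 2) : ‖deriv f z / f z‖ <= 24 * M / r := by
  have h00 : (0:Complex) ∈ Metric.ball 0 r := by simpa using hr
  have hd : DifferentiableOn Complex (fun z => deriv f z / f z) (Metric.ball 0 r) :=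
    (hf.deriv Metric.isOpen_ball).div hf h0
  obtain ⟨h, hh⟩ := hd.isExactOn_ball
  set g : Complex → Complex := fun z => h z - h 0 with hg
  have hgd : ∀ z ∈ Metric.ball 0 r, HasDerivAt g (deriv f z / f z) z := fun z hz => (hh z hz).sub_const _
  have hgD : DifferentiableOn Complex g (Metric.ball 0 r) := fun z hz => (hgd z hz).differentiableAt.differentiableWithinAt
  have hconst : ∀ z ∈ Metric.ball 0 r, Complex.exp (-g z) * f z = f 0 := by
    intro z hz
    have := (convex_ball (0:Complex) r).is_const_of_fderivWithin_eq_zero (𝕜 := Complex)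
      (f := fun z => Complex.exp (-g z) * f z) ?_ ?_ hz h00
    · simpa [hg] using this
    · exact (hgD.neg.cexp).mul hf
    · intro w hw
      rw [fderivWithin_of_isOpen Metric.isOpen_ball hw]
      have hfw := (hf.differentiableAt (Metric.isOpen_ball.mem_nhds hw)).hasDerivAt
      have := ((hgd w hw).neg.cexp.mul hfw)
      have h2 : HasDerivAt (fun z => Complex.exp (-g z) * f z) 0 w := by
        have h3 := h0 w hw
        have h4 : Complex.exp ((-g) w) * -(deriv f w / f w) * f w + Complex.exp ((-g) w) * deriv f w = 0 := by
          field_simp; ring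
        rw [h4] at this
        exact this
      have := h2.hasFDerivAt.fderiv
      rw [this]; ext; simp
  have hre : ∀ z ∈ Metric.ball 0 r, (g z).re <= M := by
    intro z hz
    have h1 := hconst z hz
    have h2 := hb z hz
    rw [<- h1, norm_mul, Complex.norm_exp] at h2
    have h3 : 0 < ‖f z‖ := norm_pos_iff.2 (h0 z hz)
    rw [<- mul_assoc, <- exp_add] at h2
    have h4 : 1 <= exp (M + (-g z).re) := by
      by_contra h; push Not at h; nlinarith
    have := one_le_exp_iff.1 h4
    simp at this; linarith
  have hzb : z ∈ Metric.ball 0 r := by simp; linarith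
  rw [<- (hgd z hzb).deriv]
  have hcb : Metric.closedBall z (r / 4) ⊆ Metric.ball 0 r := by
    intro w hw
    simp at hw ⊢
    have := norm_le_norm_add_norm_sub z w
    rw [dist_eq_norm, norm_sub_rev] at hw
    linarith
  have := Complex.norm_deriv_le_of_forall_mem_sphere_norm_le (c := z) (R := r / 4) (C := 6 * M) (f := g) (by linarith)
    (hgD.diffContOnCl_ball hcb) ?_
  · calc _ <= _ := this
      _ = _ := by field_simp; ring
  · intro w hw
    have hwb := hcb (Metric.sphere_subset_closedBall hw)
    refine (Complex.borelCaratheodory_zero hM hgD (fun z hz => hre z hz) hr hwb (by simp [hg])).trans ?_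
    have hw4 : ‖w‖ <= 3 / 4 * r := by
      simp at hw
      have := norm_le_norm_add_norm_sub z w
      rw [norm_sub_rev] at hw
      linarith
    rw [div_le_iff₀ (by linarith)]
    nlinarith

lemma div_zero_step {R : Real} (hR : 0 < R) {f : Complex → Complex} {ρ : Complex} (hf : DifferentiableOn Complex f (Metric.ball 0 (2 * R)))
    (h0 : f 0 ≠ 0) (hρ : f ρ = 0) (hρR : ‖ρ‖ <= R / 3) :
    ∃ g : Complex → Complex, DifferentiableOn Complex g (Metric.ball 0 (2 * R)) ∧ g 0 = f 0 ∧ (∀ z, g z = 0 → f z = 0) ∧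
      (∀ z ∈ Metric.sphere (0:Complex) R, 2 * ‖g z‖ <= ‖f z‖) ∧ deriv f 0 / f 0 = deriv g 0 / g 0 - 1 / ρ := by
  have hρ0 : ρ ≠ 0 := by rintro rfl; exact h0 hρ
  have hρb : Metric.ball 0 (2 * R) ∈ nhds ρ := Metric.isOpen_ball.mem_nhds (by simp; linarith)
  have hfac : ∀ z, f z = (1 - z / ρ) * (-ρ * dslope f ρ z) := by
    intro z
    have := sub_smul_dslope f ρ z
    rw [hρ, sub_zero, smul_eq_mul] at this
    rw [<- this]; field_simp; ring
  have hd : DifferentiableOn Complex (fun z => -ρ * dslope f ρ z) (Metric.ball 0 (2 * R)) :=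
    ((Complex.differentiableOn_dslope hρb).2 hf).const_mul _
  have hg0 : (fun z => -ρ * dslope f ρ z) 0 = f 0 := by
    have := hfac 0; simp at this ⊢; rw [this]
  refine ⟨fun z => -ρ * dslope f ρ z, hd, hg0, ?_, ?_, ?_⟩
  · intro z hz
    rw [hfac z]; simp only at hz; rw [hz, mul_zero]
  · intro z hz
    rw [hfac z, norm_mul (1 - z / ρ)]
    have hz' : ‖z‖ = R := by simpa using hz
    refine mul_le_mul_of_nonneg_right ?_ (norm_nonneg _)
    have h1 : ‖z / ρ‖ - ‖(1:Complex)‖ <= ‖1 - z / ρ‖ := by rw [norm_sub_rev]; exact norm_sub_norm_le _ _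
    rw [norm_div, hz', norm_one] at h1
    have h2 : 3 <= R / ‖ρ‖ := by
      rw [le_div_iff₀ (norm_pos_iff.2 hρ0)]; linarith
    linarith
  · have h00 : Metric.ball (0:Complex) (2 * R) ∈ nhds 0 := Metric.isOpen_ball.mem_nhds (by simpa using hR)
    have hgd := (hd.differentiableAt h00).hasDerivAt
    have h1 : HasDerivAt (fun z : Complex => 1 - z / ρ) (-(1 / ρ)) 0 := ((hasDerivAt_id 0).div_const ρ).const_sub 1
    have h2 := h1.mul hgd
    have h3 : HasDerivAt f _ 0 := h2.congr_of_eventuallyEq (Filter.Eventually.of_forall hfac)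
    rw [h3.deriv]
    rw [hg0]
    rw [add_div, mul_div_assoc, show (-ρ * dslope f ρ 0) = f 0 from hg0, div_self h0]
    ring
/-- Landau-type lemma -/

lemma landau {R : Real} (hR : 0 < R) (n:Nat) : ∀ f : Complex → Complex, DifferentiableOn Complex f (Metric.ball 0 (2 * R)) → f 0 ≠ 0 →
    (∀ z ∈ Metric.ball (0:Complex) R, f z = 0 → z.re <= 0) → (∀ z ∈ Metric.sphere (0:Complex) R, ‖f z‖ <= 2 ^ n * ‖f 0‖) →
    -(deriv f 0 / f 0).re <= 72 * (n + 1) / R := by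
  have hmax : ∀ f : Complex → Complex, DifferentiableOn Complex f (Metric.ball 0 (2 * R)) → ∀ B,
    (∀ z ∈ Metric.sphere 0 R, ‖f z‖ <= B) → ∀ z ∈ Metric.closedBall 0 R, ‖f z‖ <= B := by
    intro f hf B hB z hz
    refine Complex.norm_le_of_forall_mem_frontier_norm_le (U := Metric.ball 0 R) Metric.isBounded_ball
      (hf.diffContOnCl_ball (Metric.closedBall_subset_ball (by linarith))) ?_ ?_
    · rwa [frontier_ball _ hR.ne']
    · rwa [closure_ball _ hR.ne']
  have base : ∀ n : Nat, ∀ f : Complex → Complex, DifferentiableOn Complex f (Metric.ball 0 (2 * R)) → f 0 ≠ 0 →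
      (∀ z ∈ Metric.sphere 0 R, ‖f z‖ <= 2 ^ n * ‖f 0‖) → (∀ ρ, f ρ = 0 → R / 3 < ‖ρ‖) →
      -(deriv f 0 / f 0).re <= 72 * (n + 1) / R := by
    intro n f hf h0 hb hex
    have := logder_bd (f := f) (r := R / 3) (M := n + 1) (z := 0) (by linarith) (by positivity)
      (hf.mono (Metric.ball_subset_ball (by linarith))) (fun z hz h => by
        have := hex z h; simp at hz; linarith) (fun z hz => by
        refine (hmax f hf _ hb z (by simp at hz ⊢; linarith)).trans ?_
        gcongr
        calc (2:Real) ^ n <= exp 1 ^ n := by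
              gcongr; linarith [exp_one_gt_d9]
          _ = exp n := by rw [<- exp_nat_mul, mul_one]
          _ <= _ := exp_le_exp.2 (by linarith)) (by simp; linarith)
    have h2 := (neg_le_abs _).trans ((abs_re_le_norm _).trans this)
    refine h2.trans (le_of_eq ?_)
    field_simp; ring
  induction n with
  | zero =>
    intro f hf h0 hz hb
    by_cases hex : ∃ ρ, f ρ = 0 ∧ ‖ρ‖ <= R / 3
    · obtain ⟨ρ, hρ, hρR⟩ := hex
      obtain ⟨g, hg, hg0, -, hgb, -⟩ := div_zero_step hR hf h0 hρ hρR
      exfalso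
      have := hmax g hg (‖f 0‖ / 2) (fun z hz => by linarith [hgb z hz, hb z hz]) 0 (by simp [hR.le])
      rw [hg0] at this
      linarith [norm_pos_iff.2 h0]
    · push Not at hex
      exact base 0 f hf h0 hb hex
  | succ n ih =>
    intro f hf h0 hz hb
    by_cases hex : ∃ ρ, f ρ = 0 ∧ ‖ρ‖ <= R / 3
    · obtain ⟨ρ, hρ, hρR⟩ := hex
      obtain ⟨g, hg, hg0, hgz, hgb, he⟩ := div_zero_step hR hf h0 hρ hρR
      have := ih g hg (by rwa [hg0]) (fun z hz' h => hz z hz' (hgz z h)) (fun z hz => by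
        have := hgb z hz; have := hb z hz; rw [hg0]; rw [pow_succ] at this; linarith)
      rw [he, sub_re]
      have h1 : (1 / ρ).re <= 0 := by
        have := hz ρ (by simp; linarith) hρ
        rw [one_div, Complex.inv_re]
        exact div_nonpos_of_nonpos_of_nonneg this (Complex.normSq_nonneg _)
      have h2 : 72 * ((n:Real) + 1) / R <= 72 * ((n + 1 : Nat) + 1) / R := by
        gcongr; simp
      linarith
    · push Not at hex
      exact base (n + 1) f hf h0 hb hex

lemma landau_zero {R : Real} (hR : 0 < R) (n:Nat) (f : Complex → Complex) (hf : DifferentiableOn Complex f (Metric.ball 0 (2 * R))) (h0 : f 0 ≠ 0)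
    (hz : ∀ z ∈ Metric.ball (0:Complex) R, f z = 0 → z.re <= 0) (hb : ∀ z ∈ Metric.sphere (0:Complex) R, ‖f z‖ <= 2 ^ n * ‖f 0‖)
    {ρ : Complex} (hρ : f ρ = 0) (hρR : ‖ρ‖ <= R / 3) :
    -(deriv f 0 / f 0).re <= 72 * (n + 1) / R + (1 / ρ).re := by
  obtain ⟨g, hg, hg0, hgz, hgb, he⟩ := div_zero_step hR hf h0 hρ hρR
  have := landau hR n g hg (by rwa [hg0]) (fun z hz' h => hz z hz' (hgz z h)) (fun z hz => by
        have := hgb z hz; have := hb z hz; rw [hg0]; linarith [norm_nonneg (g z)])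
  rw [he, sub_re]
  linarith

noncomputable def qq (T:Real) : Real := (log T / T) ^ ((1:Real) / 3)

lemma qq_pow {T : Real} (hT : 1 < T) : qq T ^ 3 = log T / T := by
  have : 0 <= log T / T := div_nonneg (log_pos hT).le (by linarith)
  rw [qq, <- rpow_natCast, <- rpow_mul this]; norm_num

lemma qq_pos {T : Real} (hT : 1 < T) : 0 < qq T := rpow_pos_of_pos (div_pos (log_pos hT) (by linarith)) _

lemma zeta_region : ∃ T0 : Real, 10000 <= T0 ∧ ∀ T : Real, ∀ s : Complex, T0 <= T → 1 - 1e-8 * qq T ^ 2 <= s.re → s.re <= 2 →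
    exp (T / 2) <= s.im → s.im <= exp (2 * T) → ‖riemannZeta s‖ <= T ^ 4 := by
  obtain ⟨T0, hT0, h⟩ := zeta_bd
  refine ⟨2 * T0, by linarith, fun T s hT h1 h2 h3 h4 => ?_⟩
  have him : 0 < s.im := (exp_pos _).trans_le h3
  have hs : s = s.re + (exp (log s.im) : Real) * I := by
    rw [exp_log him]; exact (Complex.re_add_im s).symm
  set T' := log s.im with hT'
  have ha : T / 2 <= T' := (le_log_iff_exp_le him).2 h3
  have hb : T' <= 2 * T := (log_le_iff_le_exp him).2 h4
  have he := exp_one_lt_d9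
  have hlog : log (2 * T) / (2 * T) <= log T' / T' :=
    log_div_self_antitoneOn (by simp; linarith) (by simp; linarith) hb
  have hq' := qq_pow (T := T') (by linarith)
  have hq := qq_pow (T := T) (by linarith)
  have hp := qq_pos (T := T) (by linarith)
  have hp' := qq_pos (T := T') (by linarith)
  have hT1 : log T / T / 2 <= log (2 * T) / (2 * T) := by
    rw [div_div, mul_comm T 2]
    have : log T <= log (2 * T) := log_le_log (by linarith) (by linarith)
    gcongr
    linarith
  have h07 : 0.7 * qq T <= qq T' := by
    by_contra hc
    push Not at hc
    have := pow_lt_pow_left₀ hc hp'.le (n := 3) (by norm_num)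
    rw [mul_pow, hq', hq] at this
    have h0 : 0 < log T / T := div_pos (log_pos (by linarith)) (by linarith)
    norm_num at this
    linarith
  have hh := h T' (qq T') s.re (by linarith) hp' hq' (by nlinarith) h2
  rw [<- hs] at hh
  refine hh.trans ?_
  calc T' ^ 3 <= (2 * T) ^ 3 := by gcongr; linarith
      _ = 8 * T ^ 3 := by ring
      _ <= T * T ^ 3 := by
        refine mul_le_mul_of_nonneg_right (by linarith) (pow_nonneg (by linarith) _)
      _ = _ := by ring

lemma z1_eq {s : Complex} (hs : s ≠ 1) : riemannZeta₁ s = (s - 1) * riemannZeta s := by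
  rw [riemannZeta_eq_inv_sub_mul hs]; field_simp

lemma z1_ne {s : Complex} (hs : 1 <= s.re) : riemannZeta₁ s ≠ 0 := by
  by_cases h : s = 1
  · rw [h, riemannZeta₁_one]; exact one_ne_zero
  · rw [z1_eq h]; exact mul_ne_zero (sub_ne_zero.2 h) (riemannZeta_ne_zero_of_one_le_re hs)

lemma logder_z1 {s : Complex} (hs : s ≠ 1) (h0 : riemannZeta s ≠ 0) :
    deriv riemannZeta s / riemannZeta s = deriv riemannZeta₁ s / riemannZeta₁ s - 1 / (s - 1) := by
  have h2 : riemannZeta₁ =ᶠ[nhds s] fun s => (s - 1) * riemannZeta s :=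
    (isOpen_ne.eventually_mem hs).mono fun z hz => z1_eq hz
  have h3 := (((hasDerivAt_id s).sub_const 1).mul (differentiableAt_riemannZeta hs).hasDerivAt).congr_of_eventuallyEq h2
  rw [h3.deriv, z1_eq hs]
  simp only [id]
  field_simp; ring

lemma z1_cpt : ∃ K : Real, 0 < K ∧ ∀ σ : Real, 1 <= σ → σ <= 2 → ‖riemannZeta₁ σ‖ <= K ∧ ‖deriv riemannZeta₁ σ / riemannZeta₁ σ‖ <= K := by
  have hd := differentiable_riemannZeta₁
  have hc : Continuous riemannZeta₁ := hd.continuous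
  have hc' : Continuous (deriv riemannZeta₁) := (hd.contDiff (n := 1)).continuous_deriv le_rfl
  have h1 : ContinuousOn (fun σ : Real => riemannZeta₁ σ) (Set.Icc 1 2) := by fun_prop
  have h2 : ContinuousOn (fun σ : Real => deriv riemannZeta₁ σ / riemannZeta₁ σ) (Set.Icc 1 2) := by
    refine ContinuousOn.div (by fun_prop) h1 fun x hx => z1_ne (by simpa using hx.1)
  obtain ⟨A, hA⟩ := isCompact_Icc.exists_bound_of_continuousOn h1
  obtain ⟨B, hB⟩ := isCompact_Icc.exists_bound_of_continuousOn h2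
  exact ⟨max 1 (max A B), by positivity, fun σ h1 h2 => ⟨(hA σ ⟨h1, h2⟩).trans (by simp), (hB σ ⟨h1, h2⟩).trans (by simp)⟩⟩

lemma zeta_re_bd : ∃ K : Real, 0 < K ∧ ∀ σ : Real, 1 < σ → σ <= 2 → ∑' n : Nat, (n:Real) ^ (-σ) <= K / (σ - 1) := by
  obtain ⟨K, hK, h⟩ := z1_cpt
  refine ⟨K, hK, fun σ h1 h2 => ?_⟩
  have h3 := (h σ h1.le h2).1
  have hne : (σ:Complex) ≠ 1 := by exact_mod_cast h1.ne'
  rw [z1_eq hne, norm_mul, zeta_eq_tsum_one_div_nat_cpow (by simpa)] at h3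
  have h4 : ∑' n : Nat, 1 / (n:Complex) ^ (σ:Complex) = ((∑' n : Nat, n ^ (-σ) : Real) : Complex) := by
    rw [Complex.ofReal_tsum]
    refine tsum_congr fun n => ?_
    rw [rpow_neg (by positivity), Complex.ofReal_inv, Complex.ofReal_cpow (by positivity), one_div]
    simp
  rw [h4, norm_real, norm_of_nonneg (tsum_nonneg fun n => by positivity), <- Complex.ofReal_one, <- Complex.ofReal_sub,
    norm_real, norm_of_nonneg (by linarith)] at h3
  rw [le_div_iff₀ (by linarith)]
  linarith

lemma zeta_lower : ∃ K : Real, 0 < K ∧ ∀ s : Complex, 1 < s.re → s.re <= 2 → s.re - 1 <= K * ‖riemannZeta s‖ := by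
  obtain ⟨K, hK, h⟩ := zeta_re_bd
  refine ⟨K, hK, fun s hs h2 => ?_⟩
  have h1 := LSeries_one_mul_Lseries_moebius hs
  rw [LSeries_one_eq_riemannZeta hs] at h1
  have h3 : ‖LSeries (fun n => ((ArithmeticFunction.moebius n : Int) : Complex)) s‖ <= ∑' n : Nat, (n:Real) ^ (-s.re) := by
    refine tsum_of_norm_bounded (summable_nat_rpow.2 (by linarith)).hasSum fun n => ?_
    rcases eq_or_ne n 0 with rfl | hn
    · simp [rpow_nonneg]
    rw [LSeries.norm_term_eq, if_neg hn, rpow_neg (by positivity), div_eq_mul_inv]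
    refine mul_le_of_le_one_left (by positivity) ?_
    exact_mod_cast ArithmeticFunction.abs_moebius_le_one
  have h4 := congrArg norm h1
  rw [norm_mul, norm_one] at h4
  have h5 := h3.trans (h s.re hs h2)
  rw [le_div_iff₀ (by linarith)] at h5
  calc s.re - 1 = (‖riemannZeta s‖ * ‖LSeries (fun n => ((ArithmeticFunction.moebius n : Int) : Complex)) s‖) * (s.re - 1) := by rw [h4]; ring
    _ = ‖riemannZeta s‖ * (‖LSeries (fun n => ((ArithmeticFunction.moebius n : Int) : Complex)) s‖ * (s.re - 1)) := by ring
    _ <= ‖riemannZeta s‖ * K := by gcongr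
    _ = _ := by ring

lemma logder_series {s : Complex} (hs : 1 < s.re) :
    HasSum (fun n : Nat => (ArithmeticFunction.vonMangoldt n : Complex) * (n:Complex) ^ (-s)) (-(deriv riemannZeta s / riemannZeta s)) := by
  have h := (ArithmeticFunction.LSeriesSummable_vonMangoldt hs).LSeriesHasSum
  rw [ArithmeticFunction.LSeries_vonMangoldt_eq_deriv_riemannZeta_div hs, neg_div] at h
  refine h.congr_fun fun n => ?_
  rcases eq_or_ne n 0 with rfl | hn
  · simp
  · rw [LSeries.term_of_ne_zero hn, cpow_neg, div_eq_mul_inv]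

lemma three_four_one {σ t : Real} (hσ : 1 < σ) :
    0 <= 3 * -(deriv riemannZeta σ / riemannZeta σ).re + 4 * -(deriv riemannZeta (σ + t * I) / riemannZeta (σ + t * I)).re
      + -(deriv riemannZeta (σ + (2 * t : Real) * I) / riemannZeta (σ + (2 * t : Real) * I)).re := by
  have h1 := (logder_series (s := σ) (by simpa)).mapL reCLM
  have h2 := (logder_series (s := σ + t * I) (by simpa)).mapL reCLM
  have h3 := (logder_series (s := σ + (2 * t : Real) * I) (by simpa)).mapL reCLM
  have h4 := ((h1.mul_left 3).add (h2.mul_left 4)).add h3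
  simp only [Complex.reCLM_apply, neg_re] at h4
  refine h4.nonneg (fun n => ?_)
  rcases eq_or_ne n 0 with rfl | hn
  · simp
  have key : ∀ u : Real, ((ArithmeticFunction.vonMangoldt n : Complex) * n ^ (-(σ + u * I : Complex))).re =
      ArithmeticFunction.vonMangoldt n * (exp (-(σ * log n)) * cos (u * log n)) := by
    intro u
    rw [Complex.re_ofReal_mul, Complex.cpow_def_of_ne_zero (by exact_mod_cast hn), <- Complex.natCast_log, Complex.exp_re]
    congr 2
    · rw [re_ofReal_mul]; simp; ring
    · rw [<- cos_neg]; congr 1; rw [Complex.im_ofReal_mul]; simp; ring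
  have k0 := key 0
  have k1 := key t
  have k2 := key (2 * t)
  rw [Complex.ofReal_zero, zero_mul, add_zero, zero_mul, cos_zero] at k0
  rw [k0, k1, k2, mul_assoc 2 t, cos_two_mul]
  have : 0 <= ArithmeticFunction.vonMangoldt n * exp (-(σ * log n)) * (2 * (1 + cos (t * log n)) ^ 2) := by positivity
  linarith

lemma logder_real : ∃ C : Real, 0 < C ∧ ∀ σ : Real, 1 < σ → σ <= 2 → -(deriv riemannZeta σ / riemannZeta σ).re <= 1 / (σ - 1) + C := by
  obtain ⟨K, hK, h⟩ := z1_cpt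
  refine ⟨K, hK, fun σ h1 h2 => ?_⟩
  have hne : (σ:Complex) ≠ 1 := by exact_mod_cast h1.ne'
  rw [logder_z1 hne (riemannZeta_ne_zero_of_one_le_re (by simpa using h1.le)), Complex.sub_re]
  have h3 : (1 / ((σ:Complex) - 1)).re = 1 / (σ - 1) := by
    rw [<- Complex.ofReal_one, <- Complex.ofReal_sub, <- Complex.ofReal_div, Complex.ofReal_re]
  linarith [neg_le_abs (deriv riemannZeta₁ σ / riemannZeta₁ σ).re, Complex.abs_re_le_norm (deriv riemannZeta₁ σ / riemannZeta₁ σ), (h σ h1.le h2).2]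

noncomputable def ww (T:Real) : Real := qq T ^ 2 / log T

lemma ww_pow {T : Real} (hT : 1 < T) : ww T ^ 3 = 1 / (T ^ 2 * log T) := by
  rw [ww, div_pow, <- pow_mul, mul_comm 2 3, pow_mul, qq_pow hT]
  field_simp

lemma ww_pos {T : Real} (hT : 1 < T) : 0 < ww T := div_pos (pow_pos (qq_pos hT) _) (log_pos hT)

lemma le_of_cube {a b : Real} (hb : 0 <= b) (h : a ^ 3 <= b ^ 3) : a <= b := by
  by_contra hc; push Not at hc
  linarith [pow_lt_pow_left₀ hc hb (n := 3) (by norm_num)]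

lemma ww_anti {S T : Real} (hS : 1 < S) (h : S <= T) : ww T <= ww S := by
  refine le_of_cube (ww_pos hS).le ?_
  rw [ww_pow hS, ww_pow (hS.trans_le h)]
  have h2 : 0 < log S := log_pos hS
  gcongr

lemma ww_ev (B:Real) : ∃ T0 : Real, 100 <= T0 ∧ ∀ T, T0 <= T → B <= T * ww T := by
  refine ⟨max 100 (4 * (B ^ 3) ^ 2), le_max_left _ _, fun T hT => ?_⟩
  have h1 : 100 <= T := (le_max_left _ _).trans hT
  have h2 : 4 * (B ^ 3) ^ 2 <= T := (le_max_right _ _).trans hT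
  have h3 : 0 < log T := log_pos (by linarith)
  refine le_of_cube (mul_nonneg (by linarith) (ww_pos (by linarith)).le) ?_
  rw [mul_pow, ww_pow (by linarith)]
  have h4 : log T <= 2 * √T := by
    have := log_le_self (sqrt_nonneg T)
    rw [log_sqrt (by linarith)] at this; linarith
  have h5 : √T * √T = T := mul_self_sqrt (by linarith)
  have h6 : B ^ 3 * 2 <= √T := le_sqrt_of_sq_le (by nlinarith)
  rw [show T ^ 3 * (1 / (T ^ 2 * log T)) = T / log T by field_simp, le_div_iff₀ h3]
  rcases le_or_gt (B ^ 3) 0 with h | h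
  · nlinarith
  calc B ^ 3 * log T <= B ^ 3 * (2 * √T) := by gcongr
    _ = B ^ 3 * 2 * √T := by ring
    _ <= √T * √T := by gcongr
    _ = T := h5

lemma ww_le_one {T : Real} (hT : exp 1 <= T) : ww T <= 1 := by
  have h0 : 2 < T := by linarith [exp_one_gt_d9]
  refine le_of_cube zero_le_one ?_
  have h1 : 1 <= log T := (le_log_iff_exp_le (by linarith)).2 hT
  rw [ww_pow (by linarith), one_pow, div_le_one (by positivity)]
  nlinarith

lemma zfr_local : ∃ T0 K : Real, 10000 <= T0 ∧ 0 < K ∧ ∀ T σ u : Real, T0 <= T → 1 < σ → K <= (σ - 1) * T → σ <= 3 / 2 →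
    exp (T / 2) + 1 <= u → u <= exp (2 * T) - 1 →
    -(deriv riemannZeta (σ + u * I) / riemannZeta (σ + u * I)).re <= 72e9 / ww T ∧
    ∀ β : Real, riemannZeta (β + u * I) = 0 → σ - β <= 1e-9 * qq T ^ 2 →
      -(deriv riemannZeta (σ + u * I) / riemannZeta (σ + u * I)).re <= 72e9 / ww T - 1 / (σ - β) := by
  obtain ⟨T0, hT0, hreg⟩ := zeta_region
  obtain ⟨K, hK, hlow⟩ := zeta_lower
  refine ⟨T0, K, hT0, hK, fun T σ u hT hσ hKT hσ2 hu1 hu2 => ?_⟩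
  have hT1 : 1 < T := by linarith
  have hq := qq_pos hT1
  have hq1 : qq T <= 1 := by
    refine le_of_cube zero_le_one ?_
    rw [qq_pow hT1, one_pow, div_le_one (by linarith)]
    exact (log_le_self (by linarith))
  have hl : 2 <= log T := by
    rw [le_log_iff_exp_le (by linarith)]
    calc exp 2 = exp 1 * exp 1 := by rw [<- exp_add]; norm_num
      _ <= 3 * 3 := by gcongr <;> linarith [exp_one_lt_d9]
      _ <= T := by linarith
  set R := 1e-8 * qq T ^ 2 with hR
  have hR0 : 0 < R := by positivity
  have hR1 : R <= 1e-8 := by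
    have : qq T ^ 2 <= 1 := pow_le_one₀ hq.le hq1
    linarith
  set c : Complex := σ + u * I with hc
  have hcre : c.re = σ := by simp [hc]
  have hcim : c.im = u := by simp [hc]
  have hu0 : 1 < u := by linarith [exp_pos (T / 2)]
  set f : Complex → Complex := fun z => riemannZeta (c + z) with hf
  have hfd : DifferentiableOn Complex f (Metric.ball 0 (2 * R)) := by
    intro z hz
    have hz' : ‖z‖ < 2 * R := by simpa using hz
    have hne : c + z ≠ 1 := by
      intro h
      have := congrArg Complex.im h
      rw [add_im, hcim, one_im] at this
      have := (abs_le.1 (Complex.abs_im_le_norm z)).1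
      linarith
    exact ((differentiableAt_riemannZeta hne).comp z (by fun_prop)).differentiableWithinAt
  have hf0 : f 0 = riemannZeta c := by simp [hf]
  have hf0' : f 0 ≠ 0 := by rw [hf0]; exact riemannZeta_ne_zero_of_one_le_re (by rw [hcre]; exact hσ.le)
  have hder : deriv f 0 = deriv riemannZeta c := by
    rw [hf, deriv_comp_const_add, add_zero]
  have hz : ∀ z ∈ Metric.ball 0 R, f z = 0 → z.re <= 0 := by
    intro z _ h
    by_contra hc'
    push Not at hc'
    exact riemannZeta_ne_zero_of_one_le_re (by rw [add_re, hcre]; linarith) h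
  set n := ⌈8 * log T⌉₊ with hn
  have hn1 : 8 * log T <= n := Nat.le_ceil _
  have hn2 : (n:Real) + 1 <= 10 * log T := by linarith [Nat.ceil_lt_add_one (show 0 <= 8 * log T by linarith)]
  have hb : ∀ z ∈ Metric.sphere 0 R, ‖f z‖ <= 2 ^ n * ‖f 0‖ := by
    intro z hz
    have hz' : ‖z‖ = R := by simpa using hz
    have h1 := abs_le.1 (abs_im_le_norm z)
    have h2 := abs_le.1 (abs_re_le_norm z)
    rw [hz'] at h1 h2
    have h3 : ‖f z‖ <= T ^ 4 := by
      refine hreg T _ hT ?_ ?_ ?_ ?_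
      · rw [add_re, hcre]; linarith
      · rw [add_re, hcre]; linarith
      · rw [add_im, hcim]; linarith
      · rw [add_im, hcim]; linarith
    refine h3.trans ?_
    have h4 := hlow c (by rw [hcre]; exact hσ) (by rw [hcre]; linarith)
    rw [hcre] at h4
    rw [hf0]
    have h5 : 1 <= ‖riemannZeta c‖ * T := by
      have : K * 1 <= K * (‖riemannZeta c‖ * T) := by
        rw [mul_one]; calc K <= (σ - 1) * T := hKT
          _ <= K * ‖riemannZeta c‖ * T := by gcongr
          _ = _ := by ring
      exact le_of_mul_le_mul_left this hK
    have h6 : T ^ 5 <= 2 ^ n := by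
      rw [<- log_le_log_iff (by positivity) (by positivity), log_pow, log_pow]
      push_cast
      calc 5 * log T <= (8 * log T) * 0.69 := by linarith
        _ <= n * log 2 := by gcongr; linarith [log_two_gt_d9]
    calc T ^ 4 = T ^ 4 * 1 := by ring
      _ <= T ^ 4 * (‖riemannZeta c‖ * T) := by gcongr
      _ = T ^ 5 * ‖riemannZeta c‖ := by ring
      _ <= _ := by gcongr
  have hbd : 72 * (n + 1) / R <= 72e9 / ww T := by
    calc 72 * (n + 1) / R <= 72 * (10 * log T) / R := by gcongr
      _ = _ := by rw [hR, ww]; field_simp; norm_num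
  refine ⟨?_, fun β hβ hβR => ?_⟩
  · rw [<- hder, <- hf0]
    exact (landau hR0 n f hfd hf0' hz hb).trans hbd
  · rw [<- hder, <- hf0]
    have hβ1 : β < 1 := by
      by_contra h
      push Not at h
      exact riemannZeta_ne_zero_of_one_le_re (by simpa) hβ
    have := landau_zero hR0 n f hfd hf0' hz hb (ρ := ((β - σ : Real) : Complex)) (by
      rw [hf]; simp only
      rw [<- hβ]; congr 1; rw [hc]; push_cast; ring) (by
      rw [Complex.norm_real, norm_eq_abs, abs_of_neg (by linarith)]; linarith)
    refine this.trans ?_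
    rw [<- Complex.ofReal_one, <- Complex.ofReal_div, Complex.ofReal_re]
    have h7 : 1 / (β - σ) = -(1 / (σ - β)) := by rw [<- neg_sub σ β, one_div, inv_neg, one_div]
    linarith

lemma zfr : ∃ T0 a : Real, 10000 <= T0 ∧ 0 < a ∧ a <= 1 ∧ ∀ T : Real, ∀ s : Complex, T0 <= T → exp (T / 2) + 1 <= s.im → s.im <= exp T + 1 →
    1 - a * ww T <= s.re → riemannZeta s ≠ 0 := by
  obtain ⟨T0, K, hT0, hK, h⟩ := zfr_local
  obtain ⟨C, hC, hr⟩ := logder_real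
  set a := 0.1 / (72e9 + C) with ha
  have ha0 : 0 < a := by positivity
  have ha1 : a <= 1.4e-12 := by
    rw [ha, div_le_iff₀ (by positivity)]; linarith
  obtain ⟨T1, hT1, hev⟩ := ww_ev (K / a)
  refine ⟨max T0 T1, a / 10, hT0.trans (le_max_left _ _), by positivity, by linarith, fun T s hT h1 h2 h3 h0 => ?_⟩
  have hTa : T0 <= T := (le_max_left _ _).trans hT
  have hTb := hev T ((le_max_right _ _).trans hT)
  rw [div_le_iff₀ ha0] at hTb
  have hT2 : 1 < T := by linarith
  have he : exp 1 <= T := by linarith [exp_one_lt_d9]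
  have hl : 1 <= log T := (le_log_iff_exp_le (by linarith)).2 he
  set w := ww T with hw
  have hw0 : 0 < w := ww_pos hT2
  have hw1 : w <= 1 := ww_le_one he
  have hwq : w <= qq T ^ 2 := div_le_self (sq_nonneg _) hl
  have hw' : a * w <= 1.4e-12 * w := by gcongr
  set β := s.re
  have hβ1 : β < 1 := by
    by_contra hc
    push Not at hc
    exact riemannZeta_ne_zero_of_one_le_re hc h0
  set γ := s.im
  have hs : β + γ * I = s := Complex.re_add_im s
  have hexp : 2 * exp T + 3 <= exp (2 * T) := by
    have := add_one_le_exp T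
    rw [two_mul T, exp_add]; nlinarith
  have hpos := exp_pos (T / 2)
  have A1 := hr (1 + a * w) (by linarith) (by linarith)
  have A2 := (h T (1 + a * w) γ hTa (by linarith) (by linarith) (by linarith) h1 (by linarith)).2 β
    (by rw [hs]; exact h0) (by linarith)
  have A3 := (h T (1 + a * w) (2 * γ) hTa (by linarith) (by linarith) (by linarith) (by linarith) (by linarith)).1
  have A4 := three_four_one (σ := 1 + a * w) (t := γ) (by linarith)
  have h5 : 1 / (1.1 * (a * w)) <= 1 / (1 + a * w - β) := by
    apply one_div_le_one_div_of_le <;> linarith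
  have h6 : 1 / (1.1 * (a * w)) = 1 / 1.1 * (1 / (a * w)) := by rw [one_div_mul_one_div]
  have h7 : 10 * (72e9 + C) / w = 1 / (a * w) := by rw [ha]; field_simp; norm_num
  have h8 : 10 * (72e9 + C) / w = 10 * (72e9 / w) + 10 * (C / w) := by ring
  have h9 : C <= C / w := by rw [le_div_iff₀ hw0]; nlinarith
  have h10 : 0 < 72e9 / w := by positivity
  rw [show 1 + a * w - 1 = a * w by ring] at A1
  rw [<- hw] at A2 A3
  generalize 72e9 / w = X at *
  generalize C / w = Y at *
  generalize 1 / (a * w) = Z at *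
  rw [h6] at h5
  linarith

noncomputable def GG (s:Complex) : Complex := -(deriv riemannZeta₁ s / riemannZeta₁ s) - dslope riemannZeta₁ 1 s

lemma GG_eq {s : Complex} (hs : s ≠ 1) (h0 : riemannZeta s ≠ 0) : GG s = -(deriv riemannZeta s / riemannZeta s) - riemannZeta s := by
  rw [GG, logder_z1 hs h0, dslope_of_ne _ hs, slope_def_field, riemannZeta₁_one, z1_eq hs]
  field_simp; ring

lemma GG_diff {s : Complex} (h : riemannZeta₁ s ≠ 0) : DifferentiableAt Complex GG s := by
  have hd := differentiable_riemannZeta₁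
  have h1 : Differentiable Complex (deriv riemannZeta₁) := (hd.contDiff (n := 2)).differentiable_deriv_two
  have h2 : Differentiable Complex (dslope riemannZeta₁ 1) :=
    differentiableOn_univ.1 ((Complex.differentiableOn_dslope Filter.univ_mem).2 hd.differentiableOn)
  exact ((h1 s).div (hd s) h).neg.sub (h2 s)

lemma logder_le : ∃ C : Real, 0 < C ∧ ∀ s : Complex, 1 < s.re → s.re <= 2 → ‖deriv riemannZeta s / riemannZeta s‖ <= 1 / (s.re - 1) + C := by
  obtain ⟨C, hC, h⟩ := logder_real
  refine ⟨C, hC, fun s h1 h2 => ?_⟩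
  refine le_trans ?_ (h s.re h1 h2)
  have hs := logder_series h1
  have hr := (logder_series (s := s.re) (by simpa)).mapL reCLM
  rw [<- norm_neg, <- hs.tsum_eq]
  simp only [Complex.reCLM_apply, neg_re] at hr
  refine tsum_of_norm_bounded hr fun n => ?_
  rcases eq_or_ne n 0 with rfl | hn
  · simp
  rw [norm_mul, Complex.norm_natCast_cpow_of_pos (by omega), Complex.norm_real, norm_of_nonneg ArithmeticFunction.vonMangoldt_nonneg,
    Complex.re_ofReal_mul, <- Complex.ofReal_natCast, <- Complex.ofReal_neg, <- Complex.ofReal_cpow (by positivity), Complex.ofReal_re, Complex.neg_re]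

lemma exp2 {T : Real} (hT : 10 <= T) : exp T + 1 <= exp (2 * T) := by
  have := add_one_le_exp T
  rw [two_mul T, exp_add]; nlinarith

lemma poly18 {T : Real} (hT : 10 <= T) : 36 * T ^ 2 + T ^ 4 <= T ^ 5 := by
  have : 36 + T ^ 2 <= T ^ 3 := by nlinarith
  nlinarith

lemma ld_bd : ∃ T0 b : Real, 10000 <= T0 ∧ 0 < b ∧ ∀ T : Real, ∀ s : Complex, T0 <= T → exp (T / 2) + 2 <= s.im → s.im <= exp T →
    1 - b * ww T <= s.re → s.re <= 2 → riemannZeta s ≠ 0 ∧ ‖GG s‖ <= T ^ 5 := by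
  obtain ⟨T0, hT0, hreg⟩ := zeta_region
  obtain ⟨K, hK, hlow⟩ := zeta_lower
  obtain ⟨C, hC, hld⟩ := logder_le
  obtain ⟨T1, a', hT1, ha', ha1', hz⟩ := zfr
  set a := min a' 1e-9 with ha_def
  have ha1 : a <= 1e-9 := min_le_right _ _
  have haa : a <= a' := min_le_left _ _
  set b := a / 4 with hb
  have hb0 : 0 < b := by positivity
  obtain ⟨T2, hT2, hev⟩ := ww_ev ((K + C + 1000) / b)
  refine ⟨max (max T0 T1) (max T2 (C + 10000)), b, by linarith [le_max_left T0 T1, le_max_left (max T0 T1) (max T2 (C + 10000))], hb0, fun T s hT h1 h2 h3 h4 => ?_⟩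
  have hTa : T0 <= T := (le_max_left _ _).trans ((le_max_left _ _).trans hT)
  have hTb : T1 <= T := (le_max_right _ _).trans ((le_max_left _ _).trans hT)
  have hTc := hev T ((le_max_left _ _).trans ((le_max_right _ _).trans hT))
  have hTd : C + 10000 <= T := (le_max_right _ _).trans ((le_max_right _ _).trans hT)
  rw [div_le_iff₀ hb0] at hTc
  have hT3 : 1 < T := by linarith
  have he : exp 1 <= T := by linarith [exp_one_lt_d9]
  have hl : 1 <= log T := (le_log_iff_exp_le (by linarith)).2 he
  set w := ww T with hw
  have hw0 : 0 < w := ww_pos hT3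
  have hw1 : w <= 1 := ww_le_one he
  have hwq : w <= qq T ^ 2 := div_le_self (sq_nonneg _) hl
  set r := b * w with hr
  have hr0 : 0 < r := by positivity
  have haw : a * w = 4 * r := by rw [hr, hb]; ring
  have haw' : a * w <= a' * w := by gcongr
  have haw2 : a * w <= 1e-9 * w := by gcongr
  have hpe : 0 < exp (T / 2) := exp_pos _
  have hne : s ≠ 1 := by
    rintro rfl; simp at h1; linarith
  have hs0 : riemannZeta s ≠ 0 := hz T s hTb (by linarith) (by linarith) (by linarith)
  refine ⟨hs0, ?_⟩
  have hzeta : ‖riemannZeta s‖ <= T ^ 4 := by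
    refine hreg T s hTa (by linarith) h4 (by linarith) (h2.trans (exp_le_exp.2 (by linarith)))
  have hinv : 1 / r <= T := by rw [div_le_iff₀ hr0]; linarith
  have hmain : ‖deriv riemannZeta s / riemannZeta s‖ <= 36 * T ^ 2 := by
    rcases le_or_gt (1 + r) s.re with hc | hc
    · refine (hld s (by linarith) h4).trans ?_
      have : 1 / (s.re - 1) <= 1 / r := one_div_le_one_div_of_le hr0 (by linarith)
      have h7 : T * 1 <= T * T := by gcongr
      rw [sq]; linarith
    · set c : Complex := (1 + r : Real) + s.im * I with hcdef
      have hcre : c.re = 1 + r := by simp [hcdef]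
      have hcim : c.im = s.im := by simp [hcdef]
      set f : Complex → Complex := fun z => riemannZeta (c + z) with hf
      have hloc : ∀ z ∈ Metric.ball (0:Complex) (4 * r), 1 - 3 * r <= (c + z).re ∧ (c + z).re <= 2 ∧ exp (T / 2) + 1 <= (c + z).im ∧ (c + z).im <= exp T + 1 := by
        intro z hz
        have hz' : ‖z‖ < 4 * r := by simpa using hz
        have h5 := abs_le.1 (Complex.abs_im_le_norm z)
        have h6 := abs_le.1 (Complex.abs_re_le_norm z)
        rw [Complex.add_re, Complex.add_im, hcre, hcim]
        refine ⟨by linarith, by linarith, by linarith, by linarith⟩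
      have hfd : DifferentiableOn Complex f (Metric.ball 0 (4 * r)) := by
        intro z hz
        have hne : c + z ≠ 1 := by
          intro h
          have h5 := (hloc z hz).2.2.1
          rw [h, Complex.one_im] at h5
          linarith
        exact ((differentiableAt_riemannZeta hne).comp z (by fun_prop)).differentiableWithinAt
      have hf0 : f 0 = riemannZeta c := by simp [hf]
      have hder : deriv f (s - c) = deriv riemannZeta s := by
        rw [hf, deriv_comp_const_add, add_sub_cancel]
      have hfs : f (s - c) = riemannZeta s := by simp [hf]
      have hsc : ‖s - c‖ <= 4 * r / 2 := by
        have : s - c = ((s.re - (1 + r) : Real) : Complex) := by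
          apply Complex.ext <;> simp [hcre, hcim]
        rw [this, Complex.norm_real, norm_eq_abs, abs_le]
        constructor <;> linarith
      have := logder_bd (f := f) (r := 4 * r) (M := 6 * log T) (by positivity) (by positivity) hfd
        (fun z hz' => hz T _ hTb (hloc z hz').2.2.1 (hloc z hz').2.2.2 (by linarith [(hloc z hz').1])) (fun z hz' => by
          obtain ⟨g1, g2, g3, g4⟩ := hloc z hz'
          have hexp := exp2 (show 10 <= T by linarith)
          refine (hreg T _ hTa (by linarith) g2 (by linarith) (by linarith)).trans ?_
          rw [hf0]
          have h4 := hlow c (by rw [hcre]; linarith) (by rw [hcre]; linarith)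
          rw [hcre] at h4
          have h5 : 1 <= ‖riemannZeta c‖ * T := by
            have : K * 1 <= K * (‖riemannZeta c‖ * T) := by
              rw [mul_one]; calc K <= r * T := by linarith
                _ <= K * ‖riemannZeta c‖ * T := by gcongr; linarith
                _ = _ := by ring
            exact le_of_mul_le_mul_left this hK
          have h6 : exp (6 * log T) = T ^ 6 := by
            rw [mul_comm, exp_mul, exp_log (by linarith)]; norm_cast
          rw [h6]
          calc T ^ 4 = T ^ 4 * 1 := by ring
            _ <= T ^ 4 * (‖riemannZeta c‖ * T) := by gcongr
            _ = T ^ 5 * ‖riemannZeta c‖ := by ring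
            _ <= _ := by gcongr <;> linarith) hsc
      rw [hder, hfs] at this
      refine this.trans ?_
      calc 24 * (6 * log T) / (4 * r) = 36 * log T * (1 / r) := by field_simp; norm_num
        _ <= 36 * T * T := by gcongr; exact log_le_self (by linarith)
        _ = _ := by ring
  rw [GG_eq hne hs0]
  calc _ <= 36 * T ^ 2 + T ^ 4 := by
        refine (norm_sub_le _ _).trans ?_
        rw [norm_neg]; linarith
    _ <= _ := poly18 (by linarith)

open ComplexConjugate in
lemma GG_conj {s : Complex} (hs : s ≠ 1) (h0 : riemannZeta s ≠ 0) : ‖GG (conj s)‖ = ‖GG s‖ ∧ riemannZeta (conj s) ≠ 0 := by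
  have h1 : conj s ≠ 1 := fun h => hs (by rw [<- Complex.conj_conj s, h, map_one])
  have h2 : riemannZeta (conj s) ≠ 0 := by rw [riemannZeta_conj]; simpa using h0
  refine ⟨?_, h2⟩
  have h3 : deriv riemannZeta (conj s) = conj (deriv riemannZeta s) := by
    have h4 : (conj ∘ riemannZeta ∘ conj : Complex → Complex) = riemannZeta := by
      ext z; simp [riemannZeta_conj]
    have := congrFun (deriv_conj_conj (f := riemannZeta)) (conj s)
    rw [h4] at this
    simpa using this
  rw [GG_eq h1 h2, GG_eq hs h0, h3, riemannZeta_conj, <- map_div₀, <- map_neg, <- map_sub, Complex.norm_conj]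

lemma low_bd (H:Real) : ∃ δ C : Real, 0 < δ ∧ 0 < C ∧ ∀ s : Complex, |s.im| <= H → 1 - δ <= s.re → s.re <= 2 → riemannZeta₁ s ≠ 0 ∧ ‖GG s‖ <= C := by
  have hd := differentiable_riemannZeta₁
  have hK : IsCompact (Set.Icc (1:Real) 2 ×ℂ Set.Icc (-H) H) := isCompact_Icc.reProdIm isCompact_Icc
  have hU : IsOpen {s : Complex | riemannZeta₁ s ≠ 0} := isOpen_ne.preimage hd.continuous
  obtain ⟨δ, hδ, hsub⟩ := hK.exists_cthickening_subset_open hU (fun s hs => z1_ne (by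
    rw [Complex.mem_reProdIm] at hs; exact hs.1.1))
  have hK2 : IsCompact (Set.Icc (1 - δ) 2 ×ℂ Set.Icc (-H) H) := isCompact_Icc.reProdIm isCompact_Icc
  have hne : ∀ s ∈ (Set.Icc (1 - δ) 2 ×ℂ Set.Icc (-H) H), riemannZeta₁ s ≠ 0 := by
    intro s hs
    rw [Complex.mem_reProdIm] at hs
    by_cases h : 1 <= s.re
    · exact z1_ne h
    push Not at h
    apply hsub
    apply Metric.mem_cthickening_of_dist_le s (⟨1, s.im⟩ : Complex) δ
    · rw [Complex.mem_reProdIm]; exact ⟨by simp, hs.2⟩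
    · have : s - ⟨1, s.im⟩ = ((s.re - 1 : Real) : Complex) := by apply Complex.ext <;> simp
      rw [dist_eq_norm, this, Complex.norm_real, norm_eq_abs, abs_le]
      constructor <;> linarith [hs.1.1]
  obtain ⟨C, hC⟩ := hK2.exists_bound_of_continuousOn (f := GG) fun s hs => (GG_diff (hne s hs)).continuousAt.continuousWithinAt
  refine ⟨δ, max C 1, hδ, by positivity, fun s h1 h2 h3 => ?_⟩
  have hs : s ∈ (Set.Icc (1 - δ) 2 ×ℂ Set.Icc (-H) H) := by
    rw [Complex.mem_reProdIm]; exact ⟨⟨h2, h3⟩, abs_le.1 h1⟩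
  exact ⟨hne s hs, (hC s hs).trans (le_max_left _ _)⟩

lemma G_bd : ∃ b C T1 : Real, 0 < b ∧ b <= 1 / 4 ∧ 0 < C ∧ 10000 <= T1 ∧ ∀ T : Real, ∀ s : Complex, T1 <= T → |s.im| <= exp T →
    1 - b * ww T <= s.re → s.re <= 2 → riemannZeta₁ s ≠ 0 ∧ ‖GG s‖ <= C * T ^ 5 := by
  obtain ⟨T0, b, hT0, hb, h⟩ := ld_bd
  obtain ⟨δ, C, hδ, hC, hlow⟩ := low_bd (exp T0)
  have hm : 0 < min (min b δ) (1 / 4) := by positivity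
  refine ⟨min (min b δ) (1 / 4), C + 1, T0, hm, min_le_right _ _, by positivity, hT0, fun T s hT h1 h2 h3 => ?_⟩
  have hT1 : 1 <= T ^ 5 := one_le_pow₀ (by linarith)
  have hb1 : min (min b δ) (1 / 4) <= b := (min_le_left _ _).trans (min_le_left _ _)
  have hb2 : min (min b δ) (1 / 4) <= δ := (min_le_left _ _).trans (min_le_right _ _)
  have hw : 0 < ww T := ww_pos (by linarith)
  have hw1 : ww T <= 1 := ww_le_one (by linarith [exp_one_lt_d9])
  rcases le_or_gt |s.im| (exp T0) with hc | hc
  · have hle : min (min b δ) (1 / 4) * ww T <= δ * 1 := mul_le_mul hb2 hw1 hw.le hδ.le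
    obtain ⟨k1, k2⟩ := hlow s hc (by linarith) h3
    refine ⟨k1, k2.trans ?_⟩
    nlinarith
  have key : ∀ s : Complex, exp T0 < s.im → s.im <= exp T → 1 - min (min b δ) (1 / 4) * ww T <= s.re → s.re <= 2 →
      riemannZeta s ≠ 0 ∧ ‖GG s‖ <= (C + 1) * T ^ 5 := by
    intro s hc h1 h2 h3
    have him : 0 < s.im := (exp_pos _).trans hc
    have hT' : T0 <= log s.im := (le_log_iff_exp_le him).2 hc.le
    have hT'' : log s.im <= T := (log_le_iff_le_exp him).2 h1
    have hw2 : min (min b δ) (1 / 4) * ww T <= b * ww (log s.im) :=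
      mul_le_mul hb1 (ww_anti (by linarith) hT'') hw.le hb.le
    have h10 : 10 <= s.im := by linarith [add_one_le_exp T0]
    obtain ⟨k1, k2⟩ := h (log s.im) s hT' (by
      rw [exp_half, exp_log him]
      have : √s.im <= s.im - 2 := by
        rw [sqrt_le_left (by linarith)]; nlinarith
      linarith) (exp_log him).ge (by linarith) h3
    refine ⟨k1, k2.trans ?_⟩
    calc (log s.im) ^ 5 <= T ^ 5 := by gcongr; linarith
      _ <= _ := by nlinarith
  have hne : s ≠ 1 := by
    rintro rfl; simp at hc; linarith [exp_pos T0]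
  have h1' := abs_le.1 h1
  rcases le_or_gt 0 s.im with hp | hp
  · rw [abs_of_nonneg hp] at hc
    obtain ⟨k1, k2⟩ := key s hc h1'.2 h2 h3
    exact ⟨by rw [z1_eq hne]; exact mul_ne_zero (sub_ne_zero.2 hne) k1, k2⟩
  · rw [abs_of_neg hp] at hc
    obtain ⟨k1, k2⟩ := key (starRingEnd Complex s) (by simpa) (by simp; linarith) (by simpa using h2) (by simpa using h3)
    have hne' : starRingEnd Complex s ≠ 1 := fun h => hne (by rw [<- Complex.conj_conj s, h, map_one])
    have := GG_conj hne' k1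
    rw [Complex.conj_conj] at this
    refine ⟨by rw [z1_eq hne]; exact mul_ne_zero (sub_ne_zero.2 hne) this.2, ?_⟩
    rw [this.1]; exact k2

lemma K_bd {s : Complex} (h : 3/4 <= s.re) : ‖1/(s*(s+1))‖ <= 2*(1+s.im^2)⁻¹ := by
  have h1 : (1+s.im^2)/2 <= ‖s‖*‖s+1‖ := by
    have a : ‖s‖^2 = s.re^2+s.im^2 := by rw [sq_norm, Complex.normSq_apply]; ring
    have b : ‖s‖ <= ‖s+1‖ := by
      apply (sq_le_sq₀ (norm_nonneg _) (norm_nonneg _)).1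
      rw [a, Complex.sq_norm, Complex.normSq_apply]; simp; nlinarith
    nlinarith [norm_nonneg s, sq_nonneg s.im]
  rw [norm_div, norm_one, norm_mul]
  calc 1/(‖s‖*‖s+1‖) <= 1/((1+s.im^2)/2) := one_div_le_one_div_of_le (by positivity) h1
    _ = _ := by field_simp

lemma kern (σ:Real) (hσ : 1 <= σ) (x:Real) (hx : 0 < x) :
    ∫ y : Real, (x:Complex)^(-((σ:Complex)+y*I)) * (1/(((σ:Complex)+y*I)*((σ:Complex)+y*I+1)))
      = 2*π*(max (1-x) 0 : Real) := by
  set f : Real → Complex := fun t => (Set.Ioc 0 1).indicator (fun _ => 1 : Real → Complex) t -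
    (Set.Ioc 0 1).indicator (fun t => t^(1:Complex) : Real → Complex) t with hf
  have hm : ∀ s : Complex, 1 <= s.re → HasMellin f s (1/(s*(s+1))) := by
    intro s hs
    have h1 := hasMellin_one_Ioc (s := s) (by linarith)
    have h2 := hasMellin_cpow_Ioc 1 (s := s) (by simp; linarith)
    have h3 := hasMellin_sub h1.1 h2.1
    rw [h1.2, h2.2] at h3
    have e1 : s ≠ 0 := by intro h; rw [h] at hs; norm_num at hs
    have e2 : s+1 ≠ 0 := by
      intro h; have := congrArg Complex.re h; simp at this; linarith
    have e3 : 1/(s*(s+1)) = 1/s - 1/(s+1) := by field_simp; ring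
    rw [e3]; exact h3
  have hfx : ∀ t : Real, 0 < t → f t = ((max (1-t) 0 : Real) : Complex) := by
    intro t ht
    by_cases h : t <= 1
    · have : t ∈ Set.Ioc 0 1 := ⟨ht, h⟩
      simp only [hf, Set.indicator_of_mem this, Complex.cpow_one]
      rw [max_eq_left (by linarith)]; push_cast; ring
    · have : t ∉ Set.Ioc 0 1 := fun h' => h h'.2
      simp only [hf, Set.indicator_of_notMem this]
      rw [max_eq_right (by linarith)]; simp
  have hre : ∀ y : Real, (σ+y*I).re = σ := by intro y; simp
  have hme : ∀ y : Real, mellin f (σ+y*I) = 1/((σ+y*I)*(σ+y*I+1)) :=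
    fun y => (hm _ (by rw [hre]; exact hσ)).2
  have hcont : ContinuousAt f x := by
    have : f =ᶠ[nhds x] fun t => ((max (1-t) 0 : Real) : Complex) := by
      filter_upwards [lt_mem_nhds hx] with t ht using hfx t ht
    rw [continuousAt_congr this]; fun_prop
  have hv : Complex.VerticalIntegrable (mellin f) σ := by
    unfold Complex.VerticalIntegrable
    simp_rw [hme]
    apply MeasureTheory.Integrable.mono' (integrable_inv_one_add_sq.const_mul 2)
    · apply Continuous.aestronglyMeasurable
      apply Continuous.div (by fun_prop) (by fun_prop)
      intro y h
      rcases mul_eq_zero.1 h with h | h <;> have := congrArg Complex.re h <;> simp at this <;> linarith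
    · filter_upwards with y
      have := K_bd (s := (σ:Complex)+y*I) (by rw [hre]; linarith)
      simpa using this
  have := mellinInv_mellin_eq σ f hx (hm σ (by simpa using hσ)).1 hv hcont
  rw [hfx x hx, mellinInv] at this
  simp_rw [hme, smul_eq_mul] at this
  rw [<- this]
  rw [Complex.real_smul]; push_cast
  generalize (∫ y : Real, _ : Complex) = J
  field_simp

noncomputable def aa (n:Nat) : Real := ArithmeticFunction.vonMangoldt n - if n = 0 then 0 else 1

lemma GG_series {s : Complex} (hs : 1 < s.re) :
    HasSum (fun n : Nat => (aa n : Complex) * (n:Complex)^(-s)) (GG s) := by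
  have hs1 : s ≠ 1 := by intro h; rw [h] at hs; norm_num at hs
  rw [GG_eq hs1 (riemannZeta_ne_zero_of_one_le_re hs.le)]
  have hz : HasSum (fun n : Nat => 1/(n:Complex)^s) (riemannZeta s) := by
    rw [zeta_eq_tsum_one_div_nat_cpow hs]
    exact (Complex.summable_one_div_nat_cpow.2 hs).hasSum
  refine ((logder_series hs).sub hz).congr_fun fun n => ?_
  rcases eq_or_ne n 0 with rfl | hn
  · have : s ≠ 0 := by intro h; rw [h] at hs; norm_num at hs
    simp [aa, this]
  · simp only [aa, hn, if_false]
    push_cast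
    rw [cpow_neg]; ring

noncomputable def EE (X:Real) : Real := ∑ n ∈ Ioc 0 ⌊X⌋₊, (ArithmeticFunction.vonMangoldt n - 1) * (1 - n/X)

noncomputable def FF (X:Real) (s:Complex) : Complex := GG s * ((X:Complex)^s * (1/(s*(s+1))))

lemma perron {X σ : Real} (hX : 0 < X) (hσ : 1 < σ) :
    ∫ y : Real, FF X ((σ:Complex)+y*I) = 2*π*(EE X : Complex) := by
  have hre : ∀ y : Real, (σ+y*I).re = σ := by intro y; simp
  have hXc : (X:Complex) ≠ 0 := by exact_mod_cast hX.ne'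
  set k : Real → Complex := fun y => X^(σ+y*I) *
    (1/((σ+y*I)*(σ+y*I+1))) with hk
  set F : Nat → Real → Complex := fun n y => (aa n:Complex) * n^(-(σ+y*I)) * k y with hF
  have hne : ∀ y : Real, (σ+y*I)*(σ+y*I+1) ≠ 0 := by
    intro y h
    rcases mul_eq_zero.1 h with h | h <;> have := congrArg Complex.re h <;> simp at this <;> linarith
  have hkc : Continuous k := by
    refine Continuous.mul ?_ (Continuous.div (by fun_prop) (by fun_prop) hne)
    exact Continuous.const_cpow (by fun_prop) (Or.inl hXc)
  have hkb : ∀ y, ‖k y‖ <= X^σ * (2*(1+y^2)⁻¹) := by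
    intro y
    have := K_bd (s := (σ:Complex)+y*I) (by rw [hre]; linarith)
    rw [hk]; simp only
    rw [norm_mul, Complex.norm_cpow_eq_rpow_re_of_pos hX, hre]
    gcongr
    simpa using this
  have hki : MeasureTheory.Integrable k :=
    MeasureTheory.Integrable.mono' ((integrable_inv_one_add_sq.const_mul 2).const_mul _)
      hkc.aestronglyMeasurable (Filter.Eventually.of_forall hkb)
  have hn : ∀ n y, ‖F n y‖ = ‖(aa n : Complex) * n^(-(σ:Complex))‖ * ‖k y‖ := by
    intro n y
    rw [hF]; simp only
    rw [norm_mul]; congr 1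
    rcases eq_or_ne n 0 with rfl | h0
    · simp [aa]
    · rw [norm_mul, norm_mul, norm_natCast_cpow_of_pos (by omega),
        norm_natCast_cpow_of_pos (by omega)]
      simp
  have hFi : ∀ n, MeasureTheory.Integrable (F n) := by
    intro n
    rcases eq_or_ne n 0 with rfl | h0
    · have : F 0 = fun _ => 0 := by funext y; simp [hF, aa]
      rw [this]; exact MeasureTheory.integrable_zero _ _ _
    refine (hki.norm.const_mul ‖(aa n : Complex) * n^(-(σ:Complex))‖).mono' ?_
      (Filter.Eventually.of_forall fun y => (hn n y).le)
    apply Continuous.aestronglyMeasurable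
    refine Continuous.mul (Continuous.mul (by fun_prop) ?_) hkc
    exact Continuous.const_cpow (by fun_prop) (Or.inl (by exact_mod_cast h0))
  have hsum : Summable fun n => ∫ y, ‖F n y‖ := by
    simp_rw [hn, MeasureTheory.integral_const_mul]
    exact ((GG_series (s := σ) (by simpa)).summable.norm).mul_right _
  have h1 := MeasureTheory.hasSum_integral_of_summable_integral_norm hFi hsum
  have h2 : ∀ y, ∑' n, F n y = FF X (σ+y*I) := by
    intro y
    have := (GG_series (s := (σ:Complex)+y*I) (by rw [hre]; exact hσ)).mul_right (k y)
    rw [FF]; exact this.tsum_eq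
  simp_rw [h2] at h1
  have h3 : ∀ n, ∫ y, F n y = 2*π*((aa n * max (1-n/X) 0 : Real):Complex) := by
    intro n
    rcases eq_or_ne n 0 with rfl | h0
    · simp [hF, aa]
    have hn0 : (0:Real) < n := by positivity
    have := kern σ hσ.le (n/X) (by positivity)
    push_cast
    have e : ∀ y, F n y = (aa n : Complex) * (((n/X:Real):Complex)^(-(σ+y*I)) *
      (1/((σ+y*I)*(σ+y*I+1)))) := by
      intro y
      rw [hF]; simp only
      rw [hk]; simp only
      rw [div_eq_mul_inv (n:Real) X, Complex.ofReal_mul, Complex.mul_cpow_ofReal_nonneg hn0.le (by positivity),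
        Complex.ofReal_inv, cpow_neg X⁻¹, Complex.inv_cpow _ _ (by
          rw [Complex.arg_ofReal_of_nonneg hX.le]; exact pi_pos.ne), inv_inv]
      push_cast; ring
    simp_rw [e]
    rw [MeasureTheory.integral_const_mul, this]; push_cast; ring
  simp_rw [h3] at h1
  rw [<- h1.tsum_eq, tsum_mul_left]; congr 1
  rw [<- Complex.ofReal_tsum]; congr 1
  rw [EE, tsum_eq_sum (s := Ioc 0 ⌊X⌋₊)]
  · refine sum_congr rfl fun n hn => ?_
    rw [mem_Ioc] at hn
    have : (n:Real) <= X := (Nat.le_floor_iff hX.le).1 hn.2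
    have : n/X <= 1 := (div_le_one hX).2 this
    rw [max_eq_left (by linarith), aa, if_neg (by omega)]
  · intro n hn
    rcases eq_or_ne n 0 with rfl | h0
    · simp [aa]
    have : X < n := by
      rw [mem_Ioc] at hn
      exact (Nat.floor_lt hX.le).1 (by omega)
    have : 1 < n/X := (one_lt_div hX).2 this
    rw [max_eq_right (by linarith), mul_zero]

lemma GG_line : ∃ D : Real, 0 < D ∧ ∀ s : Complex, 1 < s.re → s.re <= 2 → ‖GG s‖ <= D / (s.re - 1) := by
  obtain ⟨C, hC, h⟩ := logder_le
  obtain ⟨K, hK, h'⟩ := zeta_re_bd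
  refine ⟨1 + C + K, by positivity, fun s h1 h2 => ?_⟩
  have hs1 : s ≠ 1 := by intro h; rw [h] at h1; norm_num at h1
  rw [GG_eq hs1 (riemannZeta_ne_zero_of_one_le_re h1.le)]
  have hz : ‖riemannZeta s‖ <= ∑' n : Nat, (n:Real) ^ (-s.re) := by
    rw [zeta_eq_tsum_one_div_nat_cpow h1]
    refine tsum_of_norm_bounded (summable_nat_rpow.2 (by linarith)).hasSum fun n => ?_
    rcases eq_or_ne n 0 with rfl | hn
    · have : s ≠ 0 := by intro h; rw [h] at h1; norm_num at h1
      simp [this]; positivity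
    · rw [norm_div, norm_one, Complex.norm_natCast_cpow_of_pos (by omega), rpow_neg (by positivity), one_div]
  have hp : 0 < s.re - 1 := by linarith
  have h3 := h s h1 h2
  have h4 := h' s.re h1 h2
  have h5 : C <= C/(s.re-1) := by rw [le_div_iff₀ hp]; nlinarith
  calc _ <= ‖-(deriv riemannZeta s / riemannZeta s)‖ + ‖riemannZeta s‖ := norm_sub_le _ _
    _ <= 1/(s.re-1) + C/(s.re-1) + K/(s.re-1) := by rw [norm_neg]; linarith
    _ = _ := by ring

lemma FF_bd {X : Real} (hX : 0 < X) {s : Complex} (h : 3/4 <= s.re) {B : Real} (hB : ‖GG s‖ <= B) :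
    ‖FF X s‖ <= B * X^s.re * 2 * (1+s.im^2)⁻¹ := by
  rw [FF, norm_mul, norm_mul, Complex.norm_cpow_eq_rpow_re_of_pos hX]
  have hB0 : 0 <= B := (norm_nonneg _).trans hB
  calc _ <= B * (X^s.re * (2*(1+s.im^2)⁻¹)) := by
        gcongr; exact K_bd h
    _ = _ := by ring

lemma FF_diff {X : Real} (hX : 0 < X) {s : Complex} (h : 0 < s.re) (hz : riemannZeta₁ s ≠ 0) :
    DifferentiableAt Complex (FF X) s := by
  have hXc : (X:Complex) ≠ 0 := by exact_mod_cast hX.ne'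
  have h1 : s ≠ 0 := by intro h'; rw [h'] at h; simp at h
  have h2 : s + 1 ≠ 0 := by
    intro h'; have := congrArg Complex.re h'; simp at this; linarith
  refine (GG_diff hz).mul (DifferentiableAt.mul ?_ ?_)
  · exact DifferentiableAt.const_cpow differentiableAt_id (Or.inl hXc)
  · exact (differentiableAt_const _).div (by fun_prop) (mul_ne_zero h1 h2)

lemma tail_int {H : Real} (hH : 0 < H) {f : Real → Complex} (hf : MeasureTheory.Integrable f) {B : Real} (hB : 0 <= B)
    (hb : ∀ y, ‖f y‖ <= B * (1+y^2)⁻¹) :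
    ‖(∫ y, f y) - ∫ y in (-H)..H, f y‖ <= B * (2/H) := by
  have hm : MeasurableSet (Set.Ioc (-H) H) := measurableSet_Ioc
  have h1 := MeasureTheory.integral_add_compl hm hf
  have h2 := MeasureTheory.integral_add_compl hm integrable_inv_one_add_sq
  rw [integral_univ_inv_one_add_sq, <- intervalIntegral.integral_of_le (by linarith), integral_inv_one_add_sq,
    arctan_neg] at h2
  rw [<- intervalIntegral.integral_of_le (by linarith)] at h1
  rw [<- h1, add_sub_cancel_left]
  have h3 : arctan H⁻¹ <= H⁻¹ := by
    have := le_tan (x := arctan H⁻¹) (arctan_nonneg.2 (by positivity)) (arctan_lt_pi_div_two _)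
    rwa [tan_arctan] at this
  rw [arctan_inv_of_pos hH] at h3
  calc _ <= ∫ y in (Set.Ioc (-H) H)ᶜ, B * (1+y^2)⁻¹ :=
        MeasureTheory.norm_integral_le_of_norm_le ((integrable_inv_one_add_sq.const_mul B).integrableOn)
          (Filter.Eventually.of_forall hb)
    _ = B * ∫ y in (Set.Ioc (-H) H)ᶜ, (1+y^2)⁻¹ := MeasureTheory.integral_const_mul _ _
    _ <= B * (2/H) := by
        gcongr
        rw [div_eq_mul_inv]; linarith

lemma int_le {H : Real} (hH : 0 < H) {f : Real → Complex} {B : Real} (hB : 0 <= B)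
    (hb : ∀ y, |y| <= H → ‖f y‖ <= B * (1+y^2)⁻¹) : ‖∫ y in (-H)..H, f y‖ <= B * π := by
  calc _ <= ∫ y in (-H)..H, B * (1+y^2)⁻¹ := by
        refine intervalIntegral.norm_integral_le_of_norm_le (by linarith) ?_
          ((integrable_inv_one_add_sq.const_mul B).intervalIntegrable)
        filter_upwards with y hy using hb y (abs_le.2 ⟨hy.1.le, hy.2⟩)
    _ = B * (arctan H - arctan (-H)) := by
        rw [intervalIntegral.integral_const_mul, integral_inv_one_add_sq]
    _ <= _ := by
        rw [arctan_neg]; gcongr; linarith [arctan_lt_pi_div_two H]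

lemma E_bd1 : ∃ b C T1 : Real, 0 < b ∧ 0 < C ∧ 10000 <= T1 ∧ ∀ T X : Real, T1 <= T → exp 1 <= X →
    |EE X| <= C * X * (T^5 * exp (-(b * ww T * log X)) + T^5 * exp (-T) + log X * exp (-T)) := by
  obtain ⟨b, C, T1, hb, hb4, hC, hT1, h⟩ := G_bd
  obtain ⟨D, hD, hG⟩ := GG_line
  refine ⟨b, 5*C*exp 1 + 2*D*exp 1, T1, hb, by positivity, hT1, fun T X hT hX => ?_⟩
  have hX0 : 0 < X := (exp_pos 1).trans_le hX
  have hL : 1 <= log X := (le_log_iff_exp_le hX0).2 hX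
  set κ : Real := 1 + 1/log X with hκ
  have hi : 0 < 1/log X := by positivity
  have hi1 : 1/log X <= 1 := (div_le_one (by linarith)).2 hL
  have hXκ : X^κ = exp 1 * X := by
    rw [rpow_def_of_pos hX0, hκ, mul_add, mul_one, exp_add, exp_log hX0, mul_one_div_cancel (by linarith)]; ring
  have hw1 : ww T <= 1 := ww_le_one (by linarith [exp_one_lt_d9])
  have hw0 : 0 < ww T := ww_pos (by linarith)
  set α : Real := 1 - b * ww T with hα
  have hbw : 0 < b * ww T := by positivity
  have hα1 : 3/4 <= α := by
    have : b * ww T <= 1/4*1 := by gcongr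
    linarith
  have hXα : X^α = X * exp (-(b * ww T * log X)) := by
    rw [rpow_def_of_pos hX0, hα, mul_sub, mul_one, sub_eq_add_neg, exp_add, exp_log hX0]; ring_nf
  set H := exp T with hH
  have hH0 : 0 < H := exp_pos _
  have hT0 : 0 < T := by linarith
  have hH1 : 1 <= H := one_le_exp hT0.le
  have hB0 : 0 <= C*T^5 := by positivity
  have hp := perron hX0 (σ := κ) (by linarith)
  have hlb : ∀ y : Real, ‖FF X ((κ:Complex)+y*I)‖ <= (D*log X*(exp 1*X)*2) * (1+y^2)⁻¹ := by
    intro y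
    have h1 := hG ((κ:Complex)+y*I) (by simp; linarith) (by simp; linarith)
    have h2 := FF_bd hX0 (s := (κ:Complex)+y*I) (by simp; linarith) h1
    simp only [Complex.add_re, Complex.ofReal_re, Complex.mul_re, Complex.I_re, mul_zero, Complex.ofReal_im,
      Complex.I_im, mul_one, sub_self, add_zero, Complex.add_im, Complex.mul_im, zero_add] at h2
    rw [hXκ] at h2
    have e : D/(κ-1) = D*log X := by rw [hκ]; field_simp; ring
    rwa [e] at h2
  have hcl : Continuous fun y : Real => FF X ((κ:Complex)+y*I) := by
    rw [continuous_iff_continuousAt]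
    intro y
    have h1 : ContinuousAt (FF X) ((κ:Complex)+y*I) :=
      (FF_diff hX0 (by simp; linarith) (z1_ne (by simp; linarith))).continuousAt
    exact ContinuousAt.comp (f := fun y : Real => (κ:Complex)+y*I) h1 (by fun_prop)
  have hint : MeasureTheory.Integrable fun y : Real => FF X ((κ:Complex)+y*I) :=
    (integrable_inv_one_add_sq.const_mul _).mono' hcl.aestronglyMeasurable (Filter.Eventually.of_forall hlb)
  have htail := tail_int hH0 hint (by positivity) hlb
  have hr := Complex.integral_boundary_rect_eq_zero_of_differentiableOn (FF X) ((α:Complex) + (-H:Real)*I) ((κ:Complex)+H*I) (by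
    intro s hs
    rw [Complex.mem_reProdIm] at hs
    simp only [Complex.add_re, Complex.ofReal_re, Complex.mul_re, Complex.I_re, mul_zero, Complex.ofReal_im,
      Complex.I_im, mul_one, sub_self, add_zero, Complex.add_im, Complex.mul_im, zero_add] at hs
    rw [Set.uIcc_of_le (by linarith), Set.uIcc_of_le (by linarith)] at hs
    have := (h T s hT (abs_le.2 ⟨hs.2.1, hs.2.2⟩) hs.1.1 (by linarith [hs.1.2])).1
    exact (FF_diff hX0 (by linarith [hs.1.1]) this).differentiableWithinAt)
  simp only [Complex.add_re, Complex.ofReal_re, Complex.mul_re, Complex.I_re, mul_zero, Complex.ofReal_im,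
      Complex.I_im, mul_one, sub_self, add_zero, Complex.add_im, Complex.mul_im, zero_add, smul_eq_mul] at hr
  have hhor : ∀ v : Real, |v| = H → ‖∫ x : Real in α..κ, FF X (x + v*I)‖ <= C*T^5*(exp 1 * X)*2*exp (-T)*(5/4) := by
    intro v hv
    have hvv : (1+v^2)⁻¹ <= exp (-T) := by
      rw [exp_neg]
      apply inv_anti₀ hH0
      rw [<- sq_abs, hv]; nlinarith
    calc _ <= (C*T^5*(exp 1 * X)*2*exp (-T)) * |κ-α| := by
          apply intervalIntegral.norm_integral_le_of_norm_le_const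
          intro x hx
          rw [Set.uIoc_of_le (by linarith)] at hx
          have h1 := (h T (x+v*I) hT (by simp [hv]; exact hH.le) (by simp; linarith [hx.1]) (by simp; linarith [hx.2])).2
          have h2 := FF_bd hX0 (s := x+v*I) (by simp; linarith [hx.1]) h1
          simp only [Complex.add_re, Complex.ofReal_re, Complex.mul_re, Complex.I_re, mul_zero, Complex.ofReal_im,
            Complex.I_im, mul_one, sub_self, add_zero, Complex.add_im, Complex.mul_im, zero_add] at h2
          refine h2.trans ?_
          have : X^x <= exp 1 * X := by
            rw [<- hXκ]; exact rpow_le_rpow_of_exponent_le (by linarith [add_one_le_exp 1]) hx.2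
          gcongr
      _ <= _ := by
          gcongr
          rw [abs_of_pos (by linarith)]; linarith
  have hleft : ‖∫ y : Real in (-H)..H, FF X (α+y*I)‖ <= (C*T^5*(X * exp (-(b * ww T * log X)))*2)*π := by
    apply int_le hH0 (by positivity)
    intro y hy
    have h1 := (h T (α+y*I) hT (by simpa using hy) (by simp; linarith) (by simp; linarith)).2
    have h2 := FF_bd hX0 (s := α+y*I) (by simpa using hα1) h1
    simp only [Complex.add_re, Complex.ofReal_re, Complex.mul_re, Complex.I_re, mul_zero, Complex.ofReal_im,
            Complex.I_im, mul_one, sub_self, add_zero, Complex.add_im, Complex.mul_im, zero_add] at h2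
    rwa [hXα] at h2
  have hb1 := hhor (-H) (by rw [abs_neg, abs_of_pos hH0])
  have hb2 := hhor H (abs_of_pos hH0)
  set A1 := ∫ x : Real in α..κ, FF X (x + (-H:Real)*I)
  set A2 := ∫ x : Real in α..κ, FF X (x + H*I)
  set A3 := ∫ y : Real in (-H)..H, FF X (κ+y*I)
  set A4 := ∫ y : Real in (-H)..H, FF X (α+y*I)
  have hn3 : ‖A3‖ <= ‖A4‖ + ‖A2‖ + ‖A1‖ := by
    have e : I * A3 = I*A4 + A2 - A1 := by linear_combination hr
    have e2 : ‖A3‖ = ‖I * A3‖ := by simp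
    rw [e2, e]
    refine (norm_sub_le _ _).trans ?_
    gcongr
    refine (norm_add_le _ _).trans ?_
    simp
  rw [hp] at htail
  have hE : ‖(2*π*(EE X:Complex))‖ = 2*π*|EE X| := by
    simp [abs_of_pos pi_pos]
  have hfin : 2*π*|EE X| <= D*log X*(exp 1*X)*2*(2/H) + ((C*T^5*(X * exp (-(b * ww T * log X)))*2)*π +
      C*T^5*(exp 1 * X)*2*exp (-T)*(5/4) + C*T^5*(exp 1 * X)*2*exp (-T)*(5/4)) := by
    rw [<- hE]
    calc _ <= ‖2*π*(EE X:Complex) - A3‖ + ‖A3‖ := by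
          have := norm_add_le (2*π*(EE X:Complex) - A3) A3
          simpa using this
      _ <= _ := by linarith
  have hHe : 2/H = 2*exp (-T) := by rw [hH, exp_neg]; rfl
  rw [hHe] at hfin
  clear_value A1 A2 A3 A4
  set u := exp (-(b * ww T * log X))
  set v := exp (-T)
  have he1 : 1 <= exp 1 := one_le_exp (by norm_num)
  have hpi := pi_gt_three
  have hpi0 := pi_pos
  have k1 : 0 <= C*X*(T^5*u) := by positivity
  have k2 : 0 <= C*X*exp 1*(T^5*v) := by positivity
  have k4 : C*X*(T^5*u) <= exp 1 * (C*X*(T^5*u)) := le_mul_of_one_le_left k1 he1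
  have k5 : 0 <= D*X*exp 1*(T^5*u) := by positivity
  have k6 : 0 <= D*X*exp 1*(T^5*v) := by positivity
  have k7 : 0 <= C*X*exp 1*(log X*v) := by positivity
  have k8 : 5/2*(C*X*exp 1*(T^5*v)) + 2*(D*X*exp 1*(log X*v)) <=
      π * (5/2*(C*X*exp 1*(T^5*v)) + 2*(D*X*exp 1*(log X*v))) := le_mul_of_one_le_left (by positivity) (by linarith)
  have k9 : π*|EE X| <= π*(C*X*(T^5*u) + (5/2*(C*X*exp 1*(T^5*v)) + 2*(D*X*exp 1*(log X*v)))) := by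
    rw [mul_add π]; linarith
  have := le_of_mul_le_mul_left k9 hpi0
  refine this.trans ?_
  linarith

noncomputable def tt (x:Real) : Real := (log x) ^ ((3:Real) / 5) * (log (log x)) ^ (-(1:Real) / 5)

lemma ee_facts {x : Real} (hx : exp (exp 1) <= x) : 0 < x ∧ exp 1 <= log x ∧ 1 <= log (log x) := by
  have h0 : 0 < x := (exp_pos _).trans_le hx
  have h1 := (le_log_iff_exp_le h0).2 hx
  exact ⟨h0, h1, (le_log_iff_exp_le ((exp_pos _).trans_le h1)).2 h1⟩

lemma tt_pow {x : Real} (hx : exp (exp 1) <= x) : tt x ^ 5 = log x ^ 3 / log (log x) := by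
  obtain ⟨h0, h1, h2⟩ := ee_facts hx
  have hl : 0 < log x := (exp_pos _).trans_le h1
  rw [tt, mul_pow, <- rpow_natCast, <- rpow_natCast, <- rpow_mul hl.le, <- rpow_mul (by linarith)]
  norm_num
  rw [rpow_neg (by linarith), rpow_one]; rfl

lemma tt_pos {x : Real} (hx : exp (exp 1) <= x) : 0 < tt x := by
  obtain ⟨h0, h1, h2⟩ := ee_facts hx
  have hl : 0 < log x := (exp_pos _).trans_le h1
  unfold tt; positivity

lemma tt_le {x : Real} (hx : exp (exp 1) <= x) : tt x <= log x := by
  obtain ⟨h0, h1, h2⟩ := ee_facts hx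
  have hl : 1 <= log x := by linarith [add_one_le_exp (1:Real)]
  refine (pow_le_pow_iff_left₀ (tt_pos hx).le (by linarith) (n := 5) (by norm_num)).1 ?_
  rw [tt_pow hx]
  calc log x^3/log (log x) <= log x^3 := div_le_self (by positivity) h2
    _ <= _ := pow_le_pow_right₀ hl (by norm_num)

lemma log_le_tt {x : Real} (hx : exp (exp 1) <= x) : log x ^ 2 <= tt x ^ 5 := by
  obtain ⟨h0, h1, h2⟩ := ee_facts hx
  have hl : 1 <= log x := by linarith [add_one_le_exp (1:Real)]
  rw [tt_pow hx, le_div_iff₀ (by linarith)]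
  have := log_le_self (by linarith : 0 <= log x)
  calc _ <= log x^2 * log x := by gcongr
    _ = _ := by ring

lemma tt_half {x y : Real} (hx : exp (exp 1) <= x) (hy : exp (exp 1) <= y) (h1 : log x <= 2 * log y)
    (h2 : log y <= 2 * log x) : tt x / 2 <= tt y := by
  obtain ⟨hx0, hx1, hx2⟩ := ee_facts hx
  obtain ⟨hy0, hy1, hy2⟩ := ee_facts hy
  have := tt_pos hx
  refine (pow_le_pow_iff_left₀ (by positivity) (tt_pos hy).le (n := 5) (by norm_num)).1 ?_
  have hl : 2 <= log x := by linarith [add_one_le_exp (1:Real)]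
  have hyl : 2 <= log y := by linarith [add_one_le_exp (1:Real)]
  rw [div_pow, tt_pow hx, tt_pow hy]
  have h3 : log (log y) <= 2 * log (log x) := by
    calc log (log y) <= log (log x * log x) := by
          apply log_le_log (by linarith); nlinarith
      _ = _ := by rw [log_mul (by linarith) (by linarith)]; ring
  rw [div_div, div_le_div_iff₀ (by positivity) (by linarith)]
  calc log x^3 * log (log y) <= (2*log y)^3 * (2*log (log x)) := by gcongr
    _ <= _ := by
      have : 0 <= log y^3*log (log x) := by positivity
      nlinarith

lemma pow_exp {a : Real} (ha : 0 < a) {T : Real} (hT : 0 <= T) : T^5 * exp (-(2*a*T)) <= 120/a^5 * exp (-(a*T)) := by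
  have h := pow_div_factorial_le_exp (a*T) (by positivity) 5
  have e : exp (-(2*a*T)) = exp (-(a*T)) * (exp (a*T))⁻¹ := by rw [<- exp_neg, <- exp_add]; ring_nf
  rw [e]
  have h2 : T^5 <= 120/a^5 * exp (a*T) := by
    norm_num [Nat.factorial] at h
    rw [div_mul_eq_mul_div, le_div_iff₀ (by positivity)]
    rw [mul_pow] at h; linarith
  calc _ <= 120/a^5 * exp (a*T) * (exp (-(a*T)) * (exp (a*T))⁻¹) := by gcongr
    _ = _ := by field_simp

lemma E_bd2 : ∃ c C X0 : Real, 0 < c ∧ c <= 1/2 ∧ 0 < C ∧ exp (exp 1) <= X0 ∧ ∀ X : Real, X0 <= X →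
    |EE X| <= C * X * exp (-(c * tt X)) := by
  obtain ⟨b, C, T1, hb, hC, hT1, h⟩ := E_bd1
  set a : Real := min b 1 / 2 with ha
  have ha0 : 0 < a := by positivity
  have hab : 2*a <= b := by grind
  have ha1 : 2*a <= 1 := by grind
  refine ⟨a, C*3*(120/a^5), exp (exp 1 + T1^5), ha0, by linarith, by positivity,
    exp_le_exp.2 (le_add_of_nonneg_right (by positivity)), fun X hX => ?_⟩
  have hee : exp (exp 1) <= X := le_trans (exp_le_exp.2 (le_add_of_nonneg_right (by positivity))) hX
  obtain ⟨h0, h1, h2⟩ := ee_facts hee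
  have hl : 1 <= log X := by linarith [add_one_le_exp (1:Real)]
  have hlT : T1^5 <= log X := by
    have := (le_log_iff_exp_le h0).2 hX; linarith [exp_pos 1]
  have htp := tt_pos hee
  have hT : T1 <= tt X := by
    refine (pow_le_pow_iff_left₀ (by linarith) htp.le (n := 5) (by norm_num)).1 ?_
    refine hlT.trans (le_trans ?_ (log_le_tt hee))
    nlinarith
  have hb := h (tt X) X hT (le_trans (exp_le_exp.2 (by linarith [add_one_le_exp (1:Real)])) hee)
  have hlt : log X <= tt X^5 := le_trans (by nlinarith) (log_le_tt hee)
  have hw : tt X <= ww (tt X) * log X := by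
    apply le_of_cube (by have := ww_pos (T := tt X) (by linarith); positivity)
    rw [mul_pow, ww_pow (by linarith)]
    have hlog : log (tt X) <= log (log X) := log_le_log htp (tt_le hee)
    have hlp : 0 < log (tt X) := log_pos (by linarith)
    rw [div_mul_eq_mul_div, one_mul, le_div_iff₀ (by positivity)]
    calc tt X^3*(tt X^2*log (tt X)) = tt X^5*log (tt X) := by ring
      _ <= tt X^5*log (log X) := by gcongr
      _ = log X^3 := by rw [tt_pow hee]; field_simp
  have e1 : exp (-(b*ww (tt X)*log X)) <= exp (-(2*a*tt X)) := by
    apply exp_le_exp.2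
    have : 2*a*tt X <= b*(ww (tt X)*log X) := by gcongr
    linarith
  have e2 : exp (-tt X) <= exp (-(2*a*tt X)) := by simp_all
  have e3 := pow_exp ha0 htp.le
  calc _ <= _ := hb
    _ <= C*X*(tt X^5*exp (-(2*a*tt X)) + tt X^5*exp (-(2*a*tt X)) + tt X^5*exp (-(2*a*tt X))) := by gcongr
    _ = C*X*(3*(tt X^5*exp (-(2*a*tt X)))) := by ring
    _ <= C*X*(3*(120/a^5*exp (-(a*tt X)))) := by gcongr
    _ = _ := by ring

noncomputable def PP (Y:Real) : Real := ∑ n ∈ Ioc 0 ⌊Y⌋₊, ArithmeticFunction.vonMangoldt n * (Y - n)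

lemma PP_diff {X Y : Real} (h0 : 0 <= X) (h : X <= Y) :
    (Y-X)*Chebyshev.psi X <= PP Y - PP X ∧ PP Y - PP X <= (Y-X)*Chebyshev.psi Y := by
  have hf : ⌊X⌋₊ <= ⌊Y⌋₊ := Nat.floor_mono h
  have hL := fun n => ArithmeticFunction.vonMangoldt_nonneg (n := n)
  have e : PP Y - PP X = (Y-X)*Chebyshev.psi X + ∑ n ∈ Ioc ⌊X⌋₊ ⌊Y⌋₊, ArithmeticFunction.vonMangoldt n * (Y-n) := by
    rw [PP, PP, Chebyshev.psi, <- sum_Ioc_consecutive _ (Nat.zero_le _) hf, mul_sum, add_sub_right_comm, <- sum_sub_distrib]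
    congr 1
    exact sum_congr rfl fun n _ => by ring
  have e2 : Chebyshev.psi Y = Chebyshev.psi X + ∑ n ∈ Ioc ⌊X⌋₊ ⌊Y⌋₊, ArithmeticFunction.vonMangoldt n := by
    rw [Chebyshev.psi, Chebyshev.psi, <- sum_Ioc_consecutive _ (Nat.zero_le _) hf]
  rw [e, e2, mul_add]
  have hm : ∀ n ∈ Ioc ⌊X⌋₊ ⌊Y⌋₊, X < n ∧ n <= Y := by
    intro n hn
    rw [mem_Ioc] at hn
    exact ⟨(Nat.floor_lt h0).1 hn.1, (Nat.le_floor_iff (h0.trans h)).1 hn.2⟩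
  constructor
  · refine le_add_of_nonneg_right (sum_nonneg fun n hn => mul_nonneg (hL n) (by linarith [(hm n hn).2]))
  · rw [mul_sum]
    refine add_le_add le_rfl (sum_le_sum fun n hn => ?_)
    rw [mul_comm]
    exact mul_le_mul_of_nonneg_right (by linarith [(hm n hn).1]) (hL n)

lemma PP_err {Y : Real} (h : 1 <= Y) : |PP Y - Y^2/2| <= Y * |EE Y| + Y := by
  set m := ⌊Y⌋₊ with hm
  have h1 : (m:Real) <= Y := Nat.floor_le (by linarith)
  have h2 : Y < m+1 := Nat.lt_floor_add_one Y
  have es : ∀ k : Nat, ∑ n ∈ Ioc 0 k, (Y - n) = k*Y - k*(k+1)/2 := by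
    intro k
    induction k with
    | zero => simp
    | succ k ih => rw [sum_Ioc_succ_top (by omega), ih]; push_cast; ring
  have e : Y*EE Y = PP Y - (m*Y - m*(m+1)/2) := by
    rw [EE, PP, <- es, mul_sum, <- sum_sub_distrib]
    refine sum_congr rfl fun n _ => ?_
    field_simp
  have e2 : PP Y - Y^2/2 = Y*EE Y + -((Y-m)^2/2 + m/2) := by rw [e]; ring
  rw [e2]
  refine (abs_add_le _ _).trans ?_
  rw [abs_mul, abs_of_pos (by linarith : 0 < Y), abs_neg, abs_of_nonneg (by positivity : 0 <= (Y-m)^2/2+(m:Real)/2)]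
  nlinarith

lemma psi_step {P1 P2 X Y d E p q : Real} (hd : 0 < d) (hY : Y = X + d) (h1 : |P1 - X^2/2| <= E) (h2 : |P2 - Y^2/2| <= E)
    (h3 : d*p <= P2 - P1) (h4 : P2 - P1 <= d*q) : p <= X + d/2 + 2*E/d ∧ Y - d/2 - 2*E/d <= q := by
  rw [abs_le] at h1 h2
  subst hY
  constructor
  · have : d*p <= d*(X + d/2 + 2*E/d) := by
      have : d*(X + d/2 + 2*E/d) = d*X+d^2/2+2*E := by field_simp
      rw [this]; nlinarith
    exact le_of_mul_le_mul_left this hd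
  · have : d*(X + d - d/2 - 2*E/d) <= d*q := by
      have : d*(X + d - d/2 - 2*E/d) = d*X+d^2/2-2*E := by field_simp; ring
      rw [this]; nlinarith
    exact le_of_mul_le_mul_left this hd

lemma theta_bd : ∃ c C X0 : Real, 0 < c ∧ c <= 1 ∧ 0 < C ∧ exp (exp 1) <= X0 ∧ ∀ X : Real, X0 <= X →
    |Chebyshev.theta X - X| <= C * X * exp (-(c * tt X)) := by
  obtain ⟨c, C, X0, hc, hc1, hC, hX0, h⟩ := E_bd2
  refine ⟨c/4, 4*(4*C+2)+9, 4*X0, by positivity, by linarith, by positivity, by linarith [exp_pos (exp 1)], fun X hX => ?_⟩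
  have hX0' : 0 < X0 := (exp_pos _).trans_le hX0
  have hee : exp (exp 1) <= X := by linarith
  obtain ⟨h0, h1, h2⟩ := ee_facts hee
  have hX4 : 4 <= X := by
    have : 2 <= exp 1 := by linarith [add_one_le_exp (1:Real)]
    linarith [add_one_le_exp (exp 1)]
  have htp := tt_pos hee
  have htl := tt_le hee
  set η := exp (-(c/4*tt X)) with hη
  have hη0 : 0 < η := exp_pos _
  have hη1 : η <= 1 := exp_le_one_iff.2 (by simp only [neg_nonpos]; positivity)
  have hη2 : exp (-(c*(tt X/2))) = η^2 := by rw [hη, <- exp_nat_mul]; congr 1; push_cast; ring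
  have hηX : exp (-(1/4*log X)) <= η := by
    apply exp_le_exp.2
    have : c/4*tt X <= 1/4*log X := by gcongr; linarith
    linarith
  have hX1 : X <= X^2*η^2 := by
    have : 1 <= X*η^2 := by
      have e : X * (exp (-(1/4*log X)))^4 = 1 := by
        rw [<- exp_nat_mul]; nth_rw 1 [<- exp_log h0]; rw [<- exp_add]; ring_nf; simp
      calc 1 = X * (exp (-(1/4*log X)))^4 := e.symm
        _ <= X * η^4 := by gcongr
        _ <= X * η^2 := by gcongr _ * ?_; exact pow_le_pow_of_le_one hη0.le hη1 (by norm_num)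
    nlinarith
  set E := (4*C+2)*X^2*η^2 with hE
  have herr : ∀ Y, X/2 <= Y → Y <= 2*X → |PP Y - Y^2/2| <= E := by
    intro Y hY1 hY2
    have hY0 : X0 <= Y := by linarith
    have hYp : 0 < Y := by linarith
    have hYee : exp (exp 1) <= Y := by linarith
    have ht : tt X/2 <= tt Y := by
      apply tt_half hee hYee
      · rw [<- log_rpow hYp]; apply log_le_log h0; norm_num; nlinarith
      · rw [<- log_rpow h0]; apply log_le_log hYp; norm_num; nlinarith
    have hE1 : |EE Y| <= C*Y*η^2 := by
      refine (h Y hY0).trans ?_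
      rw [<- hη2]; gcongr
    calc _ <= Y*|EE Y| + Y := PP_err (by linarith)
      _ <= (2*X)*(C*(2*X)*η^2) + 2*(X^2*η^2) := by
        gcongr
        · exact hE1.trans (by gcongr)
        · linarith
      _ = E := by rw [hE]; ring
  set d := η*X/2 with hd
  have hd0 : 0 < d := by positivity
  have hdX : d <= X/2 := by rw [hd]; nlinarith
  have a1 := psi_step hd0 rfl (herr X (by linarith) (by linarith)) (herr (X+d) (by linarith) (by linarith))
    (by have := (PP_diff h0.le (by linarith : X <= X+d)).1; rwa [add_sub_cancel_left] at this)
    (by have := (PP_diff h0.le (by linarith : X <= X+d)).2; rwa [add_sub_cancel_left] at this)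
  have a2 := psi_step hd0 (by ring : X = (X-d)+d) (herr (X-d) (by linarith) (by linarith)) (herr X (by linarith) (by linarith))
    (by have := (PP_diff (by linarith) (by linarith : X-d <= X)).1; rwa [sub_sub_cancel] at this)
    (by have := (PP_diff (by linarith) (by linarith : X-d <= X)).2; rwa [sub_sub_cancel] at this)
  have hEd : 2*E/d = 4*(4*C+2)*X*η := by rw [hE, hd]; field_simp; ring
  have hpsi : |Chebyshev.psi X - X| <= (4*(4*C+2)+1)*X*η := by
    rw [abs_le]
    have b1 := a1.1
    have b2 := a2.2
    rw [hEd] at b1 b2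
    have e : (4*(4*C+2)+1)*X*η = 4*(4*C+2)*X*η + 2*d := by rw [hd]; ring
    constructor <;> linarith
  have hth := Chebyshev.abs_psi_sub_theta_le_sqrt_mul_log (x := X) (by linarith)
  have hs : 2*√X*log X <= 8*X*η := by
    have hl : 1/4*log X <= exp (1/4*log X) := by linarith [add_one_le_exp (1/4*log X)]
    have e1 : √X = exp (1/2*log X) := by rw [sqrt_eq_rpow, rpow_def_of_pos h0]; ring_nf
    have e2 : X*exp (-(1/4*log X)) = exp (3/4*log X) := by
      nth_rw 1 [<- exp_log h0]; rw [<- exp_add]; ring_nf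
    calc 2*√X*log X = 8*√X*(1/4*log X) := by ring
      _ <= 8*√X*exp (1/4*log X) := by gcongr
      _ = 8*(X*exp (-(1/4*log X))) := by rw [e1, e2, mul_assoc, <- exp_add]; ring_nf
      _ <= 8*(X*η) := by gcongr
      _ = _ := by ring
  rw [abs_le] at *
  have e : (4*(4*C+2)+9)*X*η = (4*(4*C+2)+1)*X*η + 8*X*η := by ring
  constructor <;> linarith

noncomputable def ff (a t : Real) : Real := t^(-a)/log t

noncomputable def ff' (a t : Real) : Real := (-a*t^(-a-1)*log t - t^(-a)*t⁻¹)/log t^2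

lemma ff_deriv (a:Real) {t : Real} (ht : 1 < t) : HasDerivAt (ff a) (ff' a t) t := by
  have h0 : t ≠ 0 := by linarith
  exact (hasDerivAt_rpow_const (Or.inl h0)).div (hasDerivAt_log h0) (log_pos ht).ne'

lemma ff'_cont (a:Real) {u v : Real} (hu : 1 < u) : ContinuousOn (ff' a) (Set.Icc u v) := by
  have h0 : ∀ t ∈ Set.Icc u v, t ≠ 0 := fun t ht => by linarith [ht.1]
  have hl : ContinuousOn log (Set.Icc u v) := continuousOn_log.mono fun t ht => h0 t ht
  have hr : ∀ b : Real, ContinuousOn (fun t : Real => t^b) (Set.Icc u v) := fun b =>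
    ContinuousOn.rpow_const continuousOn_id fun t ht => Or.inl (h0 t ht)
  refine ContinuousOn.div ?_ (hl.pow 2) fun t ht => pow_ne_zero _ (log_pos (by linarith [ht.1])).ne'
  exact (((continuousOn_const.mul (hr _)).mul hl).sub ((hr _).mul (continuousOn_inv₀.mono fun t ht => h0 t ht)))

lemma ff_cont (a:Real) {u v : Real} (hu : 1 < u) : ContinuousOn (ff a) (Set.Icc u v) := fun t ht =>
  (ff_deriv a (by linarith [ht.1])).continuousAt.continuousWithinAt

lemma ff'_neg {a : Real} (ha : 0 <= a) {t : Real} (ht : 1 < t) : ff' a t <= 0 := by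
  have h0 := log_pos ht
  apply div_nonpos_of_nonpos_of_nonneg _ (by positivity)
  have h1 : 0 <= a*t^(-a-1)*log t := by positivity
  have h2 : 0 <= t^(-a)*t⁻¹ := by positivity
  linarith

lemma ps_diff {a u v κ : Real} (ha : 0 <= a) (hu : 1 < u) (huv : u <= v) (hκ : 0 <= κ)
    (h : ∀ t, u <= t → t <= v → |Chebyshev.theta t - t| <= κ * t) :
    |(∑ p ∈ Ioc ⌊u⌋₊ ⌊v⌋₊ with p.Prime, (p:Real)^(-a)) - ∫ t in u..v, ff a t| <=
      κ * (2 * (u * ff a u) + ∫ t in u..v, ff a t) := by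
  have hd : ∀ t ∈ Set.Icc u v, HasDerivAt (ff a) (ff' a t) t := fun t ht => ff_deriv a (by linarith [ht.1])
  have hde : ∀ t ∈ Set.Icc u v, deriv (ff a) t = ff' a t := fun t ht => (hd t ht).deriv
  have hint' : MeasureTheory.IntegrableOn (ff' a) (Set.Icc u v) := (ff'_cont a hu).integrableOn_Icc
  have hab := sum_mul_eq_sub_sub_integral_mul (fun k : Nat => if k.Prime then log k else 0) (f := ff a)
    (by linarith : 0 <= u) huv (fun t ht => (hd t ht).differentiableAt)
    (hint'.congr_fun (fun t ht => (hde t ht).symm) measurableSet_Icc)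
  have hth : ∀ t : Real, ∑ k ∈ Icc 0 ⌊t⌋₊, (if k.Prime then log k else 0) = Chebyshev.theta t := by
    intro t; rw [Chebyshev.theta_eq_sum_Icc, sum_filter]
  simp_rw [hth] at hab
  have hs : ∑ k ∈ Ioc ⌊u⌋₊ ⌊v⌋₊, ff a k * (if k.Prime then log k else 0) =
      ∑ p ∈ Ioc ⌊u⌋₊ ⌊v⌋₊ with p.Prime, (p:Real)^(-a) := by
    rw [sum_filter]
    refine sum_congr rfl fun k _ => ?_
    split_ifs with hk
    · have : log k ≠ 0 := (log_pos (by exact_mod_cast hk.one_lt)).ne'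
      rw [ff]; field_simp
    · simp
  have hi2 : ∫ t in Set.Ioc u v, deriv (ff a) t * Chebyshev.theta t = ∫ t in u..v, ff' a t * Chebyshev.theta t := by
    rw [intervalIntegral.integral_of_le huv]
    refine MeasureTheory.setIntegral_congr_fun measurableSet_Ioc fun t ht => ?_
    rw [hde t ⟨ht.1.le, ht.2⟩]
  rw [hs, hi2] at hab
  have hc1 : ContinuousOn (ff' a) (Set.uIcc u v) := by rw [Set.uIcc_of_le huv]; exact ff'_cont a hu
  have hc0 : ContinuousOn (ff a) (Set.uIcc u v) := by rw [Set.uIcc_of_le huv]; exact ff_cont a hu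
  have hct : ContinuousOn (fun t => ff' a t * t) (Set.uIcc u v) := hc1.mul continuousOn_id
  have hi3 : IntervalIntegrable (fun t => ff' a t * Chebyshev.theta t) MeasureTheory.volume u v := by
    apply IntervalIntegrable.continuousOn_mul _ hc1
    exact (Chebyshev.theta_mono).intervalIntegrable
  have hparts : ∫ t in u..v, (ff a t + ff' a t * t) = v * ff a v - u * ff a u := by
    have := intervalIntegral.integral_eq_sub_of_hasDerivAt (f := fun t => t * ff a t) (f' := fun t => ff a t + ff' a t * t)
      (a := u) (b := v) (fun t ht => by
        rw [Set.uIcc_of_le huv] at ht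
        have := (hasDerivAt_id t).mul (hd t ht)
        exact HasDerivAt.congr_deriv (f := fun t => t * ff a t) this (by simp; ring)) ((hc0.add hct).intervalIntegrable)
    exact this
  rw [intervalIntegral.integral_add hc0.intervalIntegrable hct.intervalIntegrable] at hparts
  have hsub : ∫ t in u..v, ff' a t * (Chebyshev.theta t - t) =
      (∫ t in u..v, ff' a t * Chebyshev.theta t) - ∫ t in u..v, ff' a t * t := by
    rw [<- intervalIntegral.integral_sub hi3 hct.intervalIntegrable]
    simp_rw [mul_sub]
  have hbd : |∫ t in u..v, ff' a t * (Chebyshev.theta t - t)| <= ∫ t in u..v, (-κ) * (ff' a t * t) := by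
    rw [<- norm_eq_abs]
    apply intervalIntegral.norm_integral_le_of_norm_le huv
    · filter_upwards with t ht
      rw [norm_mul, norm_eq_abs, norm_eq_abs, abs_of_nonpos (ff'_neg ha (by linarith [ht.1]))]
      have := mul_le_mul_of_nonneg_left (h t ht.1.le ht.2) (neg_nonneg.2 (ff'_neg ha (t := t) (by linarith [ht.1])))
      linarith
    · exact (hct.intervalIntegrable).const_mul _
  rw [intervalIntegral.integral_const_mul] at hbd
  have hfu : 0 <= ff a u := div_nonneg (rpow_nonneg (by linarith) _) (log_pos hu).le
  have hfv : 0 <= ff a v := div_nonneg (rpow_nonneg (by linarith) _) (log_pos (by linarith)).le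
  have hu1 := mul_le_mul_of_nonneg_left (h u le_rfl huv) hfu
  have hv1 := mul_le_mul_of_nonneg_left (h v huv le_rfl) hfv
  rw [hab]
  have e : ff a v * Chebyshev.theta v - ff a u * Chebyshev.theta u - (∫ t in u..v, ff' a t * Chebyshev.theta t) -
      ∫ t in u..v, ff a t = ff a v * (Chebyshev.theta v - v) - ff a u * (Chebyshev.theta u - u) -
      ∫ t in u..v, ff' a t * (Chebyshev.theta t - t) := by
    rw [hsub]; linarith
  rw [e]
  have e2 : κ * (2 * (u * ff a u) + ∫ t in u..v, ff a t) = ff a v * (κ*v) + ff a u * (κ*u) +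
      -κ * ∫ t in u..v, ff' a t * t := by linear_combination κ * hparts
  rw [e2]
  refine (abs_sub _ _).trans (add_le_add ((abs_sub _ _).trans ?_) hbd)
  rw [abs_mul, abs_mul, abs_of_nonneg hfu, abs_of_nonneg hfv]
  linarith

noncomputable def MM (a x : Real) : Real := ∫ t in √x..x, t^(-a)

noncomputable def II (a x : Real) : Real := ∫ t in √x..x, ff a t

noncomputable def SS (a x : Real) : Real := ∑ p ∈ Ioc ⌊√x⌋₊ ⌊x⌋₊ with p.Prime, (p:Real)^(-a)

lemma sq_facts {x : Real} (hx : 2 <= x) : 1 < √x ∧ √x <= x ∧ log (√x) = log x / 2 ∧ 0 < log x := by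
  refine ⟨?_, ?_, log_sqrt (by linarith), log_pos (by linarith)⟩
  · rw [lt_sqrt (by norm_num)]; linarith
  · rw [sqrt_le_left (by linarith)]; nlinarith

lemma pw_ii (a:Real) {u v : Real} (hu : 0 < u) (huv : u <= v) :
    IntervalIntegrable (fun t : Real => t^(-a)) MeasureTheory.volume u v := by
  apply ContinuousOn.intervalIntegrable
  rw [Set.uIcc_of_le huv]
  exact ContinuousOn.rpow_const continuousOn_id fun t ht => Or.inl (by linarith [ht.1])

lemma ff_ii (a:Real) {u v : Real} (hu : 1 < u) (huv : u <= v) :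
    IntervalIntegrable (ff a) MeasureTheory.volume u v := by
  apply ContinuousOn.intervalIntegrable
  rw [Set.uIcc_of_le huv]
  exact ff_cont a hu

lemma I_bd (a:Real) {x : Real} (hx : 2 <= x) : MM a x / log x <= II a x ∧ II a x <= 2 * MM a x / log x := by
  obtain ⟨h1, h2, h3, h4⟩ := sq_facts hx
  have hp := pw_ii a (by linarith : 0 < √x) h2
  have hl : ∀ t ∈ Set.Icc (√x) x, log x/2 <= log t ∧ log t <= log x := by
    intro t ht
    rw [<- h3]
    exact ⟨log_le_log (by linarith) ht.1, log_le_log (by linarith [ht.1]) ht.2⟩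
  constructor
  · rw [MM, II, <- intervalIntegral.integral_div]
    refine intervalIntegral.integral_mono_on h2 (hp.div_const _) (ff_ii a h1 h2) fun t ht => ?_
    have := hl t ht
    have ht0 : 0 < t := by linarith [ht.1]
    exact div_le_div_of_nonneg_left (by positivity) (by linarith) this.2
  · rw [MM, II, mul_div_right_comm, <- intervalIntegral.integral_const_mul]
    refine intervalIntegral.integral_mono_on h2 (ff_ii a h1 h2) (hp.const_mul _) fun t ht => ?_
    have := hl t ht
    have ht0 : 0 < t := by linarith [ht.1]
    rw [ff, div_mul_eq_mul_div, div_le_div_iff₀ (by linarith) h4]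
    have : 0 < t^(-a) := by positivity
    nlinarith

lemma MM_sub (a:Real) {x u v : Real} (hx : 2 <= x) (hu : √x <= u) (huv : u <= v) (hv : v <= x) :
    ∫ t in u..v, t^(-a) <= MM a x := by
  obtain ⟨h1, h2, h3, h4⟩ := sq_facts hx
  apply intervalIntegral.integral_mono_interval hu huv hv _ (pw_ii a (by linarith) h2)
  filter_upwards [MeasureTheory.self_mem_ae_restrict measurableSet_Ioc] with t ht
  exact rpow_nonneg (by linarith [ht.1]) _

lemma pw_low {a u v : Real} (ha : 0 <= a) (hu : 0 < u) (huv : u <= v) : (v-u)*v^(-a) <= ∫ t in u..v, t^(-a) := by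
  have := intervalIntegral.integral_mono_on huv (intervalIntegrable_const (c := v^(-a))) (pw_ii a hu huv) fun t ht =>
    rpow_le_rpow_of_nonpos (by linarith [ht.1]) ht.2 (by linarith)
  rwa [intervalIntegral.integral_const, smul_eq_mul] at this

lemma MM_low {a x : Real} (ha : 0 <= a) (ha3 : a <= 3) (hx : 4 <= x) :
    x^(1/2-a/2)/8 <= MM a x ∧ x^(1-a)/2 <= MM a x := by
  obtain ⟨h1, h2, h3, h4⟩ := sq_facts (by linarith : 2 <= x)
  have hs2 : 2*√x <= x := by
    nlinarith [mul_self_sqrt (by linarith : 0 <= x)]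
  have hx0 : 0 < x := by linarith
  have hsx : √x = x^(1/2:Real) := sqrt_eq_rpow x
  constructor
  · refine le_trans ?_ (MM_sub a (by linarith) le_rfl (by linarith) hs2)
    refine le_trans ?_ (pw_low ha (by linarith) (by linarith))
    have e : x^(1/2-a/2) = √x * (√x)^(-a) := by
      rw [hsx, <- rpow_mul hx0.le, <- rpow_add hx0]; ring_nf
    have h8 : (8:Real)⁻¹ <= 2^(-a) := by
      have : (2:Real)^(-3:Real) <= 2^(-a) := rpow_le_rpow_of_exponent_le (by norm_num) (by linarith)
      refine le_trans (le_of_eq ?_) this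
      rw [rpow_neg (by norm_num)]; norm_num
    rw [mul_rpow (by norm_num) (by linarith), e]
    have : 0 < √x * √x^(-a) := by positivity
    nlinarith
  · refine le_trans ?_ (MM_sub a (by linarith) (by linarith : √x <= x/2) (by linarith) le_rfl)
    refine le_trans (le_of_eq ?_) (pw_low ha (by linarith) (by linarith))
    rw [sub_eq_add_neg, rpow_add hx0, rpow_one]; ring

lemma MM_up {a x : Real} (ha : a <= 1/2) (hx : 2 <= x) : MM a x <= 2 * x^(1-a) := by
  obtain ⟨h1, h2, h3, h4⟩ := sq_facts hx
  rw [MM, integral_rpow (Or.inl (by linarith))]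
  have h5 : 0 <= √x^(-a+1) := by positivity
  rw [div_le_iff₀ (by linarith), (by ring : 1-a = -a+1)]
  have : 0 <= x^(-a+1) := rpow_nonneg (by linarith) _
  nlinarith

lemma ps_main : ∃ c C X1 : Real, 0 < c ∧ c <= 1 ∧ 0 < C ∧ exp (exp 1) <= X1 ∧ ∀ x a : Real, X1 <= x → 0 <= a → a <= 3 →
    |SS a x - II a x| <= C * exp (-(c * tt x)) * II a x := by
  obtain ⟨c, C, X0, hc, hc1, hC, hX0, h⟩ := theta_bd
  have hX00 : 0 < X0 := (exp_pos _).trans_le hX0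
  have hX4 : 4 <= X0 := by
    have h1 : 2.7 <= exp 1 := by linarith [exp_one_gt_d9]
    have h2 := quadratic_le_exp_of_nonneg (exp_pos 1).le
    nlinarith
  refine ⟨c/2, C*33, X0^2, by positivity, by linarith, by positivity, by nlinarith, fun x a hx ha ha3 => ?_⟩
  have hxX : X0 <= x := by nlinarith
  obtain ⟨h1, h2, h3, h4⟩ := sq_facts (by linarith : 2 <= x)
  have hx0 : 0 < x := by linarith
  have hsX : X0 <= √x := by rw [le_sqrt hX00.le hx0.le]; exact hx
  have hk : ∀ t, √x <= t → t <= x → |Chebyshev.theta t - t| <= (C*exp (-(c/2*tt x)))*t := by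
    intro t ht1 ht2
    have ht0 : 0 < t := by linarith
    have l1 : log x/2 <= log t := by rw [<- h3]; exact log_le_log (by linarith) ht1
    have l2 : log t <= log x := log_le_log ht0 ht2
    have := tt_half (hX0.trans hxX) (hX0.trans (hsX.trans ht1)) (by linarith) (by linarith)
    calc _ <= C*t*exp (-(c*tt t)) := h t (hsX.trans ht1)
      _ <= C*t*exp (-(c/2*tt x)) := by
        apply mul_le_mul_of_nonneg_left (exp_le_exp.2 _) (by positivity)
        nlinarith
      _ = _ := by ring
  have := ps_diff ha h1 h2 (by positivity) hk
  refine this.trans ?_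
  have e1 : √x * ff a (√x) <= 16 * II a x := by
    have e : √x * ff a (√x) = 16 * (x^(1/2-a/2)/8 / log x) := by
      rw [ff, h3, sqrt_eq_rpow, <- rpow_mul hx0.le, sub_eq_add_neg, rpow_add hx0]
      ring_nf
    rw [e]
    have m1 := (MM_low ha ha3 (by linarith : 4 <= x)).1
    have m2 := (I_bd a (by linarith : 2 <= x)).1
    have : x^(1/2-a/2)/8/log x <= MM a x/log x := by gcongr
    linarith
  have e2 : 2*(√x * ff a (√x)) + II a x <= 33 * II a x := by linarith
  calc _ <= (C*exp (-(c/2*tt x)))*(33 * II a x) := mul_le_mul_of_nonneg_left e2 (by positivity)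
    _ = _ := by ring

noncomputable def gk (s x : Real) (p k : Nat) : Real :=
  if 2 <= k ∧ x ^ ((k:Real)⁻¹) < (p:Real) then (p:Real) ^ (-(k:Real) * s) / k else 0

lemma geo {r : Real} (h0 : 0 <= r) (h1 : r < 1) (K:Nat) :
    HasSum (fun k : Nat => if K <= k then r^k else 0) (r^K/(1-r)) := by
  have h := (hasSum_geometric_of_lt_one h0 h1).mul_left (r^K)
  rw [<- div_eq_mul_inv] at h
  have hi : Function.Injective (fun k : Nat => K + k) := fun a b hab => by simpa using hab
  refine (hi.hasSum_iff ?_).1 (h.congr_fun fun k => ?_)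
  · intro k hk
    rw [if_neg]
    intro hK
    exact hk ⟨k-K, by simp only; omega⟩
  · simp [pow_add]

lemma inv_one_sub {u : Real} (hu : 0 < u) : 1/(1-exp (-u)) <= 1+1/u := by
  have h1 : exp (-u) <= 1/(1+u) := by
    rw [exp_neg, <- one_div]; exact one_div_le_one_div_of_le (by linarith) (by linarith [add_one_le_exp u])
  have h2 : u/(1+u) <= 1-exp (-u) := by
    have : u/(1+u) = 1 - 1/(1+u) := by field_simp; ring
    rw [this]; linarith
  calc _ <= 1/(u/(1+u)) := one_div_le_one_div_of_le (by positivity) h2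
    _ = _ := by field_simp; ring

lemma rk_eq {s : Real} {p : Nat} (hp : 2 <= p) (k:Nat) : (p:Real)^(-(k:Real)*s) = exp (-(log p*s))^k := by
  have : (0:Real) < p := by positivity
  rw [<- exp_nat_mul, rpow_def_of_pos this]; ring_nf

lemma gk_cond {x : Real} (hx : 2 <= x) {p k : Nat} (hp : 2 <= p) (hk : 1 <= k) :
    x^((k:Real)⁻¹) < p ↔ log x < k*log p := by
  have hp0 : (0:Real) < p := by positivity
  have hk0 : (0:Real) < k := by positivity
  rw [<- log_lt_log_iff (by positivity) hp0, log_rpow (by linarith), inv_mul_lt_iff₀ hk0]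

lemma gk_nonneg {s x : Real} {p : Nat} (k:Nat) : 0 <= gk s x p k := by
  rw [gk]; split_ifs <;> positivity

lemma gk_le {s x : Real} {p : Nat} (hp : 2 <= p) (k:Nat) : gk s x p k <= exp (-(log p*s))^k := by
  rw [gk]
  split_ifs with h
  · rw [rk_eq hp]
    exact div_le_self (by positivity) (by have := h.1; exact_mod_cast (by omega : 1 <= k))
  · positivity

lemma logp {p : Nat} (hp : 2 <= p) : 0 < log p := log_pos (by exact_mod_cast (by omega : 1 < p))

lemma r_lt {s : Real} (hs : 0 < s) {p : Nat} (hp : 2 <= p) : exp (-(log p*s)) < 1 := by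
  have := logp hp
  have : 0 < log p * s := by positivity
  rw [<- exp_zero]; exact exp_lt_exp.2 (by linarith)

lemma gk_summable {s x : Real} (hs : 0 < s) {p : Nat} (hp : 2 <= p) : Summable (gk s x p) :=
  (summable_geometric_of_lt_one (exp_pos _).le (r_lt hs hp)).of_nonneg_of_le gk_nonneg (gk_le hp)

lemma gk_sum_le {ε s x : Real} (hε : 0 < ε) (hx : 2 <= x) (hs : ε / log x <= s) {p : Nat} (hp : 2 <= p) (hpx : (p:Real) <= x) :
    ∑' k, gk s x p k <= (1+3/ε) * x^(-s) := by
  have hl : 0 < log x := log_pos (by linarith)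
  have hs0 : 0 < s := lt_of_lt_of_le (by positivity) hs
  have hlp := logp hp
  have hlx : log p <= log x := log_le_log (by positivity) hpx
  set r := exp (-(log p*s)) with hr
  set K := ⌊log x/log p⌋₊ + 1 with hK
  have hr1 : r < 1 := r_lt hs0 hp
  have hr0 : 0 < r := exp_pos _
  have hle : ∀ k, gk s x p k <= (log p/log x) * (if K <= k then r^k else 0) := by
    intro k
    by_cases h : 2 <= k ∧ x ^ ((k:Real)⁻¹) < p
    · have h2 := (gk_cond hx hp (by omega)).1 h.2
      have hk0 : (0:Real) < k := by have := h.1; positivity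
      have : log x/log p < k := by rwa [div_lt_iff₀ hlp]
      have : ⌊log x/log p⌋₊ < k := (Nat.floor_lt (by positivity)).2 this
      rw [gk, if_pos h, if_pos (by omega), rk_eq hp, div_eq_mul_inv, mul_comm]
      gcongr
      rw [inv_eq_one_div, div_le_div_iff₀ hk0 hl]; linarith
    · rw [gk, if_neg h]
      positivity
  have hsum := (geo hr0.le hr1 K).mul_left (log p/log x)
  have h1 := hasSum_le hle (gk_summable hs0 hp).hasSum hsum
  refine h1.trans ?_
  have hrK : r^K <= x^(-s) := by
    rw [hr, <- exp_nat_mul, rpow_def_of_pos (by linarith)]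
    apply exp_le_exp.2
    have : log x/log p < K := by rw [hK]; push_cast; exact Nat.lt_floor_add_one _
    rw [div_lt_iff₀ hlp] at this
    nlinarith
  have hu : ε*log p/log x <= log p*s := by
    rw [mul_comm ε, mul_div_assoc]; gcongr
  have hinv := inv_one_sub (u := log p*s) (by positivity)
  rw [<- hr] at hinv
  have h2 : 1/(log p*s) <= log x/(ε*log p) := by
    rw [one_div_le (by positivity) (by positivity), one_div_div]; exact hu
  calc (log p/log x)*(r^K/(1-r)) = (log p/log x*(1/(1-r)))*r^K := by ring
    _ <= (log p/log x*(1+log x/(ε*log p)))*x^(-s) := by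
      gcongr
      linarith
    _ = (log p/log x + 1/ε)*x^(-s) := by field_simp
    _ <= _ := by
      gcongr
      · exact (div_le_one hl).2 hlx
      · norm_num

noncomputable def gk3 (s x : Real) (p k : Nat) : Real := if 3 <= k then gk s x p k else 0

lemma gk3_facts {ε s x : Real} (hε : 0 < ε) (hx : 2 <= x) (hs : ε / log x <= s) {p : Nat} (hp : 2 <= p) (hpx : (p:Real) <= x) :
    ∑' k, gk s x p k = (if √x < p then (p:Real)^(-(2*s))/2 else 0) + ∑' k, gk3 s x p k ∧ 0 <= ∑' k, gk3 s x p k ∧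
    ∑' k, gk3 s x p k <= (1+3/ε) * x^(-s) ∧
    (2/5*log x <= log p → ∑' k, gk3 s x p k <= (1+3/ε) * (p:Real)^(-(3*s))) := by
  have hl : 0 < log x := log_pos (by linarith)
  have hs0 : 0 < s := lt_of_lt_of_le (by positivity) hs
  have hlp := logp hp
  have h3n : ∀ k, 0 <= gk3 s x p k := fun k => by rw [gk3]; split_ifs; exacts [gk_nonneg k, le_rfl]
  have h3l : ∀ k, gk3 s x p k <= gk s x p k := fun k => by rw [gk3]; split_ifs; exacts [le_rfl, gk_nonneg k]
  have hsm := gk_summable (x := x) hs0 hp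
  have hsm3 : Summable (gk3 s x p) := hsm.of_nonneg_of_le h3n h3l
  refine ⟨?_, tsum_nonneg h3n, (hsm3.tsum_le_tsum h3l hsm).trans (gk_sum_le hε hx hs hp hpx), fun h => ?_⟩
  · have h2 : HasSum (fun k => if k = 2 then gk s x p 2 else 0) (gk s x p 2) := hasSum_ite_eq 2 _
    have h4 := (h2.add hsm3.hasSum).tsum_eq
    have e : ∀ k, (if k = 2 then gk s x p 2 else 0) + gk3 s x p k = gk s x p k := by
      intro k
      rcases lt_trichotomy k 2 with hk | rfl | hk
      · rw [if_neg (by omega), gk3, if_neg (by omega), gk, if_neg (by omega)]; ring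
      · simp [gk3]
      · rw [if_neg (by omega), gk3, if_pos (by omega)]; ring
    simp_rw [e] at h4
    rw [h4]; congr 1
    rw [gk]
    have e1 : x^(((2:Nat):Real)⁻¹) = √x := by rw [sqrt_eq_rpow]; norm_num
    rw [e1]
    simp only [le_refl, true_and]
    push_cast; ring_nf
  · set r := exp (-(log p*s)) with hr
    have hr1 : r < 1 := r_lt hs0 hp
    have hr0 : 0 < r := exp_pos _
    have hle : ∀ k, gk3 s x p k <= (1/3) * (if 3 <= k then r^k else 0) := by
      intro k
      rw [gk3]
      split_ifs with hk
      · rw [gk]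
        split_ifs
        · rw [rk_eq hp, div_eq_mul_inv, mul_comm]
          gcongr
          rw [inv_eq_one_div]
          exact one_div_le_one_div_of_le (by norm_num) (by exact_mod_cast hk)
        · positivity
      · simp
    have h1 := hasSum_le hle hsm3.hasSum ((geo hr0.le hr1 3).mul_left (1/3))
    refine h1.trans ?_
    have hu : 2/5*ε <= log p*s := by
      calc 2/5*ε = (2/5*log x)*(ε/log x) := by field_simp
        _ <= _ := by gcongr
    have hinv := inv_one_sub (u := log p*s) (by positivity)
    rw [<- hr] at hinv
    have h2 : 1/(log p*s) <= 3/ε := by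
      rw [div_le_div_iff₀ (by positivity) hε]; linarith
    have e3 : p^(-(3*s)) = r^3 := by
      rw [hr, <- rk_eq hp]; push_cast; ring_nf
    rw [e3]
    have hi0 : 0 <= 1/(1-r) := by apply one_div_nonneg.2; linarith
    calc 1/3*(r^3/(1-r)) = (1/3*(1/(1-r)))*r^3 := by ring
      _ <= _ := by gcongr; linarith

lemma logG2_eq {s x : Real} (hs : 0 < s) : logG2 s x = ∑ p ∈ Nat.primesBelow (⌊x⌋₊ + 1), ∑' k, gk s x p k := by
  exact Summable.tsum_finsetSum fun p hp => gk_summable hs (Nat.prime_of_mem_primesBelow hp).two_le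

lemma cntP (N:Nat) {y c : Real} (hy : 0 <= y) (hc : 0 <= c) :
    ∑ p ∈ Nat.primesBelow N, (if (p:Real) <= y then c else 0) <= y * c := by
  rw [<- sum_filter, sum_const, nsmul_eq_mul]
  gcongr
  have : #{p ∈ Nat.primesBelow N | ((p:Nat):Real) <= y} <= #(Ioc 0 ⌊y⌋₊) := by
    apply card_le_card
    intro p hp
    rw [mem_filter] at hp
    rw [mem_Ioc]
    exact ⟨(Nat.prime_of_mem_primesBelow hp.1).pos, Nat.le_floor hp.2⟩
  rw [Nat.card_Ioc, Nat.sub_zero] at this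
  exact le_trans (by exact_mod_cast this) (Nat.floor_le hy)

lemma SS_eq {x : Real} (hx : 2 <= x) (a:Real) :
    ∑ p ∈ Nat.primesBelow (⌊x⌋₊+1), (if √x < (p:Real) then (p:Real)^(-a) else 0) = SS a x := by
  rw [<- sum_filter, SS]
  congr 1
  ext p
  simp only [mem_filter, mem_Ioc, Nat.mem_primesBelow, Nat.floor_lt (sqrt_nonneg x)]
  constructor
  · rintro ⟨⟨h1, h2⟩, h3⟩; exact ⟨⟨h3, by omega⟩, h2⟩
  · rintro ⟨⟨h1, h2⟩, h3⟩; exact ⟨⟨by omega, h3⟩, h1⟩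

lemma G_split {ε s x : Real} (hε : 0 < ε) (hx : 2 <= x) (hs : ε / log x <= s) :
    ∃ R, logG2 s x = SS (2*s) x / 2 + R ∧ 0 <= R ∧
      R <= (1+3/ε)*(x^(2/5-s) + x^(1/2-6*s/5) + SS (3*s) x) := by
  have hl : 0 < log x := log_pos (by linarith)
  have hs0 : 0 < s := lt_of_lt_of_le (by positivity) hs
  have hx0 : 0 < x := by linarith
  obtain ⟨q1, q2, q3, q4⟩ := sq_facts hx
  have hP : ∀ p ∈ Nat.primesBelow (⌊x⌋₊+1), 2 <= p ∧ p <= x := by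
    intro p hp
    refine ⟨(Nat.prime_of_mem_primesBelow hp).two_le, ?_⟩
    have := Nat.lt_of_mem_primesBelow hp
    exact (Nat.le_floor_iff hx0.le).1 (by omega)
  refine ⟨∑ p ∈ Nat.primesBelow (⌊x⌋₊+1), ∑' k, gk3 s x p k, ?_, ?_, ?_⟩
  · rw [logG2_eq hs0, <- SS_eq hx, sum_div, <- sum_add_distrib]
    refine sum_congr rfl fun p hp => ?_
    rw [(gk3_facts hε hx hs (hP p hp).1 (hP p hp).2).1]
    congr 1
    split_ifs <;> simp
  · exact sum_nonneg fun p hp => (gk3_facts hε hx hs (hP p hp).1 (hP p hp).2).2.1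
  · have hb : ∀ p ∈ Nat.primesBelow (⌊x⌋₊+1), ∑' k, gk3 s x p k <= (1+3/ε)*((if p <= x^(2/5:Real) then x^(-s) else 0) +
        (if p <= x^(1/2:Real) then x^(-(6*s/5)) else 0) + (if √x < p then (p:Real)^(-(3*s)) else 0)) := by
      intro p hp
      obtain ⟨hp2, hpx⟩ := hP p hp
      obtain ⟨-, -, f3, f4⟩ := gk3_facts hε hx hs hp2 hpx
      have hp0 : (0:Real) < p := by positivity
      have t1 : 0 <= (if (p:Real) <= x^(2/5:Real) then x^(-s) else 0) := by split_ifs <;> positivity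
      have t2 : 0 <= (if (p:Real) <= x^(1/2:Real) then x^(-(6*s/5)) else 0) := by split_ifs <;> positivity
      have t3 : 0 <= (if √x < (p:Real) then (p:Real)^(-(3*s)) else 0) := by split_ifs <;> positivity
      by_cases h1 : p <= x^(2/5:Real)
      · refine f3.trans (mul_le_mul_of_nonneg_left ?_ (by positivity))
        rw [if_pos h1]; linarith
      · have hlog : 2/5*log x <= log p := by
          rw [<- log_rpow hx0]; exact log_le_log (by positivity) (by linarith)
        refine (f4 hlog).trans (mul_le_mul_of_nonneg_left ?_ (by positivity))
        by_cases h2 : √x < p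
        · rw [if_pos h2]; linarith
        · have h3 : p <= x^(1/2:Real) := by rw [<- sqrt_eq_rpow]; linarith
          rw [if_pos h3]
          have : (p:Real)^(-(3*s)) <= x^(-(6*s/5)) := by
            rw [rpow_def_of_pos hp0, rpow_def_of_pos hx0]
            apply exp_le_exp.2; nlinarith
          linarith
    refine (sum_le_sum hb).trans ?_
    rw [<- mul_sum, sum_add_distrib, sum_add_distrib, SS_eq hx]
    gcongr
    · refine (cntP _ (by positivity) (by positivity)).trans (le_of_eq ?_)
      rw [<- rpow_add hx0]; ring_nf
    · refine (cntP _ (by positivity) (by positivity)).trans (le_of_eq ?_)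
      rw [<- rpow_add hx0]; ring_nf

lemma II_nn (a:Real) {x : Real} (hx : 2 <= x) : 0 <= MM a x ∧ 0 <= II a x := by
  obtain ⟨q1, q2, q3, q4⟩ := sq_facts hx
  have : 0 <= MM a x := intervalIntegral.integral_nonneg q2 fun t ht => rpow_nonneg (by linarith [ht.1]) _
  exact ⟨this, le_trans (by positivity) (I_bd a hx).1⟩

lemma pw_abs {s x e : Real} (hx : 4 <= x) (hs : 0 <= s) (hs1 : s <= 1) (he : e <= 1/2-s-1/20 ∨ e <= 1-2*s-1/20) :
    x^e <= 320*x^(-(1/40):Real)*II (2*s) x := by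
  have hx0 : 0 < x := by linarith
  have hl : 0 < log x := log_pos (by linarith)
  have hlx : log x <= 40*x^(1/40:Real) := by
    have := log_le_rpow_div hx0.le (by norm_num : (0:Real) < 1/40); linarith
  obtain ⟨m1, m2⟩ := MM_low (by linarith : 0 <= 2*s) (by linarith) hx
  have i1 := (I_bd (2*s) (by linarith : 2 <= x)).1
  rw [div_le_iff₀ hl] at i1
  have hI := (II_nn (2*s) (by linarith : 2 <= x)).2
  have hM : x^(e+1/20) <= 8*MM (2*s) x := by
    rcases he with h | h
    · have : x^(e+1/20) <= x^(1/2-2*s/2) := rpow_le_rpow_of_exponent_le (by linarith) (by linarith)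
      linarith
    · have : x^(e+1/20) <= x^(1-2*s) := rpow_le_rpow_of_exponent_le (by linarith) (by linarith)
      linarith [(II_nn (2*s) (by linarith : 2 <= x)).1]
  have e1 : x^e = x^(e+1/20)*x^(-(1/20):Real) := by rw [<- rpow_add hx0]; ring_nf
  have e2 : x^(-(1/40):Real) = x^(1/40:Real)*x^(-(1/20):Real) := by rw [<- rpow_add hx0]; norm_num
  rw [e1, e2]
  calc x^(e+1/20)*x^(-(1/20):Real) <= (8*(II (2*s) x*(40*x^(1/40:Real))))*x^(-(1/20):Real) := by
        gcongr
        refine hM.trans (mul_le_mul_of_nonneg_left (i1.trans ?_) (by norm_num))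
        gcongr
    _ = _ := by ring

lemma II3 {s x : Real} (hx : 4 <= x) (hs : 0 <= s) (hs1 : s <= 1) :
    II (3*s) x <= 8*(x^(-(1/40):Real)+x^(-s))*II (2*s) x := by
  have hx0 : 0 < x := by linarith
  have hx2 : 2 <= x := by linarith
  obtain ⟨q1, q2, q3, q4⟩ := sq_facts hx2
  have hI := (II_nn (2*s) hx2).2
  have k1 : 0 <= x^(-(1/40):Real)*II (2*s) x := by positivity
  have k2 : 0 <= x^(-s)*II (2*s) x := by positivity
  by_cases h : 1/10 <= s
  · have : II (3*s) x <= x^(-(1/40):Real)*II (2*s) x := by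
      rw [II, II, <- intervalIntegral.integral_const_mul]
      refine intervalIntegral.integral_mono_on q2 (ff_ii _ q1 q2) ((ff_ii _ q1 q2).const_mul _) fun t ht => ?_
      have ht0 : 0 < t := by linarith [ht.1]
      have hlt : 0 < log t := log_pos (by linarith [ht.1])
      have hlt2 : log x/2 <= log t := by rw [<- q3]; exact log_le_log (by linarith) ht.1
      rw [ff, ff, <- mul_div_assoc]
      gcongr
      rw [rpow_def_of_pos ht0, rpow_def_of_pos ht0, rpow_def_of_pos hx0, <- exp_add]
      apply exp_le_exp.2
      nlinarith
    linarith
  · have a1 := (I_bd (3*s) hx2).2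
    have a2 := MM_up (a := 3*s) (by linarith) hx2
    have a3 := (MM_low (by linarith : 0 <= 2*s) (by linarith) hx).2
    have a4 := (I_bd (2*s) hx2).1
    have e : x^(1-3*s) = x^(-s)*x^(1-2*s) := by rw [<- rpow_add hx0]; ring_nf
    have : II (3*s) x <= 8*(x^(-s)*II (2*s) x) := by
      calc _ <= 2*MM (3*s) x/log x := a1
        _ <= 2*(2*(x^(-s)*(2*MM (2*s) x)))/log x := by
          gcongr
          refine a2.trans ?_
          rw [e]; gcongr; linarith
        _ = 8*(x^(-s)*(MM (2*s) x/log x)) := by ring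
        _ <= _ := by gcongr
    linarith

lemma Q_eq {s x : Real} (hx : 2 <= x) : (if s = 1 / 2 then 1 / 2
        else (x ^ (1 - 2 * s) - x ^ (1 / 2 - s)) / ((1 - 2 * s) * Real.log x)) = MM (2*s) x / log x := by
  obtain ⟨q1, q2, q3, q4⟩ := sq_facts hx
  have hx0 : 0 < x := by linarith
  rw [MM]
  split_ifs with h
  · rw [h]
    have : ∫ t in √x..x, t^(-(2*(1/2)):Real) = log x/2 := by
      have e : ∀ t : Real, t^(-(2*(1/2)):Real) = t⁻¹ := fun t => by norm_num [rpow_neg_one]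
      simp_rw [e]
      rw [integral_inv_of_pos (by linarith) hx0, log_div hx0.ne' (by linarith), q3]; ring
    rw [this]; field_simp
  · rw [integral_rpow (Or.inr ⟨by intro h'; apply h; linarith, by
      rw [Set.uIcc_of_le q2]; intro h'; linarith [h'.1]⟩)]
    rw [sqrt_eq_rpow, <- rpow_mul hx0.le, div_div]
    ring_nf

lemma int_eq {s x : Real} (hx : 2 <= x) : (∫ t in Real.sqrt x..x, 1 / (t ^ (2 * s) * Real.log t)) = II (2*s) x := by
  obtain ⟨q1, q2, q3, q4⟩ := sq_facts hx
  apply intervalIntegral.integral_congr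
  intro t ht
  rw [Set.uIcc_of_le q2] at ht
  have h0 : 0 < t := by linarith [ht.1]
  simp only [ff]
  rw [rpow_neg h0.le, one_div, mul_inv, div_eq_mul_inv]

lemma exp_small {c C : Real} (hc : 0 < c) (hC : 0 < C) : ∃ X, ∀ x, exp (exp 1) <= x → X <= x → C*exp (-(c*tt x)) <= 1/2 := by
  obtain ⟨K, hK⟩ : ∃ K, K = 2*C/c := ⟨_, rfl⟩
  have hK0 : 0 < K := by rw [hK]; positivity
  refine ⟨exp (K^5+1), fun x hx hX => ?_⟩
  have h0 := (ee_facts hx).1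
  have h1 := (le_log_iff_exp_le h0).2 hX
  have h2 := log_le_tt hx
  have h3 : K <= tt x := by
    refine (pow_le_pow_iff_left₀ hK0.le (tt_pos hx).le (n := 5) (by norm_num)).1 ?_
    nlinarith
  have h4 : 2*C <= c*tt x := by
    rw [hK, div_le_iff₀ hc] at h3; linarith
  rw [exp_neg, <- div_eq_mul_inv, div_le_iff₀ (exp_pos _)]
  linarith [add_one_le_exp (c*tt x)]

lemma big_case {c C X1 : Real} (hc : 0 < c) (hC : 0 < C) (hX1 : exp (exp 1) <= X1)
    (H : ∀ x a, X1 <= x → 0 <= a → a <= 3 → |SS a x - II a x| <= C*exp (-(c*tt x))*II a x)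
    {ε s x : Real} (hε : 0 < ε) (hx : X1 <= x) (hx4 : 4 <= x) (hs : ε / log x <= s) (hs1 : s <= 1)
    (hsm : C*exp (-(c*tt x)) <= 1/2) :
    0 < II (2*s) x ∧ II (2*s) x/4 <= logG2 s x ∧
    |logG2 s x - II (2*s) x/2| <= (C + (1+3/ε)*652)*((Lfun x)^(-(min c (1/40))) + x^(-s)) * II (2*s) x := by
  have hx2 : 2 <= x := by linarith
  have hx0 : 0 < x := by linarith
  have hl : 0 < log x := log_pos (by linarith)
  have hs0 : 0 < s := lt_of_lt_of_le (by positivity) hs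
  have hee := hX1.trans hx
  have ht := tt_pos hee
  have htl := tt_le hee
  set J := II (2*s) x with hJ
  have hJ0 : 0 < J := by
    refine lt_of_lt_of_le ?_ (I_bd (2*s) hx2).1
    have := (MM_low (by linarith : 0 <= 2*s) (by linarith) hx4).2
    have h2 : 0 < x^(1-2*s) := by positivity
    exact div_pos (by linarith) hl
  set A := x^(-(1/40):Real) with hA
  set B := x^(-s) with hB
  set E := (Lfun x)^(-(min c (1/40))) with hE
  have eE : E = exp (-(min c (1/40)*tt x)) := by
    rw [hE, Lfun, <- exp_mul]; congr 1; rw [tt]; ring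
  have hAE : A <= E := by
    rw [eE, hA, rpow_def_of_pos hx0]
    apply exp_le_exp.2
    have : min c (1/40) * tt x <= 1/40 * tt x := mul_le_mul_of_nonneg_right (min_le_right _ _) ht.le
    linarith
  have hcE : exp (-(c*tt x)) <= E := by
    rw [eE]; apply exp_le_exp.2
    have : min c (1/40) * tt x <= c * tt x := mul_le_mul_of_nonneg_right (min_le_left _ _) ht.le
    linarith
  obtain ⟨R, e, hR0, hR⟩ := G_split hε hx2 hs
  have H2 := H x (2*s) hx (by linarith) (by linarith)
  have H3 := H x (3*s) hx (by linarith) (by linarith)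
  rw [<- hJ] at H2
  have k2 := (abs_le.1 H2).1
  have k3 := (abs_le.1 H3).2
  have n3 := (II_nn (3*s) hx2).2
  have i3 := II3 hx4 hs0.le hs1
  have p1 := pw_abs (e := 2/5-s) hx4 hs0.le hs1 (Or.inl (by linarith))
  have p2 := pw_abs (e := 1/2-6*s/5) hx4 hs0.le hs1 (by
    rcases le_total s (1/4) with h | h
    · right; linarith
    · left; linarith)
  rw [<- hJ, <- hA] at p1 p2 i3
  have s3 : SS (3*s) x <= 12*(A+B)*J := by
    have : C*exp (-(c*tt x))*II (3*s) x <= 1/2*II (3*s) x := mul_le_mul_of_nonneg_right hsm n3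
    linarith
  have hD : 0 < 1+3/ε := by positivity
  have hR2 : R <= (1+3/ε)*(652*((E+B)*J)) := by
    refine hR.trans (mul_le_mul_of_nonneg_left ?_ hD.le)
    have : A*J <= E*J := mul_le_mul_of_nonneg_right hAE hJ0.le
    have : 0 <= B*J := by positivity
    linarith
  refine ⟨hJ0, ?_, ?_⟩
  · have : C*exp (-(c*tt x))*J <= 1/2*J := mul_le_mul_of_nonneg_right hsm hJ0.le
    linarith
  · rw [e, (by ring : SS (2*s) x/2 + R - J/2 = (SS (2*s) x - J)/2 + R)]
    refine (abs_add_le _ _).trans ?_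
    rw [abs_of_nonneg hR0, abs_div, abs_two]
    have h1 : C*exp (-(c*tt x))*J <= C*E*J := by gcongr
    have h2 : 0 <= C*B*J := by positivity
    have h3 : 0 <= C*E*J := by rw [eE]; positivity
    linarith

lemma G_le {ε s x : Real} (hε : 0 < ε) (hx : 2 <= x) (hs : ε / log x <= s) : logG2 s x <= x*(1+3/ε) := by
  have hl : 0 < log x := log_pos (by linarith)
  have hs0 : 0 < s := lt_of_lt_of_le (by positivity) hs
  have hD : 0 < 1+3/ε := by positivity
  rw [logG2_eq hs0]
  refine le_trans (sum_le_sum fun p hp => ?_) (cntP (⌊x⌋₊+1) (by linarith : 0 <= x) hD.le)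
  have h1 := Nat.mem_primesBelow.1 hp
  have h2 : p <= x := (Nat.le_floor_iff (by linarith)).1 (by omega)
  rw [if_pos h2]
  refine (gk_sum_le hε hx hs h1.2.two_le h2).trans ?_
  exact mul_le_of_le_one_right hD.le (rpow_le_one_of_one_le_of_nonpos (by linarith) (by linarith))

lemma bert {x : Real} (hx : 2 <= x) : ∃ p : Nat, p.Prime ∧ √x < p ∧ (p:Real) <= x := by
  obtain ⟨q1, q2, q3, q4⟩ := sq_facts hx
  have hq := mul_self_sqrt (by linarith : 0 <= x)
  rcases lt_or_ge x 4 with h | h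
  · exact ⟨2, Nat.prime_two, by push_cast; nlinarith, by simpa using hx⟩
  · have h0 : ⌊√x⌋₊ ≠ 0 := by
      have := (Nat.one_le_floor_iff (√x)).2 q1.le
      omega
    obtain ⟨p, hp, h1, h2⟩ := Nat.exists_prime_lt_and_le_two_mul _ h0
    refine ⟨p, hp, (Nat.floor_lt (sqrt_nonneg _)).1 h1, ?_⟩
    have h3 : (p:Real) <= 2*⌊√x⌋₊ := by exact_mod_cast h2
    have h4 := Nat.floor_le (sqrt_nonneg x)
    nlinarith

lemma rp_low {x y a : Real} (hy : 1 <= y) (hyx : y <= x) (ha : a <= 2) : 1/x^2 <= y^(-a) := by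
  have : y^(-2:Real) <= y^(-a) := rpow_le_rpow_of_exponent_le hy (by linarith)
  refine le_trans ?_ this
  rw [rpow_neg (by linarith), rpow_two, <- one_div]
  gcongr

lemma small_case {X : Real} {ε s x : Real} (hε : 0 < ε) (hx : 2 <= x) (hxX : x <= X) (hs : ε / log x <= s) (hs1 : s <= 1) :
    1/(2*X^2) <= logG2 s x ∧ logG2 s x <= X*(1+3/ε) ∧ 1/(4*X^3) <= MM (2*s) x/log x ∧ MM (2*s) x/log x <= 2*X := by
  obtain ⟨q1, q2, q3, q4⟩ := sq_facts hx
  have hq := mul_self_sqrt (by linarith : 0 <= x)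
  have hs0 : 0 < s := lt_of_lt_of_le (by positivity) hs
  obtain ⟨R, e, hR0, hR⟩ := G_split hε hx hs
  have hX : 1/X^2 <= x^(-(2*s)) := rp_low (by linarith) hxX (by linarith)
  refine ⟨?_, ?_, ?_, ?_⟩
  · obtain ⟨p, hp, h1, h2⟩ := bert hx
    have h3 : p^(-(2*s)) <= SS (2*s) x := by
      refine single_le_sum (f := fun p : Nat => (p:Real)^(-(2*s))) (fun i _ => by positivity) ?_
      simp only [mem_filter, mem_Ioc]
      exact ⟨⟨(Nat.floor_lt (sqrt_nonneg _)).2 h1, Nat.le_floor h2⟩, hp⟩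
    have h4 : 1/X^2 <= p^(-(2*s)) := rp_low (by linarith) (h2.trans hxX) (by linarith)
    rw [e, (by field_simp : 1/(2*X^2) = 1/X^2/2)]
    linarith
  · exact (G_le hε hx hs).trans (by gcongr)
  · have h1 : (x-√x)*x^(-(2*s)) <= MM (2*s) x := pw_low (by linarith) (by linarith) q2
    have h2 : 1/2 <= x-√x := by nlinarith
    have h3 : log x <= X := (log_le_self (by linarith)).trans hxX
    have h0 : 0 < X := by linarith
    have h4 : 1/2*(1/X^2) <= (x-√x)*x^(-(2*s)) := by gcongr
    have h5 : (1/2*(1/X^2))/X <= MM (2*s) x/log x := by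
      apply div_le_div₀ (II_nn _ hx).1 (h4.trans h1) q4 h3
    refine le_trans ?_ h5
    rw [(by field_simp : (1/2*(1/X^2))/X = 1/(2*X^3))]
    gcongr; norm_num
  · have h1 : MM (2*s) x <= ∫ t in √x..x, 1 := by
      apply intervalIntegral.integral_mono_on q2 (pw_ii _ (by linarith) q2) intervalIntegrable_const
      intro t ht
      exact rpow_le_one_of_one_le_of_nonpos (by linarith [ht.1]) (by linarith)
    rw [intervalIntegral.integral_const, smul_eq_mul, mul_one] at h1
    have h2 : log 2 <= log x := log_le_log (by norm_num) hx
    have h3 := log_two_gt_d9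
    rw [div_le_iff₀ q4]
    nlinarith

lemma main : ∃ c : Real, 0 < c ∧ ∀ ε : Real, 0 < ε → ∃ cε Cε : Real, 0 < cε ∧ 0 < Cε ∧
      ∀ x s : Real, 2 <= x → ε / Real.log x <= s → s <= 1 →
      0 < II (2*s) x ∧ |logG2 s x - II (2*s) x/2| <= Cε * ((Lfun x) ^ (-c) + x ^ (-s))*(II (2*s) x/2) ∧
      cε*(MM (2*s) x/log x) <= logG2 s x ∧ logG2 s x <= Cε * (MM (2*s) x/log x) := by
  obtain ⟨c, C, X1, hc, hc1, hC, hX1, H⟩ := ps_main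
  obtain ⟨X2, hX2⟩ := exp_small hc hC
  refine ⟨min c (1/40), by positivity, fun ε hε => ?_⟩
  obtain ⟨X, hX⟩ : ∃ X, X = max (max X1 4) X2 := ⟨_, rfl⟩
  have b1 : X1 <= X := by rw [hX]; exact (le_max_left _ _).trans (le_max_left _ _)
  have b2 : 4 <= X := by rw [hX]; exact (le_max_right _ _).trans (le_max_left _ _)
  have b3 : X2 <= X := by rw [hX]; exact le_max_right _ _
  have hX0 : 0 < X := by linarith
  set D := 1+3/ε with hDd
  obtain ⟨K1, hK1⟩ : ∃ K, K = C + D*652 := ⟨_, rfl⟩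
  have hK10 : 0 < K1 := by rw [hK1]; positivity
  obtain ⟨K2, hK2⟩ : ∃ K, K = X*D + 2*X := ⟨_, rfl⟩
  have hK20 : 0 < K2 := by rw [hK2]; positivity
  refine ⟨min (1/4) (1/(4*X^3)), 4*K1 + 1 + 8*X^4*K2, by positivity, by positivity, fun x s hx hs hs1 => ?_⟩
  have hl : 0 < log x := log_pos (by linarith)
  have hs0 : 0 < s := lt_of_lt_of_le (by positivity) hs
  obtain ⟨i1, i2⟩ := I_bd (2*s) hx
  have hL : 0 < (Lfun x)^(-(min c (1/40))) := by unfold Lfun; positivity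
  rw [mul_div_assoc] at i2
  have hQ0 := div_nonneg (II_nn (2*s) hx).1 hl.le
  set Q := MM (2*s) x/log x with hQ
  set J := II (2*s) x with hJ
  set E := (Lfun x)^(-(min c (1/40))) with hE
  rcases le_total X x with h | h
  · have hee := hX1.trans (b1.trans h)
    obtain ⟨r1, r2, r3⟩ := big_case hc hC hX1 H hε (b1.trans h) (b2.trans h) hs hs1 (hX2 x hee (b3.trans h))
    rw [<- hJ, <- hE, <- hDd, <- hK1] at r3
    rw [<- hJ] at r1 r2
    have hE1 : E <= 1 := by
      rw [hE]; unfold Lfun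
      apply rpow_le_one_of_one_le_of_nonpos
      · exact one_le_exp (tt_pos hee).le
      · have : 0 < min c (1/40) := by positivity
        linarith
    have hB1 : x^(-s) <= 1 := rpow_le_one_of_one_le_of_nonpos (by linarith) (by linarith)
    refine ⟨r1, r3.trans ?_, ?_, ?_⟩
    · have : 0 <= (2*K1+1+8*X^4*K2) * ((E + x^(-s))*J) := by positivity
      linarith
    · have := mul_le_mul_of_nonneg_right (min_le_left (1/4) (1/(4*X^3))) hQ0
      linarith
    · have h1 := (abs_le.1 r3).2
      have h2 : K1*(E+x^(-s))*J <= K1*2*J := by gcongr; linarith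
      have h3 : K1*J <= K1*(2*Q) := by gcongr
      have h4 : 0 <= 8*X^4*K2*Q := by positivity
      linarith
  · obtain ⟨g1, g2, g3, g4⟩ := small_case hε hx h hs hs1
    rw [<- hDd] at g2
    rw [<- hQ] at g3 g4
    have hQp : 0 < Q := lt_of_lt_of_le (by positivity) g3
    have hJp : 0 < J := by linarith
    have hG0 : 0 < logG2 s x := lt_of_lt_of_le (by positivity) g1
    have hXQ : 1 <= 4*X^3*Q := by
      rw [div_le_iff₀ (by positivity)] at g3; linarith
    have hxs1 : 1/X <= x^(-s) := by
      have : x^(-1:Real) <= x^(-s) := rpow_le_rpow_of_exponent_le (by linarith) (by linarith)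
      refine le_trans ?_ this
      rw [rpow_neg_one, one_div]; gcongr
    have hX1' : 1 <= X*x^(-s) := by
      rw [div_le_iff₀ hX0] at hxs1; linarith
    refine ⟨hJp, ?_, ?_, ?_⟩
    · have a1 : |logG2 s x - J/2| <= K2 := by
        rw [abs_le]; constructor <;> linarith
      refine a1.trans ?_
      have a2 : 1 <= (X*x^(-s))*(4*X^3*J) := by
        have : 4*X^3*Q <= 4*X^3*J := by gcongr
        have := one_le_mul_of_one_le_of_one_le hX1' (hXQ.trans this)
        exact this
      have a3 : K2 <= K2*((X*x^(-s))*(4*X^3*J)) := le_mul_of_one_le_right hK20.le a2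
      have a4 : 0 <= (4*K1+1)*((E+x^(-s))*(J/2)) + 8*X^4*K2*(E*(J/2)) := by positivity
      linarith
    · have := mul_le_mul_of_nonneg_right (min_le_right (1/4) (1/(4*X^3))) hQ0
      refine this.trans (le_trans ?_ g1)
      calc 1/(4*X^3)*Q <= 1/(4*X^3)*(2*X) := by gcongr
        _ = _ := by field_simp; norm_num
    · have a1 : K2 <= K2*(4*X^3*Q) := le_mul_of_one_le_right hK20.le hXQ
      have a2 : K2*(4*X^3*Q) <= 8*X^4*K2*Q := by
        have := mul_le_mul_of_nonneg_right b2 (by positivity : 0 <= K2*X^3*Q)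
        have : 0 <= K2*X^3*Q := by positivity
        linarith
      have a3 : 0 <= (4*K1+1)*Q := by positivity
      linarith

end VK

theorem stmt18 :
    ∃ c : ℝ, 0 < c ∧ ∀ ε : ℝ, 0 < ε → ∃ cε Cε : ℝ, 0 < cε ∧ 0 < Cε ∧
      ∀ x s : ℝ, 2 ≤ x → ε / Real.log x ≤ s → s ≤ 1 →
      (∃ θ : ℝ, |θ| ≤ Cε * ((Lfun x) ^ (-c) + x ^ (-s)) ∧
        logG2 s x =
          (1 / 2) * (∫ t in Real.sqrt x..x, 1 / (t ^ (2 * s) * Real.log t)) * (1 + θ)) ∧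
      (let Q : ℝ := if s = 1 / 2 then 1 / 2
        else (x ^ (1 - 2 * s) - x ^ (1 / 2 - s)) / ((1 - 2 * s) * Real.log x)
       cε * Q ≤ logG2 s x ∧ logG2 s x ≤ Cε * Q) := by
  obtain ⟨c, hc, H⟩ := VK.main
  refine ⟨c, hc, fun ε hε => ?_⟩
  obtain ⟨a, b, ha, hb, H⟩ := H ε hε
  refine ⟨a, b, ha, hb, fun x s hx hs hs1 => ?_⟩
  obtain ⟨h0, h1, h2, h3⟩ := H x s hx hs hs1
  rw [VK.int_eq hx, VK.Q_eq hx]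
  refine ⟨⟨(logG2 s x - VK.II (2*s) x/2)/(VK.II (2*s) x/2), ?_, ?_⟩, h2, h3⟩
  · rw [abs_div, abs_of_pos (half_pos h0), div_le_iff₀ (half_pos h0)]
    exact h1
  · field_simp
    ring
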